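/- Under conditions (V1)–(V3), (V5), (V6) and the sub-quadratic growth condition (V4)': there exist g > 0, θ < 2 and r > 0 such that V_{ij}(t,ξ) ≤ g·m_i·m_j·|ξ|^θ for all t and all |ξ| > r, there exists a sequence (X^n) of non-collision T-periodic solutions of the N-body-type system ẍ_i(t) + ∇_{x_i} V(t, x_1(t),…,x_N(t)) = 0 (i = 1,…,N), each satisfying the antiperiodicity x_i^n(t + T/2) = −x_i^n(t), whose Lagrangian action values f(X^n) tend to +∞ (in particular the system has infinitely many distinct non-collision T-periodic solutions). -/

import Mathlib

open MeasureTheory Filter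

noncomputable section

/-- The total potential `V(t,x) = (1/2) ∑_{i ≠ j} V_{ij}(t, x_i - x_j)`. -/
def Vtot {N k : ℕ} (Vij : Fin N → Fin N → ℝ → EuclideanSpace ℝ (Fin k) → ℝ)
    (t : ℝ) (x : Fin N → EuclideanSpace ℝ (Fin k)) : ℝ :=
  (1 / 2) * ∑ i, ∑ j, if i ≠ j then Vij i j t (x i - x j) else 0

/-- The Lagrangian action of a `T`-periodic path. -/
def action {N k : ℕ} (T : ℝ) (m : Fin N → ℝ)
    (Vij : Fin N → Fin N → ℝ → EuclideanSpace ℝ (Fin k) → ℝ)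
    (X : ℝ → Fin N → EuclideanSpace ℝ (Fin k)) : ℝ :=
  (∑ i, m i / 2 * ∫ t in (0:ℝ)..T, ‖deriv (fun s => X s i) t‖ ^ 2)
    - ∫ t in (0:ℝ)..T, Vtot Vij t (X t)

section Brouwer

/-- A function that is Lipschitz on a closed ball and vanishes on its boundary sphere becomes
globally Lipschitz when extended by zero. -/
lemma lipschitzWith_extend_zero {E : Type*} [NormedAddCommGroup E] [NormedSpace ℝ E]
    {R : ℝ} {K : NNReal} {p : E → E}
    (hp : LipschitzOnWith K p (Metric.closedBall 0 R)) (h0 : ∀ x, ‖x‖ = R → p x = 0) :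
    LipschitzWith K (fun x => if ‖x‖ ≤ R then p x else 0) := by
  have key : ∀ x y : E, ‖x‖ ≤ R → ¬ ‖y‖ ≤ R → ‖p x‖ ≤ K * dist x y := by
    intro x y hx hy
    push Not at hy
    obtain ⟨z, hz, hzR⟩ : ∃ z ∈ segment ℝ x y, ‖z‖ = R := by
      have := (convex_segment (𝕜 := ℝ) x y).isPreconnected.intermediate_value
        (left_mem_segment ℝ x y) (right_mem_segment ℝ x y) continuous_norm.continuousOn
      obtain ⟨z, hz, h⟩ := this (show R ∈ Set.Icc ‖x‖ ‖y‖ from ⟨hx, hy.le⟩)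
      exact ⟨z, hz, h⟩
    have h1 := hp.dist_le_mul x (by simpa using hx) z (by simp [hzR])
    rw [h0 z hzR, dist_zero_right] at h1
    refine h1.trans (mul_le_mul_of_nonneg_left ?_ K.2)
    have := dist_add_dist_of_mem_segment hz
    linarith [dist_nonneg (x := z) (y := y)]
  refine LipschitzWith.of_dist_le_mul fun x y => ?_
  by_cases hx : ‖x‖ ≤ R <;> by_cases hy : ‖y‖ ≤ R <;> simp only [hx, hy, if_true, if_false]
  · exact hp.dist_le_mul x (by simpa using hx) y (by simpa using hy)
  · simpa using key x y hx hy
  · rw [dist_comm, dist_comm x y]; simpa using key y x hy hx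
  · simp; positivity

/-- Small perturbations of the identity supported in a ball preserve that ball. -/
lemma bijOn_ball_of_lipschitz {E : Type*} [NormedAddCommGroup E] [CompleteSpace E]
    {R : ℝ} {K : NNReal} {g : E → E} (hK : K < 1)
    (hg : LipschitzWith K g) (h0 : ∀ x, R ≤ ‖x‖ → g x = 0) :
    Function.Injective (fun x => x + g x) ∧
      (fun x => x + g x) '' (Metric.ball 0 R) = Metric.ball 0 R := by
  have inj : Function.Injective (fun x => x + g x) := by
    intro x y hxy
    by_contra hne
    have h1 : dist (g x) (g y) ≤ K * dist x y := hg.dist_le_mul x y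
    have h2 : dist (g x) (g y) = dist x y := by
      have : g x - g y = -(x - y) := by
        have : x + g x = y + g y := hxy
        rw [neg_sub, sub_eq_sub_iff_add_eq_add, add_comm, this, add_comm]
      rw [dist_eq_norm, this, norm_neg, dist_eq_norm]
    have h3 : 0 < dist x y := dist_pos.2 hne
    have h4 : (K : ℝ) < 1 := by exact_mod_cast hK
    nlinarith
  have surj : Function.Surjective (fun x => x + g x) := by
    intro y
    have hc : ContractingWith K (fun x => y - g x) := by
      refine ⟨hK, LipschitzWith.of_dist_le_mul fun a b => ?_⟩
      rw [dist_sub_left]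
      exact hg.dist_le_mul a b
    refine ⟨ContractingWith.fixedPoint _ hc, ?_⟩
    have := hc.fixedPoint_isFixedPt
    exact (sub_eq_iff_eq_add.1 this).symm
  refine ⟨inj, ?_⟩
  have hcompl : (fun x => x + g x) '' (Metric.ball 0 R)ᶜ = (Metric.ball 0 R)ᶜ := by
    have : Set.EqOn (fun x => x + g x) id (Metric.ball (0 : E) R)ᶜ := by
      intro x hx
      simp at hx
      simp [h0 x hx]
    rw [this.image_eq, Set.image_id]
  rw [Set.image_compl_eq ⟨inj, surj⟩] at hcompl
  exact compl_injective hcompl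

variable {E : Type*} [NormedAddCommGroup E] [InnerProductSpace ℝ E] [FiniteDimensional ℝ E]

/-- The determinant of `1 + r A` is a polynomial in `r`. -/
lemma exists_poly_det (A : E →L[ℝ] E) : ∃ P : Polynomial ℝ,
    P.degree < (Finset.range (Module.finrank ℝ E + 1)).card ∧
      ∀ r : ℝ, P.eval r = (1 + r • A).det := by
  let b := Module.finBasis ℝ E
  let M := LinearMap.toMatrix b b (A : E →ₗ[ℝ] E)
  refine ⟨Matrix.det ((Polynomial.X : Polynomial ℝ) • M.map Polynomial.C
    + (1 : Matrix _ _ ℝ).map Polynomial.C), ?_, fun r => ?_⟩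
  · refine lt_of_le_of_lt Polynomial.degree_le_natDegree ?_
    have := Polynomial.natDegree_det_X_add_C_le M 1
    simp only [Fintype.card_fin] at this
    rw [Finset.card_range]
    exact_mod_cast Nat.lt_succ_of_le this
  · have h1 : (1 + r • A).det =
        (LinearMap.toMatrix b b ((1 + r • A : E →L[ℝ] E) : E →ₗ[ℝ] E)).det := by
      rw [LinearMap.det_toMatrix]
    rw [h1, ← Polynomial.coe_evalRingHom, RingHom.map_det]
    congr 1
    have h2 : LinearMap.toMatrix b b ((1 + r • A : E →L[ℝ] E) : E →ₗ[ℝ] E) = 1 + r • M := by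
      simp [M, map_add, map_smul]
    rw [h2]
    ext i j
    by_cases hij : i = j <;> simp [hij] <;> ring


/-- If `p` vanishes on the sphere then `∫ det (1 + Dp)` over the ball is the volume of the ball. -/
lemma integral_det_one_add_fderiv [MeasurableSpace E] [BorelSpace E] {R : ℝ} {p : E → E}
    (hp : ContDiff ℝ 1 p) (h0 : ∀ x, ‖x‖ = R → p x = 0) :
    ∫ x in Metric.ball (0 : E) R, (1 + fderiv ℝ p x).det = volume.real (Metric.ball (0 : E) R) := by
  have hcD : Continuous (fderiv ℝ p) := hp.continuous_fderiv (by norm_num)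
  obtain ⟨K, hK⟩ := hp.contDiffOn.exists_lipschitzOnWith (s := Metric.closedBall (0 : E) R)
    one_ne_zero (convex_closedBall _ _) (isCompact_closedBall _ _)
  obtain ⟨K', hK'⟩ := (isCompact_closedBall (0 : E) R).exists_bound_of_continuousOn hcD.continuousOn
  -- small parameters
  obtain ⟨η, hη, hdet⟩ : ∃ η > 0, ∀ A : E →L[ℝ] E, ‖A‖ < η → 0 < (1 + A).det := by
    have hc : Continuous fun A : E →L[ℝ] E => (1 + A).det :=
      ContinuousLinearMap.continuous_det.comp (continuous_const.add continuous_id)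
    have h1 : ∀ᶠ A in nhds (0 : E →L[ℝ] E), 0 < (1 + A).det := by
      refine (hc.tendsto 0).eventually (lt_mem_nhds ?_)
      simp [ContinuousLinearMap.det]
    obtain ⟨η, hη, h⟩ := Metric.eventually_nhds_iff.1 h1
    exact ⟨η, hη, fun A hA => h (by simpa using hA)⟩
  set B : ℝ := max K K' with hB
  have hB0 : 0 ≤ B := le_max_of_le_left K.2
  set r₀ : ℝ := min 1 η / (B + 1) with hr₀
  have hr₀pos : 0 < r₀ := by positivity
  have hr₀B : r₀ * B < min 1 η := by
    rw [hr₀, div_mul_eq_mul_div, div_lt_iff₀ (by positivity)]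
    have : 0 < min 1 η := by positivity
    nlinarith
  have small : ∀ r : ℝ, 0 ≤ r → r ≤ r₀ →
      ∫ x in Metric.ball (0 : E) R, (1 + r • fderiv ℝ p x).det
        = volume.real (Metric.ball (0 : E) R) := by
    intro r hr hrr
    lift r to NNReal using hr
    set g : E → E := fun x => r • (if ‖x‖ ≤ R then p x else 0) with hg
    have hgL : LipschitzWith (r * K) g := by
      have h2 := lipschitzWith_extend_zero hK h0
      refine LipschitzWith.of_dist_le_mul fun x y => ?_
      have := h2.dist_le_mul x y
      simp only [hg, NNReal.smul_def, dist_smul₀]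
      rw [Real.norm_of_nonneg r.coe_nonneg, NNReal.coe_mul, mul_assoc]
      exact mul_le_mul_of_nonneg_left this r.2
    have hrK : r * K < 1 := by
      have : (r : ℝ) * K < 1 := by
        have h3 : (r : ℝ) * K ≤ r₀ * B :=
          mul_le_mul hrr (le_max_left _ _) K.2 hr₀pos.le
        exact (h3.trans_lt hr₀B).trans_le (min_le_left _ _)
      exact_mod_cast this
    obtain ⟨inj, him⟩ := bijOn_ball_of_lipschitz (R := R) hrK hgL (by
      intro x hx
      rcases hx.eq_or_lt with h | h
      · simp [hg, h0 x h.symm]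
      · simp [hg, not_le.2 h])
    have hd : ∀ x ∈ Metric.ball (0 : E) R, HasFDerivWithinAt (fun x => x + g x)
        (1 + (r : ℝ) • fderiv ℝ p x) (Metric.ball (0 : E) R) x := by
      intro x hx
      have h4 : HasFDerivAt (fun x => x + (r : ℝ) • p x) (1 + (r : ℝ) • fderiv ℝ p x) x :=
        (hasFDerivAt_id x).add
          ((hp.differentiable one_ne_zero x).hasFDerivAt.const_smul (r : ℝ))
      refine h4.hasFDerivWithinAt.congr' (fun y hy => ?_) hx
      simp only [hg]
      rw [if_pos (by simpa using (Metric.mem_ball.1 hy).le)]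
      rfl
    have := integral_image_eq_integral_abs_det_fderiv_smul volume Metric.isOpen_ball.measurableSet
      hd inj.injOn (fun _ => (1 : ℝ))
    rw [him] at this
    simp only [smul_eq_mul, mul_one, integral_const, MeasurableSet.univ, Measure.real,
      Measure.restrict_apply, Set.univ_inter] at this
    rw [Measure.real, this]
    refine setIntegral_congr_fun Metric.isOpen_ball.measurableSet fun x hx => ?_
    refine (abs_of_pos (hdet _ ?_)).symm
    rw [norm_smul, Real.norm_of_nonneg r.coe_nonneg]
    have h5 : (r : ℝ) * ‖fderiv ℝ p x‖ ≤ r₀ * B :=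
      mul_le_mul hrr ((hK' x (Metric.ball_subset_closedBall hx)).trans (le_max_right _ _))
        (norm_nonneg _) hr₀pos.le
    exact (h5.trans_lt hr₀B).trans_le (min_le_right _ _)
  -- interpolate
  set s := Finset.range (Module.finrank ℝ E + 1)
  set v : ℕ → ℝ := fun i => r₀ * (i / (Module.finrank ℝ E + 1)) with hv
  have hvi : Set.InjOn v s := by
    intro a _ b _ hab
    have : (a : ℝ) / (Module.finrank ℝ E + 1) = b / (Module.finrank ℝ E + 1) :=
      mul_left_cancel₀ hr₀pos.ne' hab
    have h6 : ((Module.finrank ℝ E : ℝ) + 1) ≠ 0 := by positivity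
    rw [div_left_inj' h6] at this
    exact_mod_cast this
  have hpt : ∀ x, (1 + fderiv ℝ p x).det
      = ∑ i ∈ s, (1 + v i • fderiv ℝ p x).det * (Lagrange.basis s v i).eval 1 := by
    intro x
    obtain ⟨P, hP, hPe⟩ := exists_poly_det (fderiv ℝ p x)
    have h7 := Lagrange.eq_interpolate hvi hP
    have h8 := hPe 1
    rw [one_smul] at h8
    rw [← h8, h7, Lagrange.interpolate_apply, Polynomial.eval_finsetSum]
    simp [hPe]
  simp_rw [hpt]
  rw [integral_finsetSum]
  · have : ∀ i ∈ s, ∫ x in Metric.ball (0 : E) R,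
        (1 + v i • fderiv ℝ p x).det * (Lagrange.basis s v i).eval 1
        = volume.real (Metric.ball (0 : E) R) * (Lagrange.basis s v i).eval 1 := by
      intro i hi
      rw [integral_mul_const, small (v i) (by positivity)]
      have h9 : ((i : ℝ) / (Module.finrank ℝ E + 1)) ≤ 1 := by
        rw [div_le_one (by positivity)]
        exact_mod_cast (Finset.mem_range.1 hi).le
      simp only [hv]
      nlinarith
    rw [Finset.sum_congr rfl this, ← Finset.mul_sum, ← Polynomial.eval_finsetSum,
      Lagrange.sum_basis hvi ⟨0, by simp [s]⟩]
    simp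
  · intro i _
    refine Integrable.mono_measure ?_ (Measure.restrict_mono Metric.ball_subset_closedBall le_rfl)
    refine (Continuous.continuousOn ?_).integrableOn_compact (isCompact_closedBall _ _)
    have hc : Continuous fun x => 1 + v i • fderiv ℝ p x := by fun_prop
    exact (ContinuousLinearMap.continuous_det.comp hc).mul continuous_const

/-- There is no `C¹` nonvanishing map that is the identity on a sphere. -/
lemma exists_zero_of_contDiff {R : ℝ} (hR : 0 < R) {G : E → E} (hG : ContDiff ℝ 1 G)
    (h1 : ∀ x, ‖x‖ = R → G x = x) : ∃ x, G x = 0 := by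
  by_contra! h
  let _ : MeasurableSpace E := borel E
  have : BorelSpace E := ⟨rfl⟩
  set u : E → E := fun x => (R / ‖G x‖) • G x with hu
  have hun : ∀ x, ‖u x‖ = R := fun x => by
    have := norm_pos_iff.2 (h x)
    rw [hu, norm_smul, norm_div, norm_norm, Real.norm_of_nonneg hR.le]
    field_simp
  have huc : ContDiff ℝ 1 u :=
    (contDiff_const.div (hG.norm ℝ h) fun x => (norm_pos_iff.2 (h x)).ne').smul hG
  have hdet : ∀ x, (1 + fderiv ℝ (fun x => u x - x) x).det = 0 := by
    intro x
    have hd : HasFDerivAt u (fderiv ℝ u x) x := (huc.differentiable one_ne_zero x).hasFDerivAt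
    have : fderiv ℝ (fun x => u x - x) x = fderiv ℝ u x - 1 :=
      (hd.sub (hasFDerivAt_id x)).fderiv
    rw [this, add_sub_cancel]
    by_contra hne
    obtain ⟨v, hv⟩ : ∃ v, fderiv ℝ u x v = u x :=
      (LinearEquiv.ofIsUnitDet (f := (fderiv ℝ u x : E →ₗ[ℝ] E)) (v := Module.finBasis ℝ E)
        (v' := Module.finBasis ℝ E) (by
          rw [LinearMap.det_toMatrix]; exact isUnit_iff_ne_zero.2 hne)).surjective (u x)
    have h2 : HasFDerivAt (fun y => inner ℝ (u y) (u y)) (0 : E →L[ℝ] ℝ) x := by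
      have : (fun y => inner ℝ (u y) (u y)) = fun _ => R ^ 2 := by
        ext y; rw [real_inner_self_eq_norm_sq, hun]
      rw [this]; exact hasFDerivAt_const _ _
    have h3 := congrArg (fun L => L v) (h2.unique (hd.inner ℝ hd))
    simp [hv, hun] at h3
    nlinarith
  have h4 := integral_det_one_add_fderiv (R := R) (huc.sub contDiff_id) (by
    intro x hx
    simp only [hu, h1 x hx, hx, id]
    rw [div_self hR.ne', one_smul, sub_self])
  simp only [id, hdet, integral_zero] at h4
  exact (ENNReal.toReal_pos (Metric.measure_ball_pos volume (0 : E) hR).ne'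
    measure_ball_lt_top.ne).ne h4

/-- A continuous self-map of a Euclidean space that is the identity outside a ball has a zero. -/
lemma exists_zero_of_eq_self {R : ℝ} {G : E → E} (hG : Continuous G)
    (h1 : ∀ x, R ≤ ‖x‖ → G x = x) : ∃ x, G x = 0 := by
  by_contra! h
  obtain ⟨g, hg, hgd, hgs⟩ := (hG.sub continuous_id).exists_contDiff_approx 1 hG.norm
    (fun x => norm_pos_iff.2 (h x))
  obtain ⟨x, hx⟩ := exists_zero_of_contDiff (R := |R| + 1) (by positivity)
    (G := fun x => x + g x) (contDiff_id.add hg) (by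
      intro x hx
      have : x ∉ Function.support g := fun hs => by
        have := hgs hs
        simp [h1 x (by rw [hx]; linarith [le_abs_self R])] at this
      simpa using this)
  have := hgd x
  rw [eq_neg_of_add_eq_zero_right hx, dist_eq_norm] at this
  simp [← norm_neg (-x - (G x - x))] at this

end Brouwer

/-- A Poincaré–Miranda theorem on the cube `[-L, L]^ι`. -/
lemma poincare_miranda {ι : Type*} [Fintype ι] {L : ℝ} (hL : 0 < L) {F : (ι → ℝ) → ι → ℝ}
    (hF : ContinuousOn F {x | ∀ i, |x i| ≤ L})
    (hs : ∀ x, (∀ i, |x i| ≤ L) → ∀ i, |x i| = L → 0 ≤ F x i * x i) :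
    ∃ x, (∀ i, |x i| ≤ L) ∧ F x = 0 := by
  by_contra! h
  set c : (ι → ℝ) → ι → ℝ := fun x i => max (-L) (min L (x i)) with hc
  have hcc : Continuous c := by fun_prop
  have hcb : ∀ x i, |c x i| ≤ L := fun x i =>
    abs_le.2 ⟨le_max_left _ _, max_le (by linarith) (min_le_left _ _)⟩
  set μ : (ι → ℝ) → ℝ := fun x => min 1 ‖x - c x‖ with hμ
  have hFc : Continuous fun x => F (c x) := hF.comp_continuous hcc hcb
  set G : EuclideanSpace ℝ ι → EuclideanSpace ℝ ι := fun y => WithLp.toLp 2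
    ((1 - μ y.ofLp) • F (c y.ofLp) + μ y.ofLp • y.ofLp) with hG
  have hμc : Continuous μ := by fun_prop
  have hGc : Continuous G := by
    have h2 : Continuous fun x : ι → ℝ => (1 - μ x) • F (c x) + μ x • x :=
      ((continuous_const.sub hμc).smul hFc).add (hμc.smul continuous_id)
    exact (PiLp.continuous_toLp 2 _).comp (h2.comp (PiLp.continuous_ofLp 2 _))
  have hbig : ∀ x : ι → ℝ, ∀ i, L + 1 ≤ |x i| → μ x = 1 := by
    intro x i hi
    refine min_eq_left (le_trans ?_ (norm_le_pi_norm (x - c x) i))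
    have h1 := hcb x i
    rw [Pi.sub_apply, Real.norm_eq_abs]
    linarith [abs_sub_abs_le_abs_sub (x i) (c x i)]
  obtain ⟨y, hy⟩ := exists_zero_of_eq_self (R := Real.sqrt (Fintype.card ι) * (L + 1)) hGc (by
    intro y hy
    suffices hμ1 : μ y.ofLp = 1 by simp [hG, hμ1]
    rcases isEmpty_or_nonempty ι with hι | hι
    · exact absurd (Subsingleton.elim _ _) (h 0 (fun i => (IsEmpty.false i).elim))
    by_contra hne
    have hlt : ∀ i, |y i| < L + 1 := fun i => by
      by_contra hcon
      exact hne (hbig y.ofLp i (not_lt.1 hcon))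
    have : ‖y‖ < Real.sqrt (Fintype.card ι) * (L + 1) := by
      rw [EuclideanSpace.norm_eq, ← Real.sqrt_sq (by linarith : 0 ≤ L + 1),
        ← Real.sqrt_mul (by positivity)]
      refine Real.sqrt_lt_sqrt (by positivity) ?_
      rw [← nsmul_eq_mul, ← Finset.card_univ, ← Finset.sum_const]
      refine Finset.sum_lt_sum_of_nonempty Finset.univ_nonempty fun i _ => ?_
      rw [Real.norm_eq_abs]
      exact pow_lt_pow_left₀ (hlt i) (abs_nonneg _) two_ne_zero
    linarith)
  set x : ι → ℝ := y.ofLp with hx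
  have hx0 : ∀ i, (1 - μ x) * F (c x) i + μ x * x i = 0 := fun i => by
    have := congrArg (fun z => z.ofLp i) hy
    simpa [hG] using this
  have hμ0 : 0 ≤ μ x := by positivity
  have hμ1 : μ x ≤ 1 := min_le_left _ _
  by_cases hin : x = c x
  · refine h x (fun i => hin ▸ hcb x i) (funext fun i => ?_)
    have hz : μ x = 0 := by
      have : x - c x = 0 := sub_eq_zero.2 hin
      simp [hμ, this]
    have := hx0 i
    rw [hz, ← hin] at this
    simpa using this
  · obtain ⟨i, hi⟩ := Function.ne_iff.1 hin
    have hμpos : 0 < μ x := lt_min one_pos (norm_pos_iff.2 (sub_ne_zero.2 hin))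
    have hci : |c x i| = L ∧ 0 < c x i * x i := by
      simp only [hc] at hi ⊢
      rcases lt_or_ge L (x i) with h2 | h2
      · rw [min_eq_left h2.le, max_eq_right (by linarith)]
        exact ⟨abs_of_pos hL, by nlinarith⟩
      · rw [min_eq_right h2] at hi ⊢
        rcases lt_or_ge (x i) (-L) with h3 | h3
        · rw [max_eq_left h3.le, abs_neg]
          exact ⟨abs_of_pos hL, by nlinarith⟩
        · exact absurd (max_eq_right h3).symm hi
    have h4 := hs (c x) (hcb x) i hci.1
    have h5 := congrArg (· * c x i) (hx0 i)
    simp only [zero_mul] at h5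
    nlinarith [mul_nonneg (sub_nonneg.2 hμ1) h4, mul_pos hμpos hci.2]

section Alternation

open unitInterval

/-- Families of `n` vectors of sup-norm one in `ℝ^(d+1)`. -/
abbrev UnitFamily (n d : ℕ) := {s : Fin n → Fin (d + 1) → ℝ // ∀ i, ‖s i‖ = 1}

open Classical in
/-- Normalization of each vector of a family (with a default value if one of them vanishes). -/
def unitFamily {n d : ℕ} (v : Fin n → Fin (d + 1) → ℝ) : UnitFamily n d :=
  if h : ∀ i, v i ≠ 0 then
    ⟨fun i => ‖v i‖⁻¹ • v i, fun i => by
      rw [norm_smul, norm_inv, norm_norm, inv_mul_cancel₀ (norm_ne_zero_iff.2 (h i))]⟩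
  else ⟨fun _ _ => 1, fun _ => by simp [pi_norm_const]⟩

lemma unitFamily_apply {n d : ℕ} {v : Fin n → Fin (d + 1) → ℝ} (h : ∀ i, v i ≠ 0) (i : Fin n) :
    (unitFamily v).1 i = ‖v i‖⁻¹ • v i := by
  rw [unitFamily, dif_pos h]

lemma continuousOn_unitFamily {n d : ℕ} :
    ContinuousOn (unitFamily (n := n) (d := d)) {v | ∀ i, v i ≠ 0} := by
  rw [continuousOn_iff_continuous_domRestrict, continuous_induced_rng]
  refine continuous_pi fun i => ?_
  have : (fun v : {v : Fin n → Fin (d + 1) → ℝ | ∀ i, v i ≠ 0} => ‖v.1 i‖⁻¹ • v.1 i)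
      = fun v => (unitFamily v.1).1 i := by
    ext1 v
    rw [unitFamily_apply v.2]
  change Continuous fun v : {v : Fin n → Fin (d + 1) → ℝ | ∀ i, v i ≠ 0} => (unitFamily v.1).1 i
  rw [← this]
  have hc : Continuous fun v : {v : Fin n → Fin (d + 1) → ℝ | ∀ i, v i ≠ 0} => v.1 i :=
    (continuous_apply i).comp continuous_subtype_val
  exact (hc.norm.inv₀ fun v => norm_ne_zero_iff.2 (v.2 i)).smul hc

/-- Nondecreasing instants of `[0, 1]` read off the norms of a family of vectors. -/
def runningTime {n d : ℕ} (v : Fin n → Fin (d + 1) → ℝ) (i : Fin n) : I :=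
  Set.projIcc 0 1 zero_le_one ((Finset.Iic i).sup' ⟨i, by simp⟩ fun j => ‖v j‖ - 1)

lemma continuous_runningTime {n d : ℕ} (i : Fin n) :
    Continuous fun v : Fin n → Fin (d + 1) → ℝ => runningTime v i := by
  refine continuous_projIcc.comp (Continuous.finset_sup'_apply _ fun j _ => ?_)
  fun_prop

lemma monotone_runningTime {n d : ℕ} (v : Fin n → Fin (d + 1) → ℝ) : Monotone (runningTime v) :=
  fun _ _ hij => Set.monotone_projIcc _
    (Finset.sup'_mono _ (Finset.Iic_subset_Iic.2 hij) _)

lemma runningTime_eq_one {n d : ℕ} {v : Fin n → Fin (d + 1) → ℝ} {i : Fin n} (h : 2 ≤ ‖v i‖) :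
    runningTime v i = 1 := by
  refine Set.projIcc_of_right_le _ ?_
  refine le_trans ?_ (Finset.le_sup' (fun j => ‖v j‖ - 1) (Finset.mem_Iic.2 le_rfl))
  linarith

lemma runningTime_eq_of_norm_le_one {n d : ℕ} {v : Fin n → Fin (d + 1) → ℝ} {i : Fin n}
    (h : ‖v i‖ ≤ 1) : runningTime v i = 0 ∨
      ∃ j : Fin n, (i : ℕ) = j + 1 ∧ runningTime v i = runningTime v j := by
  rcases Nat.eq_zero_or_pos i with hi | hi
  · left
    refine Set.projIcc_of_le_left _ (Finset.sup'_le _ _ fun j hj => ?_)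
    have : j = i := le_antisymm (Finset.mem_Iic.1 hj) (Fin.le_def.2 (by omega))
    rw [this]; linarith
  · right
    refine ⟨⟨i - 1, by omega⟩, by simp; omega, ?_⟩
    refine le_antisymm ?_ (monotone_runningTime v (Fin.le_def.2 (by simp)))
    rw [← Subtype.coe_le_coe]
    simp only [runningTime, Set.coe_projIcc]
    refine max_le (le_max_left _ _) ?_
    rcases le_or_gt ((Finset.Iic i).sup' ⟨i, by simp⟩ fun j => ‖v j‖ - 1) 0 with h0 | h0
    · exact le_max_of_le_left ((min_le_right _ _).trans h0)
    · refine le_max_of_le_right (min_le_min le_rfl ?_)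
      obtain ⟨j, hj, hje⟩ := Finset.exists_mem_eq_sup' (s := Finset.Iic i) ⟨i, by simp⟩
        (fun j => ‖v j‖ - 1)
      rw [hje] at h0 ⊢
      refine Finset.le_sup' (fun j => ‖v j‖ - 1) (Finset.mem_Iic.2 ?_)
      have hne : j ≠ i := fun hji => by rw [hji] at h0; linarith
      have := lt_of_le_of_ne (Finset.mem_Iic.1 hj) hne
      exact Fin.le_def.2 (by simp; omega)

/-- If `runningTime` strictly increases at `i` and stays inside `(0, 1)`, it is read off `v i`. -/
lemma runningTime_eq_norm {n d : ℕ} {v : Fin n → Fin (d + 1) → ℝ} {i : Fin n}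
    (h0 : 0 < runningTime v i) (h1 : runningTime v i < 1)
    (h : ∀ j < i, runningTime v j < runningTime v i) : (runningTime v i : ℝ) = ‖v i‖ - 1 := by
  obtain ⟨j, hj, hje⟩ := Finset.exists_mem_eq_sup' (s := Finset.Iic i) ⟨i, by simp⟩
    (fun j => ‖v j‖ - 1)
  have hji : j = i := by
    by_contra hne
    refine (h j (lt_of_le_of_ne (Finset.mem_Iic.1 hj) hne)).not_ge (Set.monotone_projIcc _ ?_)
    rw [hje]
    exact Finset.le_sup' (fun j => ‖v j‖ - 1) (Finset.mem_Iic.2 le_rfl)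
  subst hji
  rw [← Subtype.coe_lt_coe] at h0 h1
  simp only [runningTime, hje, Set.coe_projIcc] at h0 h1 ⊢
  simp only [Set.Icc.coe_zero, Set.Icc.coe_one, lt_max_iff, max_lt_iff, lt_min_iff, min_lt_iff,
    lt_irrefl, false_or] at h0 h1
  rw [min_eq_right (by linarith), max_eq_right h0.2.le]


variable {n d : ℕ} (Z : C(I × UnitFamily n d × I, ℝ × (Fin (d + 1) → ℝ)))

/-- The points of the moving path sampled at the running times of `v`. -/
def sample (l : I) (v : Fin n → Fin (d + 1) → ℝ) (i : Fin n) : ℝ × (Fin (d + 1) → ℝ) :=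
  Z (l, unitFamily v, runningTime v i)

/-- The signed cosine-like quantity measuring how close a sampled point is to the `i`-th ray. -/
def rayQuot (l : I) (v : Fin n → Fin (d + 1) → ℝ) (i : Fin n) : ℝ :=
  (-1) ^ (i : ℕ) * (sample Z l v i).2 0 / ‖sample Z l v i‖

/-- The positive part of the smallest `rayQuot`. -/
def minRayQuot [NeZero n] (l : I) (v : Fin n → Fin (d + 1) → ℝ) : ℝ :=
  max 0 (Finset.univ.inf' Finset.univ_nonempty (rayQuot Z l v))

/-- The components of a point which are transversal to the ray. -/
def transversal (w : ℝ × (Fin (d + 1) → ℝ)) (j : Fin (d + 1)) : ℝ :=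
  if j = 0 then -w.1 else w.2 j

variable {Z}

lemma continuousOn_sample (i : Fin n) : ContinuousOn
    (fun p : I × (Fin n → Fin (d + 1) → ℝ) => sample Z p.1 p.2 i) {p | ∀ i, p.2 i ≠ 0} := by
  refine Z.continuous.comp_continuousOn ?_
  refine continuousOn_fst.prodMk ((continuousOn_unitFamily.comp continuousOn_snd
    fun p hp => hp).prodMk ?_)
  exact ((continuous_runningTime i).comp continuous_snd).continuousOn

lemma continuousOn_rayQuot (hne : ∀ x, Z x ≠ 0) (i : Fin n) : ContinuousOn
    (fun p : I × (Fin n → Fin (d + 1) → ℝ) => rayQuot Z p.1 p.2 i) {p | ∀ i, p.2 i ≠ 0} := by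
  refine ContinuousOn.div (continuousOn_const.mul ?_) (continuousOn_sample i).norm
    fun p _ => norm_ne_zero_iff.2 (hne _)
  exact ((continuous_apply 0).comp continuous_snd).comp_continuousOn (continuousOn_sample i)

lemma continuousOn_minRayQuot [NeZero n] (hne : ∀ x, Z x ≠ 0) : ContinuousOn
    (fun p : I × (Fin n → Fin (d + 1) → ℝ) => minRayQuot Z p.1 p.2) {p | ∀ i, p.2 i ≠ 0} := by
  refine ContinuousOn.sup continuousOn_const ?_
  exact ContinuousOn.finset_inf'_apply _ fun i _ => continuousOn_rayQuot hne i

lemma minRayQuot_nonneg [NeZero n] (l : I) (v : Fin n → Fin (d + 1) → ℝ) : 0 ≤ minRayQuot Z l v :=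
  le_max_left _ _

lemma minRayQuot_le [NeZero n] {l : I} {v : Fin n → Fin (d + 1) → ℝ} (h : 0 < minRayQuot Z l v)
    (i : Fin n) : minRayQuot Z l v ≤ rayQuot Z l v i := by
  rcases le_total (Finset.univ.inf' Finset.univ_nonempty (rayQuot Z l v)) 0 with h0 | h0
  · rw [minRayQuot, max_eq_left h0] at h
    exact absurd h (lt_irrefl _)
  · rw [minRayQuot, max_eq_right h0]
    exact Finset.inf'_le _ (Finset.mem_univ i)

lemma minRayQuot_eq_zero [NeZero n] {l : I} {v : Fin n → Fin (d + 1) → ℝ} {i : Fin n}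
    (h : rayQuot Z l v i ≤ 0) : minRayQuot Z l v = 0 :=
  max_eq_left ((Finset.inf'_le _ (Finset.mem_univ i)).trans h)

/-- If the sampled points are on the axis then the smallest quotient cannot be intermediate. -/
lemma minRayQuot_eq_one [NeZero n] {l : I} {v : Fin n → Fin (d + 1) → ℝ} (hne : ∀ x, Z x ≠ 0)
    (h : 0 < minRayQuot Z l v) (ht : ∀ i, transversal (sample Z l v i) = 0) :
    minRayQuot Z l v = 1 := by
  have hq : ∀ i, rayQuot Z l v i = 1 := by
    intro i
    have h1 : (sample Z l v i).1 = 0 := by simpa [transversal] using congrFun (ht i) 0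
    have h2 : ∀ j, j ≠ 0 → (sample Z l v i).2 j = 0 := fun j hj => by
      simpa [transversal, hj] using congrFun (ht i) j
    have h3 : ‖sample Z l v i‖ = |(sample Z l v i).2 0| := by
      refine le_antisymm ?_ ((norm_le_pi_norm (sample Z l v i).2 0).trans (norm_snd_le _))
      refine norm_prod_le_iff.2 ⟨by simp [h1], (pi_norm_le_iff_of_nonneg (abs_nonneg _)).2 ?_⟩
      intro j
      rcases eq_or_ne j 0 with rfl | hj
      · exact le_rfl
      · simp [h2 j hj]
    have h4 : |rayQuot Z l v i| = 1 := by
      rw [rayQuot, abs_div, abs_mul, abs_pow, abs_neg, abs_one, one_pow, one_mul, abs_norm, ← h3]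
      exact div_self (norm_ne_zero_iff.2 (hne _))
    rw [← h4, abs_of_pos (h.trans_le (minRayQuot_le h i))]
  rw [minRayQuot, funext hq]
  simp

lemma minRayQuot_eq_zero_of_norm_le_one [NeZero n] {l : I} {v : Fin n → Fin (d + 1) → ℝ}
    (h0 : ∀ l s, (Z (l, s, 0)).2 = 0) {i : Fin n} (hi : ‖v i‖ ≤ 1) : minRayQuot Z l v = 0 := by
  rcases runningTime_eq_of_norm_le_one hi with h | ⟨j, hij, h⟩
  · refine minRayQuot_eq_zero (i := i) ?_
    simp [rayQuot, sample, h, h0]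
  · have : rayQuot Z l v i = - rayQuot Z l v j := by
      rw [rayQuot, rayQuot, sample, sample, h, hij, pow_succ]
      ring
    rcases le_total (rayQuot Z l v i) 0 with h1 | h1
    · exact minRayQuot_eq_zero h1
    · exact minRayQuot_eq_zero (i := j) (by linarith)

lemma minRayQuot_eq_zero_of_two_le_norm [NeZero n] {l : I} {v : Fin n → Fin (d + 1) → ℝ}
    (h1 : ∀ l s, (Z (l, s, 1)).2 = 0) {i : Fin n} (hi : 2 ≤ ‖v i‖) : minRayQuot Z l v = 0 := by
  refine minRayQuot_eq_zero (i := i) ?_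
  simp [rayQuot, sample, runningTime_eq_one hi, h1]

open Classical in
/-- The map whose zeros are excluded by the degree argument. -/
def ansatz [NeZero n] (Z : C(I × UnitFamily n d × I, ℝ × (Fin (d + 1) → ℝ)))
    (p : I × (Fin n → Fin (d + 1) → ℝ)) : (Fin n → Fin (d + 1) → ℝ) × ℝ :=
  if ∃ i, ‖p.2 i‖ ≤ 1 then (0, 1)
  else (fun i => minRayQuot Z p.1 p.2 • transversal (sample Z p.1 p.2 i),
    1 - 2 * minRayQuot Z p.1 p.2)

lemma ansatz_eq [NeZero n] (h0 : ∀ l s, (Z (l, s, 0)).2 = 0)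
    (p : I × (Fin n → Fin (d + 1) → ℝ)) : ansatz Z p =
      (fun i => minRayQuot Z p.1 p.2 • transversal (sample Z p.1 p.2 i),
        1 - 2 * minRayQuot Z p.1 p.2) := by
  by_cases h : ∃ i, ‖p.2 i‖ ≤ 1
  · rw [ansatz, if_pos h]
    obtain ⟨i, hi⟩ := h
    rw [minRayQuot_eq_zero_of_norm_le_one h0 hi]
    ext <;> simp
  · rw [ansatz, if_neg h]

lemma continuous_transversal : Continuous (transversal (d := d)) := by
  refine continuous_pi fun j => ?_
  by_cases hj : j = 0 <;> simp only [transversal, hj, if_true, if_false] <;> fun_prop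

lemma continuous_ansatz [NeZero n] (hne : ∀ x, Z x ≠ 0) (h0 : ∀ l s, (Z (l, s, 0)).2 = 0) :
    Continuous (ansatz Z) := by
  refine continuous_iff_continuousAt.2 fun p => ?_
  by_cases h : ∃ i, ‖p.2 i‖ < 1
  · obtain ⟨i, hi⟩ := h
    have hev : ∀ᶠ q : I × (Fin n → Fin (d + 1) → ℝ) in nhds p, ‖q.2 i‖ < 1 :=
      ContinuousAt.eventually_lt (by fun_prop) continuousAt_const hi
    refine (continuousAt_const (y := ((0, 1) : (Fin n → Fin (d + 1) → ℝ) × ℝ))).congr ?_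
    filter_upwards [hev] with q hq
    rw [ansatz, if_pos ⟨i, hq.le⟩]
  · push Not at h
    have hU : {p : I × (Fin n → Fin (d + 1) → ℝ) | ∀ i, p.2 i ≠ 0} ∈ nhds p := by
      refine IsOpen.mem_nhds ?_ fun i hi => ?_
      · simp only [Set.ofPred_forall]
        exact isOpen_iInter_of_finite fun i => isOpen_ne_fun (by fun_prop) continuous_const
      · have := h i
        simp [hi] at this
        linarith
    rw [show ansatz Z = _ from funext (ansatz_eq h0)]
    refine ContinuousOn.continuousAt ?_ hU
    refine ContinuousOn.prodMk (continuousOn_pi.2 fun i => ?_) ?_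
    · exact (continuousOn_minRayQuot hne).smul
        (continuous_transversal.comp_continuousOn (continuousOn_sample i))
    · exact continuousOn_const.sub (continuousOn_const.mul (continuousOn_minRayQuot hne))


/-- Positivity of all quotients for the base family forces the running times into the supports
of the corresponding bumps. -/
lemma sample_base [NeZero n] {a : ℝ → ℝ} {b : Fin n → ℝ → ℝ}
    (hbase : ∀ s t, Z (0, s, t) = (a t, ∑ i, b i t • s.1 i))
    (hb : ∀ i, ∀ t : I, 0 ≤ b i t)
    (hbmono : ∀ i j, i < j → ∀ t t' : I, 0 < b i t → 0 < b j t' → t < t')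
    {v : Fin n → Fin (d + 1) → ℝ} (hχ : 0 < minRayQuot Z 0 v) (i : Fin n) :
    0 < b i (runningTime v i) ∧
      (sample Z 0 v i).2 = b i (runningTime v i) • (unitFamily v).1 i ∧
      0 < (-1) ^ (i : ℕ) * (unitFamily v).1 i 0 := by
  have hex : ∀ i, ∃ j, 0 < b j (runningTime v i) ∧ 0 < (-1) ^ (i : ℕ) * (unitFamily v).1 j 0 := by
    intro i
    have h1 : 0 < rayQuot Z 0 v i := hχ.trans_le (minRayQuot_le hχ i)
    have h2 : 0 < (-1) ^ (i : ℕ) * (sample Z 0 v i).2 0 := by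
      by_contra hcon
      exact absurd h1 (not_lt.2 (div_nonpos_of_nonpos_of_nonneg (not_lt.1 hcon) (norm_nonneg _)))
    rw [sample, hbase] at h2
    simp only [Finset.sum_apply, Pi.smul_apply, smul_eq_mul, Finset.mul_sum] at h2
    obtain ⟨j, -, hj⟩ := Finset.exists_lt_of_sum_lt (s := Finset.univ) (f := fun _ => (0 : ℝ))
      (by simpa using h2)
    have h3 : 0 < b j (runningTime v i) * ((-1) ^ (i : ℕ) * (unitFamily v).1 j 0) := by
      linarith [hj]
    have h4 : 0 < b j (runningTime v i) := lt_of_le_of_ne (hb _ _) fun h => by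
      rw [← h, zero_mul] at h3
      exact lt_irrefl _ h3
    exact ⟨j, h4, (mul_pos_iff_of_pos_left h4).1 h3⟩
  choose J hJb hJs using hex
  have hJmono : Monotone J := fun i i' hii => by
    by_contra hcon
    exact (hbmono _ _ (not_le.1 hcon) _ _ (hJb i') (hJb i)).not_ge (monotone_runningTime v hii)
  have hJstrict : StrictMono J := fun i i' hii => by
    refine lt_of_le_of_ne (hJmono hii.le) fun heq => ?_
    set i₁ : Fin n := ⟨i + 1, by have := Fin.lt_def.1 hii; omega⟩ with hi₁
    have h1 : J i₁ = J i := by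
      refine le_antisymm ?_ (hJmono (Fin.le_def.2 (by simp [hi₁])))
      rw [heq]
      exact hJmono (Fin.le_def.2 (by simpa [hi₁] using hii))
    have h2 := hJs i₁
    rw [h1] at h2
    have h3 := hJs i
    have h4 : ((i₁ : Fin n) : ℕ) = i + 1 := rfl
    rw [h4, pow_succ] at h2
    linarith
  have hJ : J = id := (hJstrict.range_inj strictMono_id).1 (by
    rw [Set.range_id, (Finite.surjective_of_injective hJstrict.injective).range_eq])
  subst hJ
  simp only [id] at hJb hJs
  refine ⟨hJb i, ?_, hJs i⟩
  rw [sample, hbase]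
  refine Finset.sum_eq_single i (fun j _ hji => ?_) (fun h => absurd (Finset.mem_univ i) h)
  have : b j (runningTime v i) = 0 := by
    by_contra hne
    have hpos := lt_of_le_of_ne (hb j (runningTime v i)) (Ne.symm hne)
    rcases lt_or_gt_of_ne hji with h | h
    · exact lt_irrefl _ (hbmono _ _ h _ _ hpos (hJb i))
    · exact lt_irrefl _ (hbmono _ _ h _ _ (hJb i) hpos)
  rw [this, zero_smul]


/-- The family of vectors pointing to the alternating rays at the instants `τ i`. -/
def alternatingVector (n d : ℕ) (τ : Fin n → ℝ) (i : Fin n) (j : Fin (d + 1)) : ℝ :=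
  if j = 0 then (-1) ^ (i : ℕ) * (1 + τ i) else 0

lemma norm_alternatingVector (τ : Fin n → ℝ) (i : Fin n) (h : 0 < τ i) :
    ‖alternatingVector n d τ i‖ = 1 + τ i := by
  have h1 : |alternatingVector n d τ i 0| = 1 + τ i := by
    rw [alternatingVector, if_pos rfl, abs_mul, abs_pow, abs_neg, abs_one, one_pow, one_mul,
      abs_of_pos (by linarith)]
  refine le_antisymm ((pi_norm_le_iff_of_nonneg (by linarith)).2 fun j => ?_) ?_
  · by_cases hj : j = 0
    · rw [hj, Real.norm_eq_abs, h1]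
    · rw [alternatingVector, if_neg hj, norm_zero]
      linarith
  · rw [← h1]
    exact norm_le_pi_norm (alternatingVector n d τ i) 0

/-- The only family compatible with the base path is the alternating one, for which the smallest
quotient equals one. -/
lemma minRayQuot_alternatingVector [NeZero n] {a : ℝ → ℝ} {b : Fin n → ℝ → ℝ} {τ : Fin n → ℝ}
    (hne : ∀ x, Z x ≠ 0)
    (hbase : ∀ s t, Z (0, s, t) = (a t, ∑ i, b i t • s.1 i))
    (hb : ∀ i, ∀ t : I, 0 ≤ b i t)
    (hbmono : ∀ i j, i < j → ∀ t t' : I, 0 < b i t → 0 < b j t' → t < t')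
    (hτ : ∀ i, 0 < τ i ∧ τ i < 1) (haτ : ∀ i, a (τ i) = 0) (hbτ : ∀ i, 0 < b i (τ i)) :
    minRayQuot Z 0 (alternatingVector n d τ) = 1 := by
  set v := alternatingVector n d τ with hv
  have hn : ∀ i, ‖v i‖ = 1 + τ i := fun i => norm_alternatingVector τ i (hτ i).1
  have hv0 : ∀ i, v i ≠ 0 := fun i => norm_ne_zero_iff.1 (by rw [hn]; linarith [(hτ i).1])
  have hτI : ∀ i, τ i ∈ Set.Icc (0 : ℝ) 1 := fun i => ⟨(hτ i).1.le, (hτ i).2.le⟩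
  have hτmono : Monotone τ := by
    intro i j hij
    rcases hij.eq_or_lt with rfl | h
    · exact le_rfl
    · exact (hbmono i j h ⟨τ i, hτI i⟩ ⟨τ j, hτI j⟩ (hbτ i) (hbτ j)).le
  have hrt : ∀ i, runningTime v i = ⟨τ i, hτI i⟩ := by
    intro i
    have : (Finset.Iic i).sup' ⟨i, by simp⟩ (fun j => ‖v j‖ - 1) = τ i := by
      refine le_antisymm (Finset.sup'_le _ _ fun j hj => ?_) ?_
      · rw [hn]
        linarith [hτmono (Finset.mem_Iic.1 hj)]
      · refine le_trans ?_ (Finset.le_sup' _ (Finset.mem_Iic.2 le_rfl))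
        rw [hn]; linarith
    rw [runningTime, this, Set.projIcc_of_mem _ (hτI i)]
  have hs : ∀ i, (sample Z 0 v i) = (0, b i (τ i) • (unitFamily v).1 i) := by
    intro i
    rw [sample, hrt, hbase]
    refine Prod.ext (haτ i) ?_
    refine Finset.sum_eq_single i (fun j _ hji => ?_) (fun h => absurd (Finset.mem_univ i) h)
    have : b j (τ i) = 0 := by
      by_contra hne
      have hpos := lt_of_le_of_ne (hb j ⟨τ i, hτI i⟩) (Ne.symm hne)
      rcases lt_or_gt_of_ne hji with h | h
      · exact lt_irrefl _ (hbmono _ _ h _ _ hpos (show 0 < b i (⟨τ i, hτI i⟩ : I) from hbτ i))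
      · exact lt_irrefl _ (hbmono _ _ h _ _ (show 0 < b i (⟨τ i, hτI i⟩ : I) from hbτ i) hpos)
    exact (congrArg (· • (unitFamily v).1 j) this).trans (zero_smul _ _)
  refine minRayQuot_eq_one hne ?_ fun i => ?_
  · refine lt_max_of_lt_right ((Finset.lt_inf'_iff _).2 fun i _ => ?_)
    refine div_pos ?_ (norm_pos_iff.2 (hne _))
    rw [hs, unitFamily_apply hv0]
    simp only [Pi.smul_apply, smul_eq_mul, hn]
    have h1 : (v i) 0 = (-1) ^ (i : ℕ) * (1 + τ i) := by simp [hv, alternatingVector]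
    have h2 : ((-1 : ℝ) ^ (i : ℕ)) * (-1) ^ (i : ℕ) = 1 := by
      rw [← mul_pow]; norm_num
    have h3 : 0 < 1 + τ i := by linarith [(hτ i).1]
    rw [h1]
    calc (0 : ℝ) < b i (τ i) := hbτ i
      _ = ((-1 : ℝ) ^ (i : ℕ)) * (-1) ^ (i : ℕ) * (b i (τ i) * ((1 + τ i)⁻¹ * (1 + τ i))) := by
        rw [h2, inv_mul_cancel₀ h3.ne']; ring
      _ = _ := by ring
  · rw [hs, unitFamily_apply hv0]
    ext j
    by_cases hj : j = 0
    · simp [transversal, hj]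
    · simp [transversal, hj, hv, alternatingVector]

/-- A homotopy of the base family, whose end points stay on the first axis, must pass alternately
through the opposite rays of the second axis. -/
theorem exists_alternation [NeZero n] {a : ℝ → ℝ} {b : Fin n → ℝ → ℝ} {τ : Fin n → ℝ}
    (hne : ∀ x, Z x ≠ 0) (h0 : ∀ l s, (Z (l, s, 0)).2 = 0) (h1 : ∀ l s, (Z (l, s, 1)).2 = 0)
    (hbase : ∀ s t, Z (0, s, t) = (a t, ∑ i, b i t • s.1 i))
    (hb : ∀ i, ∀ t : I, 0 ≤ b i t)
    (hbmono : ∀ i j, i < j → ∀ t t' : I, 0 < b i t → 0 < b j t' → t < t')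
    (hτ : ∀ i, 0 < τ i ∧ τ i < 1) (haτ : ∀ i, a (τ i) = 0) (hbτ : ∀ i, 0 < b i (τ i))
    (ha : ∀ i, ∀ t : I, 0 < b i t → (-1) ^ (i : ℕ) * a t * (t - τ i) ≤ 0) :
    ∃ s : UnitFamily n d, ∃ t : Fin n → I, Monotone t ∧ ∀ i, (Z (1, s, t i)).1 = 0 ∧
      (∀ j, j ≠ 0 → (Z (1, s, t i)).2 j = 0) ∧ 0 < (-1) ^ (i : ℕ) * (Z (1, s, t i)).2 0 := by
  by_contra hcon
  set vs := alternatingVector n d τ with hvs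
  have hχs := minRayQuot_alternatingVector hne hbase hb hbmono hτ haτ hbτ
  -- the map to which the Poincaré–Miranda theorem is applied
  set κ : (Option (Fin n × Fin (d + 1)) → ℝ) → I × (Fin n → Fin (d + 1) → ℝ) := fun x =>
    (Set.projIcc 0 1 zero_le_one (x none), fun i j => x (some (i, j))) with hκ
  have hκc : Continuous κ := by
    refine (continuous_projIcc.comp (continuous_apply _)).prodMk ?_
    fun_prop
  set μ : (Option (Fin n × Fin (d + 1)) → ℝ) → ℝ := fun x => max 0 (min 1 (-x none)) with hμ
  set ν : (Option (Fin n × Fin (d + 1)) → ℝ) → ℝ := fun x => max 0 (min 1 (x none - 1)) with hν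
  have hμc : Continuous μ := by fun_prop
  have hνc : Continuous ν := by fun_prop
  set F : (Option (Fin n × Fin (d + 1)) → ℝ) → Option (Fin n × Fin (d + 1)) → ℝ := fun x o =>
    o.elim ((1 - μ x - ν x) * (ansatz Z (κ x)).2 - μ x + ν x)
      (fun q => (1 - μ x - ν x) * (ansatz Z (κ x)).1 q.1 q.2
        + μ x * ((κ x).2 q.1 q.2 - vs q.1 q.2)) with hF
  have hAc : Continuous fun x => ansatz Z (κ x) := (continuous_ansatz hne h0).comp hκc
  have hFc : Continuous F := by
    refine continuous_pi fun o => ?_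
    rcases o with _ | ⟨i, j⟩
    · exact (((continuous_const.sub hμc).sub hνc).mul (continuous_snd.comp hAc)).sub hμc |>.add hνc
    · have h2 : Continuous fun x => (ansatz Z (κ x)).1 i j :=
        (continuous_apply j).comp ((continuous_apply i).comp (continuous_fst.comp hAc))
      have h3 : Continuous fun x => (κ x).2 i j :=
        (continuous_apply j).comp ((continuous_apply i).comp (continuous_snd.comp hκc))
      exact (((continuous_const.sub hμc).sub hνc).mul h2).add
        (hμc.mul (h3.sub continuous_const))
  obtain ⟨x, hx, hFx⟩ := poincare_miranda (L := 3) (by norm_num) hFc.continuousOn (by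
    intro x hx o ho
    rcases o with _ | ⟨i, j⟩
    · rcases eq_or_eq_neg_of_abs_eq ho with h | h
      · have e1 : μ x = 0 := by simp only [hμ, h]; norm_num
        have e2 : ν x = 1 := by simp only [hν, h]; norm_num
        simp only [hF, Option.elim, e1, e2, h]; norm_num
      · have e1 : μ x = 1 := by simp only [hμ, h]; norm_num
        have e2 : ν x = 0 := by simp only [hν, h]; norm_num
        simp only [hF, Option.elim, e1, e2, h]; norm_num
    · have h3 : 2 ≤ ‖(κ x).2 i‖ := by
        have : |x (some (i, j))| ≤ ‖(κ x).2 i‖ := norm_le_pi_norm ((κ x).2 i) j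
        linarith
      have h4 : (ansatz Z (κ x)).1 i j = 0 := by
        rw [ansatz_eq h0, minRayQuot_eq_zero_of_two_le_norm h1 h3]; simp
      have h5 : |vs i j| ≤ 2 := by
        have : |vs i j| ≤ ‖vs i‖ := norm_le_pi_norm (vs i) j
        rw [hvs, norm_alternatingVector τ i (hτ i).1] at this
        linarith [(hτ i).2]
      have h6 : 0 ≤ μ x := le_max_left _ _
      simp only [hF, Option.elim, h4]
      rw [mul_zero, zero_add, mul_assoc]
      refine mul_nonneg h6 ?_
      change 0 ≤ (x (some (i, j)) - vs i j) * x (some (i, j))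
      have h7 := abs_le.1 h5
      rcases eq_or_eq_neg_of_abs_eq ho with h | h <;> rw [h] <;> nlinarith)
  have hbeta := congrFun hFx none
  have hcomp : ∀ i j, _ := fun i j => congrFun hFx (some (i, j))
  simp only [hF, Option.elim, ansatz_eq h0, Pi.zero_apply] at hbeta hcomp
  set l := (κ x).1 with hl
  set v := (κ x).2 with hv
  set χ := minRayQuot Z l v with hχ
  have hχ0 : 0 ≤ χ := minRayQuot_nonneg _ _
  -- away from the negative levels only alternation at level one is possible
  have htrans : μ x = 0 → ν x < 1 → 0 < χ → χ = 1 := by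
    intro hμ0 hν1 hχp
    refine minRayQuot_eq_one hne hχp fun i => funext fun j => ?_
    have := hcomp i j
    rw [hμ0] at this
    simp only [sub_zero, zero_mul, add_zero, Pi.smul_apply, smul_eq_mul, mul_eq_zero] at this
    rcases this with h | h | h
    · linarith
    · linarith
    · exact h
  rcases lt_or_ge (x none) 0 with hneg | hnn
  · have hν0 : ν x = 0 := max_eq_left ((min_le_right _ _).trans (by linarith))
    have hμp : 0 < μ x := lt_max_of_lt_right (lt_min one_pos (by linarith))
    have hμ1 : μ x ≤ 1 := max_le zero_le_one (min_le_left _ _)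
    have hl0 : l = 0 := Set.projIcc_of_le_left zero_le_one hneg.le
    have hχh : χ < 1 / 2 ∧ μ x < 1 := by
      rw [hν0] at hbeta
      have h2 : (1 - μ x) * (1 - 2 * χ) = μ x := by linarith
      have h3 : 0 < 1 - μ x := by
        refine lt_of_le_of_ne (by linarith) fun h => ?_
        rw [← h, zero_mul] at h2
        linarith
      refine ⟨?_, by linarith⟩
      by_contra h4
      nlinarith
    have hvv : v = vs := by
      rcases hχ0.eq_or_lt with h | hχp
      · ext i j
        have := hcomp i j
        rw [← h, hν0] at this
        simp only [zero_smul, Pi.zero_apply, mul_zero, zero_add, mul_eq_zero] at this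
        rcases this with h | h <;> linarith
      · rw [hχ, hl0] at hχp
        have hbs := sample_base hbase hb hbmono hχp
        have hv0 : ∀ i, v i ≠ 0 := fun i h => by
          have := minRayQuot_eq_zero_of_norm_le_one (Z := Z) (l := 0) (v := v) h0 (i := i)
            (by rw [h]; simp)
          linarith
        have hrt : ∀ i, (runningTime v i : ℝ) = ‖v i‖ - 1 := by
          intro i
          have hnz : ∀ t : I, (∀ l s, (Z (l, s, t)).2 = 0) → runningTime v i ≠ t := by
            intro t ht heq
            have := (hbs i).2
            rw [sample, heq, ht] at this
            have h2 := congrFun this.1 0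
            have h3 : 0 < b i t * ((-1) ^ (i : ℕ) * (unitFamily v).1 i 0) :=
              mul_pos (heq ▸ (hbs i).1) this.2
            simp only [Pi.zero_apply, Pi.smul_apply, smul_eq_mul] at h2
            have h4 : b i t * ((-1) ^ (i : ℕ) * (unitFamily v).1 i 0)
              = (-1) ^ (i : ℕ) * (b i t * (unitFamily v).1 i 0) := by ring
            rw [h4, ← h2, mul_zero] at h3
            exact lt_irrefl _ h3
          exact runningTime_eq_norm (lt_of_le_of_ne (runningTime v i).2.1 (hnz 0 h0).symm)
            (lt_of_le_of_ne (runningTime v i).2.2 (hnz 1 h1))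
            (fun j hj => hbmono _ _ hj _ _ (hbs j).1 (hbs i).1)
        have hvj : ∀ i j, j ≠ 0 → v i j = 0 := by
          intro i j hj
          have h2 := hcomp i j
          rw [hl0, hν0] at h2
          simp only [Pi.smul_apply, smul_eq_mul, transversal, hj, if_false, (hbs i).2.1,
            unitFamily_apply hv0, hvs, alternatingVector, sub_zero] at h2
          have hpos : 0 < (1 - μ x) * (χ * (b i (runningTime v i) * ‖v i‖⁻¹)) + μ x := by
            have := (hbs i).1
            have := norm_pos_iff.2 (hv0 i)
            have : 0 ≤ 1 - μ x := by linarith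
            positivity
          have h3 : ((1 - μ x) * (χ * (b i (runningTime v i) * ‖v i‖⁻¹)) + μ x) * v i j = 0 := by
            linear_combination h2
          exact (mul_eq_zero.1 h3).resolve_left hpos.ne'
        ext i j
        by_cases hj : j = 0
        swap
        · rw [hvj i j hj, hvs, alternatingVector, if_neg hj]
        subst hj
        have hsq : ((-1 : ℝ) ^ (i : ℕ)) * (-1) ^ (i : ℕ) = 1 := by
          rw [← mul_pow]; norm_num
        have hvi0 : v i 0 = (-1) ^ (i : ℕ) * ‖v i‖ := by
          have h2 : 0 < (-1) ^ (i : ℕ) * v i 0 := by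
            have h3 := (hbs i).2.2
            rw [unitFamily_apply hv0, Pi.smul_apply, smul_eq_mul, ← mul_assoc,
              mul_comm ((-1 : ℝ) ^ (i : ℕ)), mul_assoc] at h3
            exact (mul_pos_iff_of_pos_left (inv_pos.2 (norm_pos_iff.2 (hv0 i)))).1 h3
          have h4 : ‖v i‖ = |v i 0| := by
            refine le_antisymm ((pi_norm_le_iff_of_nonneg (abs_nonneg _)).2 fun j => ?_)
              (norm_le_pi_norm (v i) 0)
            rcases eq_or_ne j 0 with rfl | hj
            · exact le_rfl
            · simp [hvj i j hj]
          have h5 : |v i 0| = (-1) ^ (i : ℕ) * v i 0 := by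
            rw [← abs_of_pos h2, abs_mul, abs_pow, abs_neg, abs_one, one_pow, one_mul]
          rw [h4, h5, ← mul_assoc, hsq, one_mul]
        have hat := ha i (runningTime v i) (hbs i).1
        have h2 := hcomp i 0
        have hs1 : (sample Z 0 v i).1 = a (runningTime v i) := by rw [sample, hbase]
        rw [hl0, hν0, hvi0] at h2
        simp only [Pi.smul_apply, smul_eq_mul, transversal, if_true, hs1, hvs,
          alternatingVector, sub_zero] at h2
        set r : ℝ := (runningTime v i : ℝ) with hr
        have hvr : ‖v i‖ = 1 + r := by rw [hr, hrt i]; ring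
        rw [hvr] at h2
        have h3 : μ x * (r - τ i) ^ 2
            = (1 - μ x) * (χ * ((-1) ^ (i : ℕ) * a r * (r - τ i))) := by
          have h4 : (-1) ^ (i : ℕ) * (r - τ i) * (μ x * ((-1) ^ (i : ℕ) * (r - τ i))
              - (1 - μ x) * (χ * a r)) = 0 := by
            have : μ x * ((-1) ^ (i : ℕ) * (r - τ i))
              - (1 - μ x) * (χ * a r) = 0 := by linarith
            rw [this, mul_zero]
          have h5 : (-1) ^ (i : ℕ) * (r - τ i) * (μ x * ((-1) ^ (i : ℕ) * (r - τ i))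
              - (1 - μ x) * (χ * a r))
              = ((-1 : ℝ) ^ (i : ℕ)) * (-1) ^ (i : ℕ) * (μ x * (r - τ i) ^ 2)
              - (1 - μ x) * (χ * ((-1) ^ (i : ℕ) * a r * (r - τ i))) := by ring
          rw [h5, hsq, one_mul] at h4
          linarith
        have h6 : (1 - μ x) * (χ * ((-1) ^ (i : ℕ) * a r * (r - τ i))) ≤ 0 :=
          mul_nonpos_of_nonneg_of_nonpos (by linarith)
            (mul_nonpos_of_nonneg_of_nonpos hχ0 hat)
        have h7 : r = τ i := by
          have : (r - τ i) ^ 2 ≤ 0 := by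
            by_contra hc
            have := mul_pos hμp (not_le.1 hc)
            linarith
          have := pow_eq_zero_iff (two_ne_zero) |>.1 (le_antisymm this (sq_nonneg _))
          linarith
        rw [hvi0, hvr, h7, hvs, alternatingVector, if_pos rfl]
    have : χ = 1 := by rw [hχ, hl0, hvv, hχs]
    linarith [hχh.1]
  · have hμ0 : μ x = 0 := max_eq_left ((min_le_right _ _).trans (by linarith))
    have hν1 : ν x ≤ 1 := max_le zero_le_one (min_le_left _ _)
    have hν0 : 0 ≤ ν x := le_max_left _ _
    rw [hμ0] at hbeta
    have hν1' : ν x < 1 := lt_of_le_of_ne hν1 fun h => by rw [h] at hbeta; linarith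
    have hχp : 0 < χ := by
      refine lt_of_le_of_ne hχ0 fun h => ?_
      rw [← h] at hbeta
      linarith
    have hχ1 := htrans hμ0 hν1' hχp
    have hν2 : 0 < ν x := by
      rw [hχ1] at hbeta
      linarith
    have hl1 : l = 1 := by
      refine Set.projIcc_of_right_le zero_le_one ?_
      by_contra hc
      have : ν x = 0 := max_eq_left ((min_le_right _ _).trans (by linarith))
      linarith
    rw [hχ, hl1] at hχp
    have htr : ∀ i, transversal (sample Z 1 v i) = 0 := by
      intro i
      ext j
      have := hcomp i j
      rw [hμ0, hχ1, hl1] at this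
      simp only [one_smul, zero_mul, add_zero, sub_zero, mul_eq_zero] at this
      rcases this with h | h
      · linarith
      · exact h
    refine hcon ⟨unitFamily v, runningTime v, monotone_runningTime v, fun i => ⟨?_, ?_, ?_⟩⟩
    · change (sample Z 1 v i).1 = 0
      simpa [transversal] using congrFun (htr i) 0
    · intro j hj
      change (sample Z 1 v i).2 j = 0
      simpa [transversal, hj] using congrFun (htr i) j
    · have h2 : 0 < rayQuot Z 1 v i := hχp.trans_le (minRayQuot_le hχp i)
      by_contra hc
      exact absurd h2 (not_lt.2 (div_nonpos_of_nonpos_of_nonneg (not_lt.1 hc) (norm_nonneg _)))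

end Alternation

section BasePath

open unitInterval

/-- A smooth odd bump: positive to the right of `κ`, negative to the left of `-κ`, else zero. -/
def oddBump (κ x : ℝ) : ℝ := expNegInvGlue (x - κ) - expNegInvGlue (-x - κ)

lemma contDiff_oddBump (κ : ℝ) : ContDiff ℝ 1 (oddBump κ) :=
  (expNegInvGlue.contDiff.comp (contDiff_id.sub contDiff_const)).sub
    (expNegInvGlue.contDiff.comp (contDiff_id.neg.sub contDiff_const))

lemma oddBump_neg (κ x : ℝ) : oddBump κ (-x) = -oddBump κ x := by
  rw [oddBump, oddBump, neg_neg]; ring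

lemma oddBump_eq_zero {κ x : ℝ} (h : |x| ≤ κ) : oddBump κ x = 0 := by
  have := abs_le.1 h
  rw [oddBump, expNegInvGlue.zero_of_nonpos (by linarith),
    expNegInvGlue.zero_of_nonpos (by linarith), sub_zero]

lemma oddBump_pos {κ x : ℝ} (hκ : 0 ≤ κ) (h : κ < x) : 0 < oddBump κ x := by
  rw [oddBump, expNegInvGlue.zero_of_nonpos (x := -x - κ) (by linarith), sub_zero]
  exact expNegInvGlue.pos_of_pos (by linarith)

variable {n : ℕ}

/-- The middle of the `i`-th of `n` equal subintervals of `[0, 1]`. -/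
def midTime (i : Fin n) : ℝ := (2 * i + 1) / (2 * n)

/-- The antiperiodic bump centred at `midTime i`. -/
def timeBump (i : Fin n) (t : ℝ) : ℝ :=
  oddBump (Real.cos (Real.pi / (2 * n))) (Real.cos (Real.pi * (t - midTime i)))

lemma contDiff_timeBump (i : Fin n) : ContDiff ℝ 1 (timeBump i) :=
  (contDiff_oddBump _).comp
    (Real.contDiff_cos.comp (contDiff_const.mul (contDiff_id.sub contDiff_const)))

lemma timeBump_add_one (i : Fin n) (t : ℝ) : timeBump i (t + 1) = -timeBump i t := by
  rw [timeBump, timeBump, ← oddBump_neg, ← Real.cos_add_pi]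
  ring_nf

lemma midTime_mem (i : Fin n) : 1 / (2 * n) ≤ midTime i ∧ midTime i ≤ 1 - 1 / (2 * (n : ℝ)) := by
  have hi : ((i : ℕ) : ℝ) + 1 ≤ n := by exact_mod_cast i.2
  have hn : (0 : ℝ) < n := by linarith [Nat.cast_nonneg (α := ℝ) (i : ℕ)]
  have hi0 : (0 : ℝ) ≤ (i : ℕ) := Nat.cast_nonneg _
  constructor
  · rw [midTime, div_le_div_iff_of_pos_right (by positivity)]
    linarith
  · rw [midTime, div_le_iff₀ (by positivity), sub_mul, div_mul_cancel₀ _ (by positivity)]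
    linarith

lemma timeBump_of_mem (i : Fin n) {t : ℝ} (ht : t ∈ Set.Icc (0 : ℝ) 1) :
    0 ≤ timeBump i t ∧ (0 < timeBump i t ↔ |t - midTime i| < 1 / (2 * n)) := by
  have hn : (1 : ℝ) ≤ n := by exact_mod_cast (Nat.succ_le_of_lt (Nat.zero_lt_of_lt i.2))
  have hm := midTime_mem i
  have hh : 1 / (2 * (n : ℝ)) ≤ 1 / 2 := by
    apply one_div_le_one_div_of_le <;> linarith
  have hh0 : 0 < 1 / (2 * (n : ℝ)) := by positivity
  have hpi := Real.pi_pos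
  have e : Real.pi / (2 * n) = Real.pi * (1 / (2 * n)) := by ring
  have hκ : 0 ≤ Real.cos (Real.pi / (2 * n)) := by
    apply Real.cos_nonneg_of_mem_Icc
    rw [e]
    constructor <;> nlinarith
  have habs : |t - midTime i| ≤ 1 - 1 / (2 * n) :=
    abs_le.2 ⟨by linarith [ht.1], by linarith [ht.2]⟩
  have hcos : Real.cos (Real.pi * (t - midTime i)) = Real.cos (Real.pi * |t - midTime i|) := by
    rw [← Real.cos_abs, abs_mul, abs_of_pos hpi]
  rcases lt_or_ge |t - midTime i| (1 / (2 * n)) with h | h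
  · have : 0 < timeBump i t := by
      refine oddBump_pos hκ ?_
      rw [hcos, e]
      refine Real.cos_lt_cos_of_nonneg_of_le_pi (by positivity) ?_ ?_
      · nlinarith
      · exact mul_lt_mul_of_pos_left h hpi
    exact ⟨this.le, iff_of_true this h⟩
  · have : timeBump i t = 0 := by
      refine oddBump_eq_zero (abs_le.2 ⟨?_, ?_⟩)
      · rw [hcos, ← Real.cos_pi_sub, e]
        refine Real.cos_le_cos_of_nonneg_of_le_pi (by positivity) ?_ ?_
        · nlinarith
        · nlinarith
      · rw [hcos, e]
        refine Real.cos_le_cos_of_nonneg_of_le_pi (by positivity) ?_ ?_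
        · nlinarith
        · exact mul_le_mul_of_nonneg_left h hpi.le
    rw [this]
    exact ⟨le_rfl, iff_of_false (lt_irrefl _) h.not_gt⟩

/-- The axial component of the base path. -/
def baseAxis (n : ℕ) (t : ℝ) : ℝ := Real.cos (Real.pi * n * t)

lemma baseAxis_add_one (hn : Odd n) (t : ℝ) : baseAxis n (t + 1) = -baseAxis n t := by
  obtain ⟨k, rfl⟩ := hn
  have : Real.pi * (2 * k + 1 : ℕ) * (t + 1)
      = (Real.pi * (2 * k + 1 : ℕ) * t + Real.pi) + k * (2 * Real.pi) := by
    push_cast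
    ring
  rw [baseAxis, baseAxis, this, Real.cos_add_nat_mul_two_pi, Real.cos_add_pi]

lemma baseAxis_midTime_add (i : Fin n) (u : ℝ) :
    baseAxis n (midTime i + u) = -((-1) ^ (i : ℕ) * Real.sin (Real.pi * n * u)) := by
  have hn : (n : ℝ) ≠ 0 := by exact_mod_cast (Nat.zero_lt_of_lt i.2).ne'
  have : Real.pi * n * (midTime i + u)
      = (Real.pi * n * u + Real.pi / 2) + (i : ℕ) * Real.pi := by
    rw [midTime]
    field_simp
    ring
  rw [baseAxis, this, Real.cos_add_nat_mul_pi, Real.cos_add_pi_div_two]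
  ring

lemma baseAxis_midTime (i : Fin n) : baseAxis n (midTime i) = 0 := by
  simpa using baseAxis_midTime_add i 0

lemma timeBump_midTime (i : Fin n) : 0 < timeBump i (midTime i) := by
  have hn : (0 : ℝ) < n := by exact_mod_cast (Nat.zero_lt_of_lt i.2)
  have hh : 0 < 1 / (2 * (n : ℝ)) := by positivity
  have hm := midTime_mem i
  refine (timeBump_of_mem i ⟨by linarith, by linarith⟩).2.2 ?_
  simpa using hn

lemma timeBump_strict {i j : Fin n} (hij : i < j) {t t' : I} (h : 0 < timeBump i t)
    (h' : 0 < timeBump j t') : t < t' := by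
  have hn : (0 : ℝ) < n := by exact_mod_cast (Nat.zero_lt_of_lt i.2)
  have h1 := abs_lt.1 ((timeBump_of_mem i t.2).2.1 h)
  have h2 := abs_lt.1 ((timeBump_of_mem j t'.2).2.1 h')
  have h3 : midTime i + 2 * (1 / (2 * n)) ≤ midTime j := by
    have : ((i : ℕ) : ℝ) + 1 ≤ (j : ℕ) := by exact_mod_cast hij
    rw [midTime, midTime, mul_one_div, ← add_div, div_le_div_iff_of_pos_right (by positivity)]
    linarith
  rw [← Subtype.coe_lt_coe]
  linarith

lemma baseAxis_sign (i : Fin n) {t : ℝ} (ht : t ∈ Set.Icc (0 : ℝ) 1) (h : 0 < timeBump i t) :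
    (-1) ^ (i : ℕ) * baseAxis n t * (t - midTime i) ≤ 0 := by
  have hn : (0 : ℝ) < n := by exact_mod_cast (Nat.zero_lt_of_lt i.2)
  have h1 := (timeBump_of_mem i ht).2.1 h
  obtain ⟨u, rfl⟩ : ∃ u, t = midTime i + u := ⟨t - midTime i, by ring⟩
  rw [add_sub_cancel_left] at h1 ⊢
  have hsq : ((-1 : ℝ) ^ (i : ℕ)) * (-1) ^ (i : ℕ) = 1 := by
    rw [← mul_pow]; norm_num
  have h2 : 0 ≤ Real.sin (Real.pi * n * u) * u := by
    have hpi := Real.pi_pos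
    have hb : |Real.pi * n * u| ≤ Real.pi := by
      rw [abs_mul, abs_of_pos (by positivity)]
      have h3 : n * |u| ≤ 1 := by
        have := mul_le_mul_of_nonneg_left h1.le hn.le
        have e : (n : ℝ) * (1 / (2 * n)) = 1 / 2 := by field_simp
        linarith
      nlinarith
    rcases le_total 0 u with hu | hu
    · refine mul_nonneg (Real.sin_nonneg_of_nonneg_of_le_pi (by positivity) ?_) hu
      exact (le_abs_self _).trans hb
    · refine mul_nonneg_of_nonpos_of_nonpos (Real.sin_nonpos_of_nonpos_of_neg_pi_le ?_ ?_) hu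
      · exact mul_nonpos_of_nonneg_of_nonpos (by positivity) hu
      · exact (abs_le.1 hb).1
  rw [baseAxis_midTime_add]
  have : (-1) ^ (i : ℕ) * -((-1) ^ (i : ℕ) * Real.sin (Real.pi * n * u)) * u
      = -(((-1 : ℝ) ^ (i : ℕ)) * (-1) ^ (i : ℕ) * (Real.sin (Real.pi * n * u) * u)) := by ring
  rw [this, hsq, one_mul]
  linarith

variable {d : ℕ}

/-- The base path with transversal directions `s`. -/
def basePath (s : UnitFamily n d) (t : ℝ) : ℝ × (Fin (d + 1) → ℝ) :=
  (baseAxis n t, ∑ i, timeBump i t • s.1 i)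

lemma basePath_add_one (hn : Odd n) (s : UnitFamily n d) (t : ℝ) :
    basePath s (t + 1) = -basePath s t := by
  simp [basePath, baseAxis_add_one hn, timeBump_add_one]

lemma timeBump_zero (i : Fin n) : timeBump i 0 = 0 := by
  have h := timeBump_of_mem i (t := 0) (by simp)
  have hm := midTime_mem i
  have hn : (0 : ℝ) < n := by exact_mod_cast (Nat.zero_lt_of_lt i.2)
  have hh : 0 < 1 / (2 * (n : ℝ)) := by positivity
  refine le_antisymm (not_lt.1 fun h0 => ?_) h.1
  have := h.2.1 h0
  rw [zero_sub, abs_neg, abs_of_pos (by linarith)] at this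
  linarith

lemma basePath_zero (s : UnitFamily n d) : basePath s 0 = (1, 0) := by
  simp [basePath, baseAxis, timeBump_zero]

lemma basePath_ne_zero (hn : Odd n) (s : UnitFamily n d) (t : ℝ) : basePath s t ≠ 0 := by
  have hI : ∀ t ∈ Set.Ico (0 : ℝ) 1, basePath s t ≠ 0 := by
    intro t ht h0
    have hn0 : (0 : ℝ) < n := by exact_mod_cast hn.pos
    have ha : Real.cos (Real.pi * n * t) = 0 := congrArg Prod.fst h0
    obtain ⟨k, hk⟩ := Real.cos_eq_zero_iff.1 ha
    have hk' : 2 * n * t = 2 * k + 1 := by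
      have := Real.pi_pos
      have h1 : Real.pi * (2 * n * t) = Real.pi * (2 * k + 1) := by linarith
      exact mul_left_cancel₀ this.ne' h1
    have hk0 : 0 ≤ k := by
      have : (-1 : ℝ) < k := by nlinarith [ht.1, mul_nonneg hn0.le ht.1]
      have : -1 < k := by exact_mod_cast this
      omega
    have hkn : k < n := by
      have : (k : ℝ) < n := by nlinarith [ht.2]
      exact_mod_cast this
    lift k to ℕ using hk0
    set j : Fin n := ⟨k, by exact_mod_cast hkn⟩ with hj
    have htj : t = midTime j := by
      rw [midTime, eq_div_iff (by positivity)]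
      simp only [hj]
      push_cast at hk'
      linarith
    have hb : ∀ i, i ≠ j → timeBump i t = 0 := by
      intro i hij
      have htI : t ∈ Set.Icc (0 : ℝ) 1 := ⟨ht.1, ht.2.le⟩
      refine le_antisymm (not_lt.1 fun h => ?_) (timeBump_of_mem i htI).1
      have hjp : 0 < timeBump j t := htj ▸ timeBump_midTime j
      rcases lt_or_gt_of_ne hij with h1 | h1
      · exact lt_irrefl _ (timeBump_strict h1 (t := ⟨t, htI⟩) (t' := ⟨t, htI⟩) h hjp)
      · exact lt_irrefl _ (timeBump_strict h1 (t := ⟨t, htI⟩) (t' := ⟨t, htI⟩) hjp h)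
    have h2 : ∑ i, timeBump i t • s.1 i = 0 := congrArg Prod.snd h0
    rw [Finset.sum_eq_single j (fun i _ hij => by rw [hb i hij, zero_smul])
      (fun h => absurd (Finset.mem_univ j) h)] at h2
    rcases smul_eq_zero.1 h2 with h | h
    · rw [htj] at h
      exact (timeBump_midTime j).ne' h
    · have := s.2 j
      rw [h, norm_zero] at this
      exact zero_ne_one this
  have hz : ∀ m : ℕ, ∀ t, basePath s t = 0 ↔ basePath s (t + m) = 0 := by
    intro m
    induction m with
    | zero => simp
    | succ m ih =>
      intro t
      rw [ih, Nat.cast_succ, ← add_assoc, basePath_add_one hn, neg_eq_zero]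
  have hz' : ∀ m : ℤ, ∀ t, basePath s (t + m) = 0 → basePath s t = 0 := by
    intro m t h
    obtain ⟨k, rfl | rfl⟩ := m.eq_nat_or_neg
    · exact (hz k t).2 (by exact_mod_cast h)
    · have := (hz k _).1 h
      simpa using this
  intro h
  refine hI (Int.fract t) ⟨Int.fract_nonneg t, Int.fract_lt_one t⟩ (hz' ⌊t⌋ _ ?_)
  rwa [Int.fract_add_floor]

/-- Every nonvanishing homotopy of the base family passes alternately through the opposite rays of
the second axis. -/
theorem exists_alternation_basePath (hn : Odd n)
    {Z : C(I × UnitFamily n d × I, ℝ × (Fin (d + 1) → ℝ))}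
    (hne : ∀ x, Z x ≠ 0) (h0 : ∀ l s, (Z (l, s, 0)).2 = 0) (h1 : ∀ l s, (Z (l, s, 1)).2 = 0)
    (hbase : ∀ s t, Z (0, s, t) = basePath s t) :
    ∃ s : UnitFamily n d, ∃ t : Fin n → I, Monotone t ∧ ∀ i, (Z (1, s, t i)).1 = 0 ∧
      (∀ j, j ≠ 0 → (Z (1, s, t i)).2 j = 0) ∧ 0 < (-1) ^ (i : ℕ) * (Z (1, s, t i)).2 0 := by
  have : NeZero n := ⟨hn.pos.ne'⟩
  have hn0 : (0 : ℝ) < n := by exact_mod_cast hn.pos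
  have hh : 0 < 1 / (2 * (n : ℝ)) := by positivity
  refine exists_alternation (a := baseAxis n) (b := timeBump) (τ := midTime) hne h0 h1 hbase
    (fun i t => (timeBump_of_mem i t.2).1) (fun i j hij t t' => timeBump_strict hij)
    (fun i => ?_) baseAxis_midTime timeBump_midTime (fun i t => baseAxis_sign i t.2)
  have := midTime_mem i
  exact ⟨by linarith, by linarith⟩

end BasePath

section Antiprimitive

variable {F : Type*} [NormedAddCommGroup F] [NormedSpace ℝ F]

/-- The primitive of `g` that is `τ`-antiperiodic when `g` is. -/
def antiPrimitive (τ : ℝ) (g : ℝ → F) (t : ℝ) : F :=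
  (∫ u in (0 : ℝ)..t, g u) - (1 / 2 : ℝ) • ∫ u in (0 : ℝ)..τ, g u

variable {τ : ℝ} {g h : ℝ → F}

lemma antiPrimitive_sub (hg : Continuous g) (hh : Continuous h) :
    antiPrimitive τ (fun t => g t - h t) = fun t => antiPrimitive τ g t - antiPrimitive τ h t := by
  funext t
  simp only [antiPrimitive]
  rw [intervalIntegral.integral_sub (hg.intervalIntegrable _ _) (hh.intervalIntegrable _ _),
    intervalIntegral.integral_sub (hg.intervalIntegrable _ _) (hh.intervalIntegrable _ _)]
  module

lemma antiPrimitive_smul (s : ℝ) (g : ℝ → F) :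
    antiPrimitive τ (fun t => s • g t) = fun t => s • antiPrimitive τ g t := by
  funext t
  simp only [antiPrimitive, intervalIntegral.integral_smul]
  module

lemma continuous_antiPrimitive_parametric {X : Type*} [TopologicalSpace X] {g : X → ℝ → F}
    (hg : Continuous fun p : X × ℝ => g p.1 p.2) :
    Continuous fun p : X × ℝ => antiPrimitive τ (g p.1) p.2 := by
  have h1 := intervalIntegral.continuous_parametric_primitive_of_continuous (μ := volume)
    (f := g) (a₀ := 0) hg
  exact h1.sub (continuous_const.smul (h1.comp (continuous_fst.prodMk continuous_const)))

/-- Convergence of antiperiodic primitives under bounded pointwise convergence. -/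
lemma tendsto_antiPrimitive {g : ℕ → ℝ → F} {h : ℝ → F} {K : ℝ} (hg : ∀ n, Continuous (g n))
    (hb : ∀ n t, ‖g n t‖ ≤ K) (hlim : ∀ t, Tendsto (fun n => g n t) atTop (nhds (h t))) (t : ℝ) :
    Tendsto (fun n => antiPrimitive τ (g n) t) atTop (nhds (antiPrimitive τ h t)) := by
  have key : ∀ b : ℝ, Tendsto (fun n => ∫ u in (0 : ℝ)..b, g n u) atTop
      (nhds (∫ u in (0 : ℝ)..b, h u)) := fun b =>
    intervalIntegral.tendsto_integral_filter_of_dominated_convergence (fun _ => K)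
      (Eventually.of_forall fun n => (hg n).aestronglyMeasurable)
      (Eventually.of_forall fun n => Eventually.of_forall fun t _ => hb n t)
      intervalIntegrable_const (Eventually.of_forall fun t _ => hlim t)
  exact (key t).sub ((key τ).const_smul _)

/-- Cauchy-Schwarz inequality on an interval. -/
lemma sq_integral_norm_le {E : Type*} [NormedAddCommGroup E] {g : ℝ → E} {a b : ℝ}
    (hab : a ≤ b) (hg : Continuous g) :
    (∫ t in a..b, ‖g t‖) ^ 2 ≤ (b - a) * ∫ t in a..b, ‖g t‖ ^ 2 := by
  set J := ∫ t in a..b, ‖g t‖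
  have hi1 : IntervalIntegrable (fun t => ‖g t‖ ^ 2) volume a b :=
    (hg.norm.pow 2).intervalIntegrable _ _
  have hi2 : IntervalIntegrable (fun t => ‖g t‖) volume a b := hg.norm.intervalIntegrable _ _
  have key : ∀ c : ℝ, 0 ≤ (∫ t in a..b, ‖g t‖ ^ 2) - 2 * c * J + (b - a) * c ^ 2 := by
    intro c
    have : 0 ≤ ∫ t in a..b, (‖g t‖ - c) ^ 2 :=
      intervalIntegral.integral_nonneg hab fun t _ => sq_nonneg _
    calc (0 : ℝ) ≤ ∫ t in a..b, (‖g t‖ - c) ^ 2 := this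
      _ = ∫ t in a..b, (‖g t‖ ^ 2 - 2 * c * ‖g t‖ + c ^ 2) := by
          congr 1; funext t; ring
      _ = _ := by
          rw [intervalIntegral.integral_add (hi1.sub (hi2.const_mul _)) intervalIntegrable_const,
            intervalIntegral.integral_sub hi1 (hi2.const_mul _),
            intervalIntegral.integral_const_mul, intervalIntegral.integral_const, smul_eq_mul]
  rcases hab.eq_or_lt with rfl | hlt
  · simp [J]
  · have h := key (J / (b - a))
    have hp : 0 < b - a := sub_pos.2 hlt
    have e : (b - a) * ((∫ t in a..b, ‖g t‖ ^ 2) - 2 * (J / (b - a)) * J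
        + (b - a) * (J / (b - a)) ^ 2) = (b - a) * (∫ t in a..b, ‖g t‖ ^ 2) - J ^ 2 := by
      field_simp
      ring
    have := mul_nonneg hp.le h
    rw [e] at this
    linarith

lemma antiPrimitive_eq (hg : Continuous g) (t : ℝ) :
    antiPrimitive τ g t = (1 / 2 : ℝ) • ((∫ u in (0 : ℝ)..t, g u) - ∫ u in t..τ, g u) := by
  rw [antiPrimitive, ← intervalIntegral.integral_add_adjacent_intervals
    (hg.intervalIntegrable 0 t) (hg.intervalIntegrable t τ)]
  module

lemma norm_antiPrimitive_le_integral (hg : Continuous g) {t : ℝ} (ht : t ∈ Set.Icc 0 τ) :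
    ‖antiPrimitive τ g t‖ ≤ (∫ u in (0 : ℝ)..τ, ‖g u‖) / 2 := by
  rw [antiPrimitive_eq hg, norm_smul, ← intervalIntegral.integral_add_adjacent_intervals
    (hg.norm.intervalIntegrable 0 t) (hg.norm.intervalIntegrable t τ)]
  have h1 := intervalIntegral.norm_integral_le_integral_norm (f := g) (μ := volume) ht.1
  have h2 := intervalIntegral.norm_integral_le_integral_norm (f := g) (μ := volume) ht.2
  have h3 := norm_sub_le (∫ u in (0 : ℝ)..t, g u) (∫ u in t..τ, g u)
  norm_num
  linarith

/-- Every time is an antiperiod multiple away from `[0, τ)`. -/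
lemma Function.Antiperiodic.exists_mem_Ico_eq_or {E : Type*} [NormedAddCommGroup E]
    (hτ : 0 < τ) (t : ℝ) : ∃ u ∈ Set.Ico 0 τ,
    ∃ ε : ℤˣ, ∀ g : ℝ → E, Function.Antiperiodic g τ → g t = ε • g u := by
  obtain ⟨m, hm, -⟩ := existsUnique_add_zsmul_mem_Ico hτ t 0
  refine ⟨t + m • τ, by simpa using hm, m.negOnePow⁻¹, fun g hg => ?_⟩
  rw [hg.add_zsmul_eq]
  exact (inv_smul_smul m.negOnePow (g t)).symm

lemma norm_units_smul {E : Type*} [NormedAddCommGroup E] (ε : ℤˣ) (x : E) : ‖ε • x‖ = ‖x‖ := by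
  rcases Int.units_eq_one_or ε with rfl | rfl <;> simp

lemma Function.Antiperiodic.norm_le_of_Ico {E : Type*} [NormedAddCommGroup E]
    {g : ℝ → E} (hτ : 0 < τ) {B : ℝ}
    (hg : Function.Antiperiodic g τ) (hb : ∀ t ∈ Set.Icc 0 τ, ‖g t‖ ≤ B) (t : ℝ) : ‖g t‖ ≤ B := by
  obtain ⟨u, hu, ε, h⟩ := Function.Antiperiodic.exists_mem_Ico_eq_or (E := E) hτ t
  rw [h g hg, norm_units_smul]
  exact hb u ⟨hu.1, hu.2.le⟩

lemma antiperiodic_antiPrimitive (hg : Continuous g) (ha : Function.Antiperiodic g τ) :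
    Function.Antiperiodic (antiPrimitive τ g) τ := by
  intro t
  have h1 : ∫ u in (0 : ℝ)..(t + τ), g u = (∫ u in (0 : ℝ)..τ, g u) - ∫ u in (0 : ℝ)..t, g u := by
    rw [← intervalIntegral.integral_add_adjacent_intervals (hg.intervalIntegrable 0 τ)
      (hg.intervalIntegrable τ (t + τ)), sub_eq_add_neg, ← intervalIntegral.integral_neg]
    congr 1
    have := intervalIntegral.integral_comp_add_right (a := 0) (b := t) g τ
    rw [zero_add] at this
    rw [← this]
    simp only [ha _]
  rw [antiPrimitive, antiPrimitive, h1]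
  module

variable [CompleteSpace F]

lemma hasDerivAt_antiPrimitive (hg : Continuous g) (t : ℝ) :
    HasDerivAt (antiPrimitive τ g) (g t) t :=
  (hg.integral_hasStrictDerivAt 0 t).hasDerivAt.sub_const _

lemma continuous_antiPrimitive (hg : Continuous g) : Continuous (antiPrimitive τ g) :=
  continuous_iff_continuousAt.2 fun t => (hasDerivAt_antiPrimitive hg t).continuousAt

/-- An antiperiodic function is the antiperiodic primitive of its derivative. -/
lemma eq_antiPrimitive {x : ℝ → F} (hg : Continuous g) (hx : ∀ t, HasDerivAt x (g t) t)
    (ha : Function.Antiperiodic x τ) : x = antiPrimitive τ g := by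
  have h : ∀ t, ∫ u in (0 : ℝ)..t, g u = x t - x 0 := fun t =>
    intervalIntegral.integral_eq_sub_of_hasDerivAt (fun u _ => hx u) (hg.intervalIntegrable _ _)
  funext t
  rw [antiPrimitive, h, h, ha.eq]
  module

end Antiprimitive

section Variational

variable {F : Type*} [NormedAddCommGroup F] [InnerProductSpace ℝ F]

/-- The action over `[0, τ]` of the path with velocity `v`, for unit masses. -/
def halfAction (τ : ℝ) (W : ℝ → F → ℝ) (v : ℝ → F) : ℝ :=
  ∫ t in (0 : ℝ)..τ, (1 / 2 * ‖v t‖ ^ 2 - W t (antiPrimitive τ v t))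

/-- The velocity of the antiperiodic solution of `ÿ = -G(t, x)`, `x` having velocity `v`. -/
def response (τ : ℝ) (G : ℝ → F → F) (v : ℝ → F) : ℝ → F :=
  antiPrimitive τ fun t => -G t (antiPrimitive τ v t)

/-- A velocity of an antiperiodic `C¹` path in `Ω`. -/
structure IsVelocity (τ : ℝ) (Ω : Set F) (v : ℝ → F) : Prop where
  continuous : Continuous v
  antiperiodic : Function.Antiperiodic v τ
  mem : ∀ t, antiPrimitive τ v t ∈ Ω

/-- A potential `W` on `Ω` with gradient `G`, invariant under `(t, x) ↦ (t + τ, -x)`, for which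
the sublevels of the action are relatively compact. -/
structure IsCoerciveSystem (τ : ℝ) (Ω : Set F) (W : ℝ → F → ℝ) (G : ℝ → F → F) : Prop where
  pos : 0 < τ
  isOpen : IsOpen Ω
  continuousOn_potential : ContinuousOn (fun p : ℝ × F => W p.1 p.2) (Set.univ ×ˢ Ω)
  continuousOn_gradient : ContinuousOn (fun p : ℝ × F => G p.1 p.2) (Set.univ ×ˢ Ω)
  hasFDerivAt : ∀ t, ∀ x ∈ Ω, HasFDerivAt (W t) (innerSL ℝ (G t x)) x
  gradient_neg : ∀ t, ∀ x ∈ Ω, -x ∈ Ω → G (t + τ) (-x) = -G t x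
  compact : ∀ B : ℝ, ∃ C ⊆ Ω, IsCompact C ∧ ∃ R, ∀ v, IsVelocity τ Ω v → halfAction τ W v ≤ B →
    (∀ t, antiPrimitive τ v t ∈ C) ∧ ∫ t in (0 : ℝ)..τ, ‖v t‖ ^ 2 ≤ R

variable {τ : ℝ} {Ω : Set F} {W : ℝ → F → ℝ} {G : ℝ → F → F} {v : ℝ → F}

lemma continuous_comp_path {E X : Type*} [TopologicalSpace E] [TopologicalSpace X] {Ω : Set X}
    {H : ℝ → X → E} {x : ℝ → X}
    (hH : ContinuousOn (fun p : ℝ × X => H p.1 p.2) (Set.univ ×ˢ Ω)) (hx : Continuous x)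
    (hm : ∀ t, x t ∈ Ω) : Continuous fun t => H t (x t) :=
  hH.comp_continuous (continuous_id.prodMk hx) fun t => ⟨trivial, hm t⟩

namespace IsCoerciveSystem

lemma antiperiodic_force (S : IsCoerciveSystem τ Ω W G) (hv : IsVelocity τ Ω v) :
    Function.Antiperiodic (fun t => -G t (antiPrimitive τ v t)) τ := by
  intro t
  have h := antiperiodic_antiPrimitive hv.continuous hv.antiperiodic t
  have h2 := hv.mem (t + τ)
  simp only [h] at h2 ⊢
  rw [S.gradient_neg t _ (hv.mem t) h2]

variable [FiniteDimensional ℝ F]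

lemma continuous_force (S : IsCoerciveSystem τ Ω W G) (hv : IsVelocity τ Ω v) :
    Continuous fun t => -G t (antiPrimitive τ v t) :=
  (continuous_comp_path S.continuousOn_gradient (continuous_antiPrimitive hv.continuous)
    hv.mem).neg

lemma continuous_potential (S : IsCoerciveSystem τ Ω W G) (hv : IsVelocity τ Ω v) :
    Continuous fun t => W t (antiPrimitive τ v t) :=
  continuous_comp_path S.continuousOn_potential (continuous_antiPrimitive hv.continuous) hv.mem

lemma continuous_response (S : IsCoerciveSystem τ Ω W G) (hv : IsVelocity τ Ω v) :
    Continuous (response τ G v) :=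
  continuous_antiPrimitive (S.continuous_force hv)

lemma antiperiodic_response (S : IsCoerciveSystem τ Ω W G) (hv : IsVelocity τ Ω v) :
    Function.Antiperiodic (response τ G v) τ :=
  antiperiodic_antiPrimitive (S.continuous_force hv) (S.antiperiodic_force hv)

lemma halfAction_eq (S : IsCoerciveSystem τ Ω W G) (hv : IsVelocity τ Ω v) :
    halfAction τ W v =
    1 / 2 * (∫ t in (0 : ℝ)..τ, ‖v t‖ ^ 2) - ∫ t in (0 : ℝ)..τ, W t (antiPrimitive τ v t) := by
  rw [halfAction, intervalIntegral.integral_sub, intervalIntegral.integral_const_mul]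
  · exact ((hv.continuous.norm.pow 2).intervalIntegrable _ _).const_mul _
  · exact (S.continuous_potential hv).intervalIntegrable _ _

/-- Integration by parts against the response. -/
lemma integral_inner_gradient (S : IsCoerciveSystem τ Ω W G) (hv : IsVelocity τ Ω v)
    {e : ℝ → F} (he : Continuous e)
    (ha : Function.Antiperiodic e τ) :
    ∫ t in (0 : ℝ)..τ, inner ℝ (G t (antiPrimitive τ v t)) (antiPrimitive τ e t) =
      ∫ t in (0 : ℝ)..τ, inner ℝ (response τ G v t) (e t) := by
  have hf := S.continuous_force hv
  have hd : ∀ t, HasDerivAt (fun t => inner ℝ (response τ G v t) (antiPrimitive τ e t))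
      (inner ℝ (response τ G v t) (e t) +
        inner ℝ (-G t (antiPrimitive τ v t)) (antiPrimitive τ e t)) t := fun t =>
    (hasDerivAt_antiPrimitive hf t).inner ℝ (hasDerivAt_antiPrimitive he t)
  have c1 : Continuous fun t => inner ℝ (response τ G v t) (e t) :=
    (S.continuous_response hv).inner he
  have c2 : Continuous fun t => inner ℝ (-G t (antiPrimitive τ v t)) (antiPrimitive τ e t) :=
    hf.inner (continuous_antiPrimitive he)
  have h := intervalIntegral.integral_eq_sub_of_hasDerivAt (a := 0) (b := τ) (fun t _ => hd t)
    ((c1.add c2).intervalIntegrable _ _)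
  rw [intervalIntegral.integral_add (c1.intervalIntegrable _ _) (c2.intervalIntegrable _ _),
    (S.antiperiodic_response hv).eq, (antiperiodic_antiPrimitive he ha).eq, inner_neg_neg,
    sub_self] at h
  simp only [inner_neg_left, intervalIntegral.integral_neg] at h
  linarith

/-- Effect of a step in the direction of the negative gradient on the action. -/
lemma halfAction_step_le (S : IsCoerciveSystem τ Ω W G) (hv : IsVelocity τ Ω v)
    {e : ℝ → F}
    (he : e = fun t => v t - response τ G v t) {s ω q : ℝ} (hs : 0 ≤ s) (hω : 0 ≤ ω)
    (hq : ∀ t, ‖antiPrimitive τ e t‖ ≤ q)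
    (hball : ∀ t ∈ Set.Icc 0 τ, ∀ z, ‖z - antiPrimitive τ v t‖ ≤ s * q →
      z ∈ Ω ∧ ‖G t z - G t (antiPrimitive τ v t)‖ ≤ ω)
    (hv' : IsVelocity τ Ω fun t => v t - s • e t) :
    halfAction τ W (fun t => v t - s • e t) ≤ halfAction τ W v
      - (s - s ^ 2 / 2) * (∫ t in (0 : ℝ)..τ, ‖e t‖ ^ 2) + s * ω * τ * q := by
  have hce : Continuous e := he ▸ hv.continuous.sub (S.continuous_response hv)
  have hae : Function.Antiperiodic e τ := by
    intro t
    simp only [he]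
    rw [hv.antiperiodic, S.antiperiodic_response hv]
    abel
  set d := antiPrimitive τ e with hd
  set x := antiPrimitive τ v with hx
  have hx' : antiPrimitive τ (fun t => v t - s • e t) = fun t => x t - s • d t := by
    rw [antiPrimitive_sub (h := fun t => s • e t) hv.continuous (hce.const_smul s),
      antiPrimitive_smul]
  have hcd : Continuous d := continuous_antiPrimitive hce
  have hG : Continuous fun t => inner ℝ (G t (x t)) (d t) := by
    exact (continuous_comp_path S.continuousOn_gradient (continuous_antiPrimitive hv.continuous)
      hv.mem).inner hcd
  have hpot : ∀ t ∈ Set.Icc 0 τ, W t (x t) - s * inner ℝ (G t (x t)) (d t) - s * ω * q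
      ≤ W t (x t - s • d t) := by
    intro t ht
    have hsub : ∀ z ∈ Metric.closedBall (x t) (s * q), ‖z - x t‖ ≤ s * q := fun z hz => by
      rwa [← dist_eq_norm]
    have h0 : 0 ≤ s * q := mul_nonneg hs ((norm_nonneg _).trans (hq t))
    have hsd : ‖x t - s • d t - x t‖ ≤ s * q := by
      rw [sub_sub_cancel_left, norm_neg, norm_smul, Real.norm_of_nonneg hs]
      exact mul_le_mul_of_nonneg_left (hq t) hs
    have := (convex_closedBall (x t) (s * q)).norm_image_sub_le_of_norm_hasFDerivWithin_le'
      (f := W t) (f' := fun z => innerSL ℝ (G t z)) (φ := innerSL ℝ (G t (x t))) (C := ω)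
      (x := x t) (y := x t - s • d t)
      (fun z hz => (S.hasFDerivAt t z (hball t ht z (hsub z hz)).1).hasFDerivWithinAt)
      (fun z hz => by
        rw [← map_sub, innerSL_apply_norm]
        exact (hball t ht z (hsub z hz)).2)
      (Metric.mem_closedBall_self h0) (by rwa [Metric.mem_closedBall, dist_eq_norm])
    have h2 := (abs_le.1 this).1
    have h3 : ω * ‖x t - s • d t - x t‖ ≤ ω * (s * q) := mul_le_mul_of_nonneg_left hsd hω
    have h4 : innerSL ℝ (G t (x t)) (x t - s • d t - x t) = -(s * inner ℝ (G t (x t)) (d t)) := by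
      rw [sub_sub_cancel_left, map_neg, map_smul]
      rfl
    rw [h4] at h2
    linarith
  have cW := S.continuous_potential hv
  have cW' := S.continuous_potential hv'
  have csG : Continuous fun t => s * inner ℝ (G t (x t)) (d t) := hG.const_mul s
  have cWG : Continuous fun t => W t (x t) - s * inner ℝ (G t (x t)) (d t) := cW.sub csG
  rw [S.halfAction_eq hv, S.halfAction_eq hv']
  simp only [hx'] at cW' ⊢
  have hτ := S.pos
  have i1 : ∫ t in (0 : ℝ)..τ, (W t (x t) - s * inner ℝ (G t (x t)) (d t) - s * ω * q) ≤
      ∫ t in (0 : ℝ)..τ, W t (x t - s • d t) :=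
    intervalIntegral.integral_mono_on hτ.le
      ((cWG.sub continuous_const).intervalIntegrable _ _)
      (cW'.intervalIntegrable _ _) hpot
  rw [intervalIntegral.integral_sub (cWG.intervalIntegrable _ _)
    intervalIntegrable_const, intervalIntegral.integral_sub (cW.intervalIntegrable _ _)
    (csG.intervalIntegrable _ _), intervalIntegral.integral_const_mul,
    intervalIntegral.integral_const, smul_eq_mul, sub_zero,
    S.integral_inner_gradient hv hce hae] at i1
  have c3 : Continuous fun t => inner ℝ (response τ G v t) (e t) :=
    (S.continuous_response hv).inner hce
  have i2 : ∫ t in (0 : ℝ)..τ, ‖v t - s • e t‖ ^ 2 = (∫ t in (0 : ℝ)..τ, ‖v t‖ ^ 2)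
      - 2 * s * (∫ t in (0 : ℝ)..τ, inner ℝ (response τ G v t) (e t))
      - (2 * s - s ^ 2) * ∫ t in (0 : ℝ)..τ, ‖e t‖ ^ 2 := by
    have cv2 : Continuous fun t => ‖v t‖ ^ 2 := hv.continuous.norm.pow 2
    have ce2 : Continuous fun t => ‖e t‖ ^ 2 := hce.norm.pow 2
    have c4 : Continuous fun t => 2 * s * inner ℝ (response τ G v t) (e t) := c3.const_mul _
    have c5 : Continuous fun t => ‖v t‖ ^ 2 - 2 * s * inner ℝ (response τ G v t) (e t) :=
      cv2.sub c4
    have c6 : Continuous fun t => (2 * s - s ^ 2) * ‖e t‖ ^ 2 := ce2.const_mul _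
    rw [← intervalIntegral.integral_const_mul, ← intervalIntegral.integral_const_mul,
      ← intervalIntegral.integral_sub (cv2.intervalIntegrable _ _) (c4.intervalIntegrable _ _),
      ← intervalIntegral.integral_sub (c5.intervalIntegrable _ _) (c6.intervalIntegrable _ _)]
    congr 1
    funext t
    have hr : v t = response τ G v t + e t := by
      rw [he]
      exact (add_sub_cancel _ _).symm
    rw [norm_sub_sq_real, inner_smul_right, norm_smul, mul_pow, Real.norm_eq_abs, sq_abs, hr,
      inner_add_left, real_inner_self_eq_norm_sq]
    ring
  rw [i2]
  linarith

end IsCoerciveSystem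
end Variational

section PalaisSmale

variable {F : Type*} [NormedAddCommGroup F]

/-- Sequential compactness of bounded equi-Lipschitz antiperiodic functions. -/
lemma exists_subseq_tendsto_antiperiodic [ProperSpace F] {τ : ℝ} (hτ : 0 < τ) {u : ℕ → ℝ → F}
    {K : NNReal} {B : ℝ} (hu : ∀ n, LipschitzWith K (u n)) (hb : ∀ n t, ‖u n t‖ ≤ B)
    (ha : ∀ n, Function.Antiperiodic (u n) τ) :
    ∃ φ : ℕ → ℕ, StrictMono φ ∧ ∃ w : ℝ → F, LipschitzWith K w ∧ Function.Antiperiodic w τ ∧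
      ∀ t, Tendsto (fun n => u (φ n) t) atTop (nhds (w t)) := by
  let r : ℕ → BoundedContinuousFunction (Set.Icc 0 τ) F := fun n =>
    BoundedContinuousFunction.mkOfCompact ⟨fun t => u n t, (hu n).continuous.comp
      continuous_subtype_val⟩
  have hc : IsCompact (closure (Set.range r)) := by
    refine BoundedContinuousFunction.arzela_ascoli (Metric.closedBall 0 B)
      (isCompact_closedBall 0 B) _ ?_ ?_
    · rintro _ x ⟨n, rfl⟩
      rw [mem_closedBall_zero_iff]
      exact hb n x
    · refine (LipschitzWith.uniformEquicontinuous _ K ?_).equicontinuous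
      rintro ⟨_, n, rfl⟩
      have := (hu n).comp (LipschitzWith.subtype_val (Set.Icc 0 τ))
      rwa [mul_one] at this
  obtain ⟨l, -, φ, hφ, hl⟩ := hc.tendsto_subseq fun n => subset_closure (Set.mem_range_self n)
  have hI : ∀ t : Set.Icc 0 τ, Tendsto (fun n => u (φ n) t) atTop (nhds (l t)) := fun t =>
    ((continuous_eval_const t).tendsto l).comp hl
  have hex : ∀ t, ∃ y, Tendsto (fun n => u (φ n) t) atTop (nhds y) := by
    intro t
    obtain ⟨s, hs, ε, h⟩ := Function.Antiperiodic.exists_mem_Ico_eq_or (E := F) hτ t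
    have := hI ⟨s, hs.1, hs.2.le⟩
    simp only [fun n => h _ (ha n)]
    rcases Int.units_eq_one_or ε with rfl | rfl
    · exact ⟨_, by simpa using this⟩
    · exact ⟨_, by simpa only [Units.neg_smul, one_smul] using this.neg⟩
  choose w hw using hex
  refine ⟨φ, hφ, w, ?_, fun t => ?_, hw⟩
  · refine LipschitzWith.of_dist_le_mul fun s t => ?_
    exact le_of_tendsto' ((hw s).dist (hw t)) fun n => (hu _).dist_le_mul s t
  · refine tendsto_nhds_unique (hw (t + τ)) ?_
    simpa only [fun n => ha n t] using (hw t).neg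

lemma tendsto_comp_path {E X : Type*} [TopologicalSpace E] [TopologicalSpace X] {Ω : Set X}
    (hΩ : IsOpen Ω) {H : ℝ → X → E}
    (hH : ContinuousOn (fun p : ℝ × X => H p.1 p.2) (Set.univ ×ˢ Ω)) {x : ℕ → X} {y : X}
    (hy : y ∈ Ω) (hx : Tendsto x atTop (nhds y)) {t : ℝ} :
    Tendsto (fun n => H t (x n)) atTop (nhds (H t y)) :=
  (hH.continuousAt (x := (t, y)) ((isOpen_univ.prod hΩ).mem_nhds ⟨trivial, hy⟩)).tendsto.comp
    (tendsto_const_nhds.prodMk_nhds hx)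

variable [InnerProductSpace ℝ F]
variable {τ : ℝ} {Ω : Set F} {W : ℝ → F → ℝ} {G : ℝ → F → F} {v : ℝ → F}

lemma norm_antiPrimitive_le {e : ℝ → F} (hτ : 0 < τ) (he : Continuous e)
    (ha : Function.Antiperiodic e τ) (t : ℝ) :
    ‖antiPrimitive τ e t‖ ≤ Real.sqrt (τ * ∫ t in (0 : ℝ)..τ, ‖e t‖ ^ 2) := by
  refine (antiperiodic_antiPrimitive he ha).norm_le_of_Ico hτ (fun t ht => ?_) t
  have h1 := norm_antiPrimitive_le_integral he ht
  have h2 := sq_integral_norm_le hτ.le he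
  have h3 : 0 ≤ ∫ t in (0 : ℝ)..τ, ‖e t‖ :=
    intervalIntegral.integral_nonneg hτ.le fun t _ => norm_nonneg _
  refine h1.trans ((half_le_self h3).trans (Real.le_sqrt_of_sq_le ?_))
  simpa using h2

variable [FiniteDimensional ℝ F]

namespace IsCoerciveSystem

lemma exists_force_bound (S : IsCoerciveSystem τ Ω W G) {C : Set F} (hC : IsCompact C)
    (hCΩ : C ⊆ Ω) : ∃ K : NNReal, ∀ v, IsVelocity τ Ω v → (∀ t, antiPrimitive τ v t ∈ C) →
      (∀ t, ‖-G t (antiPrimitive τ v t)‖ ≤ K) ∧ ∀ t, ‖response τ G v t‖ ≤ K := by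
  have hcomp : IsCompact (Set.Icc 0 τ ×ˢ C) := isCompact_Icc.prod hC
  obtain ⟨K, hK⟩ := hcomp.exists_bound_of_continuousOn
    (S.continuousOn_gradient.mono (Set.prod_mono (Set.subset_univ _) hCΩ))
  refine ⟨⟨max 0 (max K (τ * K)), le_max_left _ _⟩, fun v hv hvC => ?_⟩
  have h1 : ∀ t, ‖-G t (antiPrimitive τ v t)‖ ≤ K :=
    (S.antiperiodic_force hv).norm_le_of_Ico S.pos fun t ht => by
      rw [norm_neg]
      exact hK (t, _) ⟨ht, hvC t⟩
  refine ⟨fun t => (h1 t).trans ((le_max_left _ _).trans (le_max_right _ _)), ?_⟩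
  refine (S.antiperiodic_response hv).norm_le_of_Ico S.pos fun t ht => ?_
  refine le_trans ?_ ((le_max_right K (τ * K)).trans (le_max_right 0 _))
  refine (norm_antiPrimitive_le_integral (S.continuous_force hv) ht).trans ?_
  have h2 : ∫ u in (0 : ℝ)..τ, ‖-G u (antiPrimitive τ v u)‖ ≤ ∫ _u in (0 : ℝ)..τ, K :=
    intervalIntegral.integral_mono_on S.pos.le
      ((S.continuous_force hv).norm.intervalIntegrable _ _) intervalIntegrable_const
      fun t _ => h1 t
  rw [intervalIntegral.integral_const, sub_zero, smul_eq_mul] at h2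
  have h3 : 0 ≤ K := (norm_nonneg _).trans (h1 0)
  nlinarith [mul_nonneg S.pos.le h3]

/-- If all antiperiodic solutions have action below `A`, then the gradient of the action is bounded
away from zero between the levels `A` and `B`. -/
lemma exists_le_residual (S : IsCoerciveSystem τ Ω W G) {A : ℝ}
    (hA : ∀ v, IsVelocity τ Ω v → response τ G v = v → halfAction τ W v < A) (B : ℝ) :
    ∃ σ > 0, ∀ v, IsVelocity τ Ω v → A ≤ halfAction τ W v → halfAction τ W v ≤ B →
      σ ≤ ∫ t in (0 : ℝ)..τ, ‖v t - response τ G v t‖ ^ 2 := by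
  obtain ⟨C, hCΩ, hC, R, hR⟩ := S.compact B
  obtain ⟨K, hK⟩ := S.exists_force_bound hC hCΩ
  have hcomp : IsCompact (Set.Icc 0 τ ×ˢ C) := isCompact_Icc.prod hC
  obtain ⟨L, hL⟩ := hcomp.exists_bound_of_continuousOn
    (S.continuousOn_potential.mono (Set.prod_mono (Set.subset_univ _) hCΩ))
  by_contra! hcon
  choose v hv hvA hvB hres using fun n : ℕ => hcon (1 / (n + 1)) Nat.one_div_pos_of_nat
  have hvC := fun n => (hR _ (hv n) (hvB n)).1
  have hcr := fun n => S.continuous_response (hv n)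
  obtain ⟨φ, hφ, w, hwL, hwa, hw⟩ := exists_subseq_tendsto_antiperiodic S.pos (K := K)
    (u := fun n => response τ G (v n))
    (fun n => lipschitzWith_of_nnnorm_deriv_le
      (fun t => (hasDerivAt_antiPrimitive (S.continuous_force (hv n)) t).differentiableAt)
      fun t => by
        rw [response, (hasDerivAt_antiPrimitive (S.continuous_force (hv n)) t).deriv]
        exact (hK _ (hv n) (hvC n)).1 t)
    (fun n => (hK _ (hv n) (hvC n)).2) (fun n => S.antiperiodic_response (hv n))
  set e : ℕ → ℝ → F := fun n t => v (φ n) t - response τ G (v (φ n)) t with he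
  have hce : ∀ n, Continuous (e n) := fun n => (hv _).continuous.sub (hcr _)
  have hae : ∀ n, Function.Antiperiodic (e n) τ := fun n t => by
    simp only [he]
    rw [(hv _).antiperiodic, S.antiperiodic_response (hv _)]
    abel
  have hE : Tendsto (fun n => ∫ t in (0 : ℝ)..τ, ‖e n t‖ ^ 2) atTop (nhds 0) :=
    squeeze_zero (fun n => intervalIntegral.integral_nonneg S.pos.le fun t _ => sq_nonneg _)
      (fun n => (hres (φ n)).le) (tendsto_one_div_add_atTop_nhds_zero_nat.comp hφ.tendsto_atTop)
  have hsqrt : Tendsto (fun n => Real.sqrt (τ * ∫ t in (0 : ℝ)..τ, ‖e n t‖ ^ 2)) atTop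
      (nhds 0) := by
    have := (hE.const_mul τ).sqrt
    rwa [mul_zero, Real.sqrt_zero] at this
  have hd : ∀ t, Tendsto (fun n => antiPrimitive τ (e n) t) atTop (nhds 0) := fun t =>
    squeeze_zero_norm (fun n => norm_antiPrimitive_le S.pos (hce n) (hae n) t) hsqrt
  have hx : ∀ t, Tendsto (fun n => antiPrimitive τ (v (φ n)) t) atTop
      (nhds (antiPrimitive τ w t)) := by
    intro t
    have h1 := (tendsto_antiPrimitive (τ := τ) (fun n => hcr (φ n))
      (fun n => (hK _ (hv (φ n)) (hvC (φ n))).2) hw t).add (hd t)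
    rw [add_zero] at h1
    refine h1.congr fun n => ?_
    rw [he, antiPrimitive_sub (hv _).continuous (hcr _)]
    exact add_sub_cancel _ _
  have hwC : ∀ t, antiPrimitive τ w t ∈ C := fun t =>
    hC.isClosed.mem_of_tendsto (hx t) (Eventually.of_forall fun n => hvC (φ n) t)
  have hwv : IsVelocity τ Ω w := ⟨hwL.continuous, hwa, fun t => hCΩ (hwC t)⟩
  have hsol : response τ G w = w := by
    funext t
    refine tendsto_nhds_unique ?_ (hw t)
    exact tendsto_antiPrimitive (fun n => S.continuous_force (hv (φ n)))
      (fun n => (hK _ (hv (φ n)) (hvC (φ n))).1)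
        (fun t => (tendsto_comp_path S.isOpen S.continuousOn_gradient (hCΩ (hwC t)) (hx t)).neg) t
  refine (hA w hwv hsol).not_ge ?_
  have hpot : Tendsto (fun n => ∫ t in (0 : ℝ)..τ, W t (antiPrimitive τ (v (φ n)) t)) atTop
      (nhds (∫ t in (0 : ℝ)..τ, W t (antiPrimitive τ w t))) := by
    refine intervalIntegral.tendsto_integral_filter_of_dominated_convergence (fun _ => L)
      (Eventually.of_forall fun n => (S.continuous_potential (hv _)).aestronglyMeasurable)
      (Eventually.of_forall fun n => Eventually.of_forall fun t ht => ?_)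
      intervalIntegrable_const (Eventually.of_forall fun t _ =>
        tendsto_comp_path S.isOpen S.continuousOn_potential (hCΩ (hwC t)) (hx t))
    rw [Set.uIoc_of_le S.pos.le] at ht
    exact hL (t, _) ⟨Set.Ioc_subset_Icc_self ht, hvC _ t⟩
  have hkin : Tendsto (fun n => ∫ t in (0 : ℝ)..τ, ‖response τ G (v (φ n)) t‖ ^ 2) atTop
      (nhds (∫ t in (0 : ℝ)..τ, ‖w t‖ ^ 2)) :=
    intervalIntegral.tendsto_integral_filter_of_dominated_convergence (fun _ => (K : ℝ) ^ 2)
      (Eventually.of_forall fun n => ((hcr _).norm.pow 2).aestronglyMeasurable)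
      (Eventually.of_forall fun n => Eventually.of_forall fun t _ => by
        rw [norm_pow, norm_norm]
        exact pow_le_pow_left₀ (norm_nonneg _) ((hK _ (hv (φ n)) (hvC (φ n))).2 t) 2)
      intervalIntegrable_const (Eventually.of_forall fun t _ => (hw t).norm.pow 2)
  rw [S.halfAction_eq hwv]
  have hlim := ((hkin.const_mul (1 / 2)).sub hpot).add
    ((hsqrt.const_mul (K : ℝ)).add (hE.const_mul (1 / 2)))
  rw [mul_zero, mul_zero, add_zero, add_zero] at hlim
  refine ge_of_tendsto' hlim fun n => (hvA (φ n)).trans ?_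
  rw [S.halfAction_eq (hv _)]
  have c1 : Continuous fun t => ‖response τ G (v (φ n)) t‖ ^ 2 := (hcr _).norm.pow 2
  have c2 : Continuous fun t => 2 * K * ‖e n t‖ := (hce n).norm.const_mul _
  have c3 : Continuous fun t => ‖e n t‖ ^ 2 := (hce n).norm.pow 2
  have c4 : Continuous fun t => ‖response τ G (v (φ n)) t‖ ^ 2 + 2 * K * ‖e n t‖ := c1.add c2
  have hmono : ∫ t in (0 : ℝ)..τ, ‖v (φ n) t‖ ^ 2 ≤ ∫ t in (0 : ℝ)..τ,
      (‖response τ G (v (φ n)) t‖ ^ 2 + 2 * K * ‖e n t‖ + ‖e n t‖ ^ 2) := by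
    refine intervalIntegral.integral_mono_on S.pos.le
      (((hv _).continuous.norm.pow 2).intervalIntegrable _ _)
      ((c4.add c3).intervalIntegrable _ _) fun t _ => ?_
    have h1 : v (φ n) t = response τ G (v (φ n)) t + e n t := (add_sub_cancel _ _).symm
    have h2 := norm_add_le (response τ G (v (φ n)) t) (e n t)
    have h3 := (hK _ (hv (φ n)) (hvC (φ n))).2 t
    have h4 : ‖v (φ n) t‖ ^ 2 ≤ (‖response τ G (v (φ n)) t‖ + ‖e n t‖) ^ 2 := by
      rw [h1]
      exact pow_le_pow_left₀ (norm_nonneg _) h2 2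
    nlinarith [mul_le_mul_of_nonneg_right h3 (norm_nonneg (e n t))]
  rw [intervalIntegral.integral_add (c4.intervalIntegrable _ _) (c3.intervalIntegrable _ _),
    intervalIntegral.integral_add (c1.intervalIntegrable _ _) (c2.intervalIntegrable _ _),
    intervalIntegral.integral_const_mul] at hmono
  have h5 : ∫ t in (0 : ℝ)..τ, ‖e n t‖ ≤ Real.sqrt (τ * ∫ t in (0 : ℝ)..τ, ‖e n t‖ ^ 2) := by
    refine Real.le_sqrt_of_sq_le ?_
    simpa using sq_integral_norm_le S.pos.le (hce n)
  have h6 := mul_le_mul_of_nonneg_left h5 K.2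
  have h7 : (K : ℝ) = K.1 := rfl
  rw [h7] at hmono ⊢
  linarith

end IsCoerciveSystem
end PalaisSmale

section Descent

variable {F : Type*} [NormedAddCommGroup F] [InnerProductSpace ℝ F] [FiniteDimensional ℝ F]
variable {τ : ℝ} {Ω : Set F} {W : ℝ → F → ℝ} {G : ℝ → F → F} {v : ℝ → F}

/-- The gradient of the action at the path with velocity `v`, as a velocity. -/
def actionGrad (τ : ℝ) (G : ℝ → F → F) (v : ℝ → F) (t : ℝ) : F := v t - response τ G v t

/-- The velocity after an Euler step of length `s` along the negative gradient. -/
def eulerStep (τ : ℝ) (G : ℝ → F → F) (s : ℝ) (v : ℝ → F) (t : ℝ) : F :=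
  v t - s • actionGrad τ G v t

namespace IsCoerciveSystem

lemma continuous_actionGrad (S : IsCoerciveSystem τ Ω W G) (hv : IsVelocity τ Ω v) :
    Continuous (actionGrad τ G v) := hv.continuous.sub (S.continuous_response hv)

lemma antiperiodic_actionGrad (S : IsCoerciveSystem τ Ω W G) (hv : IsVelocity τ Ω v) :
    Function.Antiperiodic (actionGrad τ G v) τ := fun t => by
  rw [actionGrad, actionGrad, hv.antiperiodic, S.antiperiodic_response hv]
  abel

lemma antiPrimitive_eulerStep (S : IsCoerciveSystem τ Ω W G) (hv : IsVelocity τ Ω v) (s t : ℝ) :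
    antiPrimitive τ (eulerStep τ G s v) t =
      antiPrimitive τ v t - s • antiPrimitive τ (actionGrad τ G v) t := by
  have := antiPrimitive_sub (τ := τ) (h := fun t => s • actionGrad τ G v t) hv.continuous
    ((S.continuous_actionGrad hv).const_smul s)
  rw [antiPrimitive_smul] at this
  exact congrFun this t

lemma integral_actionGrad_le (S : IsCoerciveSystem τ Ω W G) (hv : IsVelocity τ Ω v) {K : ℝ}
    (hK : ∀ t, ‖response τ G v t‖ ≤ K) : ∫ t in (0 : ℝ)..τ, ‖actionGrad τ G v t‖ ^ 2 ≤
      2 * (∫ t in (0 : ℝ)..τ, ‖v t‖ ^ 2) + 2 * τ * K ^ 2 := by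
  have c1 : Continuous fun t => 2 * ‖v t‖ ^ 2 := (hv.continuous.norm.pow 2).const_mul _
  have h : ∫ t in (0 : ℝ)..τ, ‖actionGrad τ G v t‖ ^ 2 ≤
      ∫ t in (0 : ℝ)..τ, (2 * ‖v t‖ ^ 2 + 2 * K ^ 2) := by
    refine intervalIntegral.integral_mono_on S.pos.le
      (((S.continuous_actionGrad hv).norm.pow 2).intervalIntegrable _ _)
      ((c1.add continuous_const).intervalIntegrable _ _) fun t _ => ?_
    have h1 : ‖actionGrad τ G v t‖ ≤ ‖v t‖ + K := (norm_sub_le _ _).trans (by gcongr; exact hK t)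
    have h2 := pow_le_pow_left₀ (norm_nonneg _) h1 2
    nlinarith [sq_nonneg (‖v t‖ - K)]
  rw [intervalIntegral.integral_add (c1.intervalIntegrable _ _) intervalIntegrable_const,
    intervalIntegral.integral_const_mul, intervalIntegral.integral_const, smul_eq_mul,
    sub_zero] at h
  linarith

/-- Small Euler steps decrease the action, above the level `A`, by a fixed amount. -/
lemma exists_eulerStep (S : IsCoerciveSystem τ Ω W G) {A : ℝ}
    (hA : ∀ v, IsVelocity τ Ω v → response τ G v = v → halfAction τ W v < A) (B : ℝ)
    {ε : ℝ} (hε : 0 < ε) :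
    ∃ s > 0, ∃ η > 0, ∀ v, IsVelocity τ Ω v → halfAction τ W v ≤ B →
      (∀ t, ‖s • antiPrimitive τ (actionGrad τ G v) t‖ ≤ ε) ∧ IsVelocity τ Ω (eulerStep τ G s v) ∧
      halfAction τ W (eulerStep τ G s v) ≤ max (halfAction τ W v - η) (A + 1) := by
  obtain ⟨C, hCΩ, hC, R, hR⟩ := S.compact B
  obtain ⟨K, hK⟩ := S.exists_force_bound hC hCΩ
  obtain ⟨σ, hσ, hres⟩ := S.exists_le_residual hA B
  have hτ := S.pos
  obtain ⟨ρ₀, hρ₀, hthick⟩ := hC.exists_cthickening_subset_open S.isOpen hCΩ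
  have huc := (isCompact_Icc (a := 0) (b := τ)).prod (hC.cthickening (r := ρ₀))
    |>.uniformContinuousOn_of_continuous
    (S.continuousOn_gradient.mono (Set.prod_mono (Set.subset_univ _) hthick))
  set c := min (Real.sqrt σ / 4) 1 with hc
  have hc0 : 0 < c := lt_min (by positivity) one_pos
  have hc1 : c ≤ Real.sqrt σ / 4 := min_le_left _ _
  have hc2 : c ≤ 1 := min_le_right _ _
  set ω := c / (τ * Real.sqrt τ) with hω
  have hsτ : 0 < Real.sqrt τ := Real.sqrt_pos.2 hτ
  have hω0 : 0 < ω := by positivity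
  obtain ⟨δ, hδ, hGδ⟩ := Metric.uniformContinuousOn_iff.1 huc ω hω0
  set ρ := min ρ₀ (δ / 2) with hρ
  have hρ0 : 0 < ρ := lt_min hρ₀ (half_pos hδ)
  set q := Real.sqrt (τ * (2 * R + 2 * τ * (K : ℝ) ^ 2)) with hq
  have hq0 : 0 ≤ q := Real.sqrt_nonneg _
  set s := min (1 / 2) (min ρ ε / (q + 1)) with hs
  have hs0 : 0 < s := lt_min one_half_pos (div_pos (lt_min hρ0 hε) (by linarith))
  have hs1 : s ≤ 1 / 2 := min_le_left _ _
  have hsq : s * q ≤ min ρ ε := by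
    have h1 : s * (q + 1) ≤ min ρ ε := (le_div_iff₀ (by linarith)).1 (min_le_right _ _)
    nlinarith
  refine ⟨s, hs0, s * σ / 2, by positivity, fun v hv hvB => ?_⟩
  obtain ⟨hvC, hvR⟩ := hR v hv hvB
  have hce := S.continuous_actionGrad hv
  have hae := S.antiperiodic_actionGrad hv
  set E := ∫ t in (0 : ℝ)..τ, ‖actionGrad τ G v t‖ ^ 2 with hE
  have hE0 : 0 ≤ E := intervalIntegral.integral_nonneg hτ.le fun t _ => sq_nonneg _
  have hER : E ≤ 2 * R + 2 * τ * (K : ℝ) ^ 2 :=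
    (S.integral_actionGrad_le hv (hK v hv hvC).2).trans (by linarith)
  have hd := norm_antiPrimitive_le hτ hce hae
  have hqE : Real.sqrt (τ * E) ≤ q := Real.sqrt_le_sqrt (mul_le_mul_of_nonneg_left hER hτ.le)
  have hsd : ∀ t, ‖s • antiPrimitive τ (actionGrad τ G v) t‖ ≤ min ρ ε := fun t => by
    rw [norm_smul, Real.norm_of_nonneg hs0.le]
    exact (mul_le_mul_of_nonneg_left ((hd t).trans hqE) hs0.le).trans hsq
  have hmem : ∀ t z, ‖z - antiPrimitive τ v t‖ ≤ ρ → z ∈ Metric.cthickening ρ₀ C := fun t z hz =>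
    Metric.mem_cthickening_of_dist_le z _ _ _ (hvC t)
      ((dist_eq_norm z _).le.trans (hz.trans (min_le_left _ _)))
  have hv' : IsVelocity τ Ω (eulerStep τ G s v) := by
    refine ⟨hv.continuous.sub (hce.const_smul s), fun t => ?_, fun t => ?_⟩
    · rw [eulerStep, eulerStep, hv.antiperiodic, hae]
      module
    · rw [S.antiPrimitive_eulerStep hv]
      refine hthick (hmem t _ ?_)
      rw [sub_sub_cancel_left, norm_neg]
      exact (hsd t).trans (min_le_left _ _)
  refine ⟨fun t => (hsd t).trans (min_le_right _ _), hv', ?_⟩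
  have key := S.halfAction_step_le hv (e := actionGrad τ G v) rfl hs0.le hω0.le hd
    (fun t ht z hz => by
      have hz' : ‖z - antiPrimitive τ v t‖ ≤ ρ := hz.trans
        ((mul_le_mul_of_nonneg_left hqE hs0.le).trans (hsq.trans (min_le_left _ _)))
      refine ⟨hthick (hmem t z hz'), ?_⟩
      rw [← dist_eq_norm]
      refine (hGδ (t, z) ⟨ht, hmem t z hz'⟩ (t, antiPrimitive τ v t)
        ⟨ht, Metric.self_subset_cthickening C (hvC t)⟩ ?_).le
      rw [Prod.dist_eq, dist_self, max_eq_right dist_nonneg, dist_eq_norm]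
      exact (hz'.trans (min_le_right _ _)).trans_lt (half_lt_self hδ)) hv'
  rw [← hE] at key
  have hD : E = Real.sqrt E ^ 2 := (Real.sq_sqrt hE0).symm
  set D := Real.sqrt E
  have hD0 : 0 ≤ D := Real.sqrt_nonneg _
  have hcD : s * ω * τ * Real.sqrt (τ * E) = s * (c * D) := by
    rw [Real.sqrt_mul hτ.le, hω]
    field_simp
    rfl
  rw [hcD] at key
  have hs2 : (s - s ^ 2 / 2) * E ≥ s * (3 / 4 * D ^ 2) := by
    rw [← hD]
    nlinarith [mul_nonneg hs0.le hE0]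
  change halfAction τ W (eulerStep τ G s v) ≤ _ at key
  rcases le_or_gt A (halfAction τ W v) with h | h
  · refine le_max_of_le_left (key.trans ?_)
    have h1 := hres v hv h hvB
    change σ ≤ E at h1
    have h2 : Real.sqrt σ ≤ D := Real.sqrt_le_sqrt h1
    have h3 : c * D ≤ D ^ 2 / 4 := by nlinarith
    have h4 : s * (c * D) ≤ s * (D ^ 2 / 4) := mul_le_mul_of_nonneg_left h3 hs0.le
    have h5 : s * σ ≤ s * D ^ 2 := mul_le_mul_of_nonneg_left (hD ▸ h1) hs0.le
    linarith
  · refine le_max_of_le_right (key.trans ?_)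
    have h3 : c * D - 3 / 4 * D ^ 2 ≤ 1 := by nlinarith [sq_nonneg (D - 2 / 3 * c)]
    nlinarith

/-- A class of families of paths stable under small Euler steps contains a family on which the
action is at most `A + 1`, provided all antiperiodic solutions have action below `A`. -/
theorem exists_family_le (S : IsCoerciveSystem τ Ω W G) {A : ℝ}
    (hA : ∀ v, IsVelocity τ Ω v → response τ G v = v → halfAction τ W v < A) {B : ℝ}
    (hAB : A + 1 ≤ B) {ε : ℝ} (hε : 0 < ε) {M : Type*} {Γ : (M → ℝ → F) → Prop}
    (hΓ : ∀ h, Γ h → ∀ m, IsVelocity τ Ω (h m))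
    (hstep : ∀ h, Γ h → (∀ m, halfAction τ W (h m) ≤ B) → ∀ s,
      (∀ m t, ‖s • antiPrimitive τ (actionGrad τ G (h m)) t‖ ≤ ε) →
      (∀ m, IsVelocity τ Ω (eulerStep τ G s (h m))) → Γ fun m => eulerStep τ G s (h m))
    {h₀ : M → ℝ → F} (h₀Γ : Γ h₀) (h₀B : ∀ m, halfAction τ W (h₀ m) ≤ B) :
    ∃ h, Γ h ∧ ∀ m, halfAction τ W (h m) ≤ A + 1 := by
  obtain ⟨s, -, η, hη, hE⟩ := S.exists_eulerStep hA B hε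
  have hind : ∀ n : ℕ, ∃ h, Γ h ∧ ∀ m, halfAction τ W (h m) ≤ max (B - n * η) (A + 1) := by
    intro n
    induction n with
    | zero => exact ⟨h₀, h₀Γ, fun m => le_max_of_le_left (by simpa using h₀B m)⟩
    | succ n ih =>
      obtain ⟨h, hh, hle⟩ := ih
      have hB : ∀ m, halfAction τ W (h m) ≤ B := fun m => (hle m).trans
        (max_le (sub_le_self _ (by positivity)) hAB)
      have hS := fun m => hE (h m) (hΓ h hh m) (hB m)
      refine ⟨_, hstep h hh hB s (fun m => (hS m).1) fun m => (hS m).2.1, fun m => ?_⟩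
      refine (hS m).2.2.trans (max_le ?_ (le_max_right _ _))
      rcases le_max_iff.1 (hle m) with h1 | h1
      · refine le_max_of_le_left ?_
        push_cast
        linarith
      · exact le_max_of_le_right (by linarith)
  obtain ⟨n, hn⟩ := exists_nat_gt ((B - (A + 1)) / η)
  obtain ⟨h, hh, hle⟩ := hind n
  refine ⟨h, hh, fun m => (hle m).trans (max_le ?_ le_rfl)⟩
  rw [div_lt_iff₀ hη] at hn
  linarith

end IsCoerciveSystem
end Descent

section PairPotential

variable {E : Type*} [NormedAddCommGroup E] [InnerProductSpace ℝ E] [FiniteDimensional ℝ E]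

/-- A `C¹` interaction potential, invariant under `(t, ξ) ↦ (t + τ, -ξ)`, with a strong force
singularity at the origin and sub-quadratic growth at infinity. -/
structure IsPairPotential (τ : ℝ) (V : ℝ → E → ℝ) : Prop where
  contDiffOn : ContDiffOn ℝ 1 (fun p : ℝ × E => V p.1 p.2) (Set.univ ×ˢ {0}ᶜ)
  symm : ∀ t ξ, V (t + τ) (-ξ) = V t ξ
  singular : ∀ M : ℝ, ∃ δ > 0, ∀ t ξ, ξ ≠ 0 → ‖ξ‖ < δ → V t ξ < -M
  strong : ∃ 𝒩 : Set E, IsOpen 𝒩 ∧ 0 ∈ 𝒩 ∧ ∃ U : E → ℝ, ContDiffOn ℝ 1 U (𝒩 \ {0}) ∧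
    Tendsto U (nhdsWithin 0 (𝒩 \ {0})) atTop ∧ ∀ t, ∀ ξ ∈ 𝒩 \ {0}, ‖gradient U ξ‖ ^ 2 ≤ -V t ξ
  growth : ∀ ε > 0, ∃ R : ℝ, ∀ t ξ, R < ‖ξ‖ → V t ξ ≤ ε * ‖ξ‖ ^ 2

lemma exists_rpow_le_mul_sq (c : ℝ) {θ : ℝ} (hθ : θ < 2) {ε : ℝ} (hε : 0 < ε) :
    ∃ R : ℝ, ∀ x, R < x → c * x ^ θ ≤ ε * x ^ 2 := by
  have h := (tendsto_rpow_neg_atTop (sub_pos.2 hθ)).const_mul c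
  rw [mul_zero] at h
  obtain ⟨R, hR⟩ := eventually_atTop.1 ((h.eventually_lt_const hε).and (eventually_gt_atTop 0))
  refine ⟨R, fun x hx => ?_⟩
  obtain ⟨h1, h2⟩ := hR x hx.le
  have e : x ^ θ = x ^ (-(2 - θ)) * x ^ 2 := by
    rw [← Real.rpow_natCast x 2, ← Real.rpow_add h2]
    congr 1
    push_cast
    ring
  rw [e, ← mul_assoc]
  exact mul_le_mul_of_nonneg_right h1.le (sq_nonneg x)

variable {τ : ℝ} {V : ℝ → E → ℝ}

/-- A potential growth moved along the path: the strong force condition bounds `U` at the start. -/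
lemma le_of_strong_force {𝒩 : Set E} (h𝒩 : IsOpen 𝒩) {U : E → ℝ}
    (hU : ContDiffOn ℝ 1 U (𝒩 \ {0})) {ρ : ℝ} (hρ : Metric.closedBall 0 ρ ⊆ 𝒩) {m : ℝ}
    (hm : ∀ ξ, ‖ξ‖ = ρ → U ξ ≤ m) {y y' : ℝ → E} {φ : ℝ → ℝ} (hy : ∀ t, HasDerivAt y (y' t) t)
    (hy' : Continuous y') (h0 : ∀ t, y t ≠ 0) (hφ : Continuous φ) (hφ0 : ∀ t, 0 ≤ φ t)
    (hUφ : ∀ t, y t ∈ 𝒩 \ {0} → ‖gradient U (y t)‖ ^ 2 ≤ φ t) {a b : ℝ} (hab : a ≤ b)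
    (ha : ‖y a‖ ≤ ρ) (hb : ρ ≤ ‖y b‖) :
    U (y a) ≤ m + 1 / 2 * ∫ t in a..b, (φ t + ‖y' t‖ ^ 2) := by
  have hcy : Continuous y := continuous_iff_continuousAt.2 fun t => (hy t).continuousAt
  have hcψ : Continuous fun t => φ t + ‖y' t‖ ^ 2 := hφ.add (hy'.norm.pow 2)
  obtain ⟨c, ⟨hc, hcρ⟩, hleast⟩ : ∃ c, IsLeast (Set.Icc a b ∩ {t | ‖y t‖ = ρ}) c := by
    refine (isCompact_Icc.inter_right (isClosed_eq hcy.norm continuous_const)).exists_isLeast ?_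
    obtain ⟨c, hc, h⟩ := intermediate_value_Icc hab hcy.norm.continuousOn ⟨ha, hb⟩
    exact ⟨c, hc, h⟩
  have hle : ∀ t ∈ Set.Icc a c, ‖y t‖ ≤ ρ := by
    intro t ht
    by_contra! hlt
    obtain ⟨s, hs, h⟩ := intermediate_value_Icc ht.1 hcy.norm.continuousOn ⟨ha, hlt.le⟩
    have h2 : c ≤ s := hleast ⟨⟨hs.1, hs.2.trans (ht.2.trans hc.2)⟩, h⟩
    have h3 : s = t := le_antisymm hs.2 (ht.2.trans h2)
    rw [h3] at h
    exact hlt.ne' h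
  have hopen : IsOpen (𝒩 \ {0}) := h𝒩.sdiff isClosed_singleton
  have hmem : ∀ t ∈ Set.Icc a c, y t ∈ 𝒩 \ {0} := fun t ht =>
    ⟨hρ (mem_closedBall_zero_iff.2 (hle t ht)), h0 t⟩
  have hderiv : ∀ t ∈ Set.Icc a c, HasDerivAt
      (fun t => U (y t) + 1 / 2 * ∫ u in a..t, (φ u + ‖y' u‖ ^ 2))
      (inner ℝ (gradient U (y t)) (y' t) + 1 / 2 * (φ t + ‖y' t‖ ^ 2)) t := by
    intro t ht
    have h1 : DifferentiableAt ℝ U (y t) :=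
      (hU.differentiableOn one_ne_zero).differentiableAt (hopen.mem_nhds (hmem t ht))
    have h2 := h1.hasGradientAt.hasFDerivAt.comp_hasDerivAt t (hy t)
    rw [InnerProductSpace.toDual_apply_apply] at h2
    exact h2.add ((hcψ.integral_hasStrictDerivAt a t).hasDerivAt.const_mul _)
  have hmono := monotoneOn_of_deriv_nonneg (convex_Icc a c)
    (fun t ht => (hderiv t ht).continuousAt.continuousWithinAt)
    (fun t ht => (hderiv t (interior_subset ht)).differentiableAt.differentiableWithinAt)
    (fun t ht => by
      have ht' := interior_subset ht
      rw [(hderiv t ht').deriv]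
      have h1 := (abs_le.1 (abs_real_inner_le_norm (gradient U (y t)) (y' t))).1
      have h2 := hUφ t (hmem t ht')
      nlinarith [sq_nonneg (‖gradient U (y t)‖ - ‖y' t‖)])
  have h := hmono ⟨le_rfl, hc.1⟩ ⟨hc.1, le_rfl⟩ hc.1
  simp only [intervalIntegral.integral_same, mul_zero, add_zero] at h
  have h2 : ∫ t in a..c, (φ t + ‖y' t‖ ^ 2) ≤ ∫ t in a..b, (φ t + ‖y' t‖ ^ 2) :=
    intervalIntegral.integral_mono_interval le_rfl hc.1 hc.2
      (ae_of_all _ fun t => add_nonneg (hφ0 t) (sq_nonneg _)) (hcψ.intervalIntegrable _ _)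
  have h3 := hm _ hcρ
  linarith

namespace IsPairPotential

lemma continuousOn (hV : IsPairPotential τ V) :
    ContinuousOn (fun p : ℝ × E => V p.1 p.2) (Set.univ ×ˢ {0}ᶜ) := hV.contDiffOn.continuousOn

lemma periodic (hV : IsPairPotential τ V) (ξ : E) : Function.Periodic (fun t => V t ξ) (2 * τ) := by
  intro t
  have h := hV.symm (t + τ) (-ξ)
  rw [neg_neg] at h
  change V (t + 2 * τ) ξ = V t ξ
  rw [two_mul, ← add_assoc, h, hV.symm]

/-- A quadratic upper bound with small coefficient. -/
lemma exists_le_add_mul_sq (hV : IsPairPotential τ V) (hτ : 0 < τ) {ε : ℝ} (hε : 0 < ε) :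
    ∃ C ≥ 0, ∀ t ξ, ξ ≠ 0 → V t ξ ≤ C + ε * ‖ξ‖ ^ 2 := by
  obtain ⟨R, hR⟩ := hV.growth ε hε
  obtain ⟨δ, hδ, hsing⟩ := hV.singular 0
  set A : Set E := Metric.closedBall 0 R \ Metric.ball 0 δ with hA
  have hAc : IsCompact A := (isCompact_closedBall 0 R).diff Metric.isOpen_ball
  obtain ⟨C, hC⟩ := (isCompact_Icc (a := 0) (b := 2 * τ)).prod hAc |>.exists_bound_of_continuousOn
    (hV.continuousOn.mono (Set.prod_mono (Set.subset_univ _) fun ξ hξ h0 => hξ.2 (by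
      rw [Set.mem_singleton_iff.1 h0]
      exact Metric.mem_ball_self hδ)))
  refine ⟨max C 0, le_max_right _ _, fun t ξ hξ => ?_⟩
  have hε' : 0 ≤ ε * ‖ξ‖ ^ 2 := by positivity
  have h0 : 0 ≤ max C 0 := le_max_right _ _
  rcases lt_or_ge ‖ξ‖ δ with h | h
  · have := hsing t ξ hξ h
    linarith
  rcases lt_or_ge R ‖ξ‖ with h' | h'
  · have := hR t ξ h'
    linarith
  · obtain ⟨s, hs, hst⟩ := (hV.periodic ξ).exists_mem_Ico₀ (by positivity) t
    change V t ξ = V s ξ at hst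
    rw [hst]
    have := hC (s, ξ) ⟨⟨hs.1, hs.2.le⟩, mem_closedBall_zero_iff.2 h',
      fun hb => (mem_ball_zero_iff.1 hb).not_ge h⟩
    have h2 := (le_abs_self _).trans this
    have h3 := le_max_left C 0
    linarith

/-- Paths with bounded action stay away from collisions. -/
lemma exists_le_norm (hV : IsPairPotential τ V) (hτ : 0 < τ) (C P Q : ℝ) :
    ∃ δ > 0, ∀ y y' : ℝ → E, (∀ t, HasDerivAt y (y' t) t) → Continuous y' → (∀ t, y t ≠ 0) →
      Function.Antiperiodic y τ → (∀ t, V t (y t) ≤ C) → ∫ t in (0 : ℝ)..τ, -V t (y t) ≤ P →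
      ∫ t in (0 : ℝ)..τ, ‖y' t‖ ^ 2 ≤ Q → ∀ t, δ ≤ ‖y t‖ := by
  obtain ⟨𝒩, h𝒩, h0𝒩, U, hU, hUlim, hUV⟩ := hV.strong
  obtain ⟨δ₁, hδ₁, hsing⟩ := hV.singular ((|P| + 1) / τ)
  obtain ⟨δ₂, hδ₂, hball⟩ := Metric.isOpen_iff.1 h𝒩 0 h0𝒩
  set ρ := min δ₁ δ₂ / 2 with hρ
  have hρ0 : 0 < ρ := half_pos (lt_min hδ₁ hδ₂)
  have hρ1 : ρ < δ₁ := (half_lt_self (lt_min hδ₁ hδ₂)).trans_le (min_le_left _ _)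
  have hρ2 : ρ < δ₂ := (half_lt_self (lt_min hδ₁ hδ₂)).trans_le (min_le_right _ _)
  have hρ𝒩 : Metric.closedBall 0 ρ ⊆ 𝒩 := (Metric.closedBall_subset_ball hρ2).trans hball
  obtain ⟨m, hm⟩ := (isCompact_sphere (0 : E) ρ).exists_bound_of_continuousOn
    (hU.continuousOn.mono fun ξ hξ => ⟨hρ𝒩 (Metric.sphere_subset_closedBall hξ), fun h => by
      rw [Set.mem_singleton_iff.1 h, mem_sphere_zero_iff_norm, norm_zero] at hξ
      exact hρ0.ne hξ⟩)
  have hm' : ∀ ξ, ‖ξ‖ = ρ → U ξ ≤ m := fun ξ hξ =>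
    (le_abs_self _).trans (hm ξ (mem_sphere_zero_iff_norm.2 hξ))
  set C' := max C 0
  set bd := m + 1 / 2 * (τ * C' + P + Q)
  have hev := hUlim.eventually_gt_atTop bd
  rw [eventually_nhdsWithin_iff, Metric.eventually_nhds_iff] at hev
  obtain ⟨δ₃, hδ₃, hev⟩ := hev
  refine ⟨min ρ δ₃, lt_min hρ0 hδ₃, fun y y' hy hy' h0 ha hC hP hQ t₀ => ?_⟩
  have hcy : Continuous y := continuous_iff_continuousAt.2 fun t => (hy t).continuousAt
  have hcV : Continuous fun t => V t (y t) := continuous_comp_path hV.continuousOn hcy h0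
  wlog ht₀ : t₀ ∈ Set.Ico 0 τ generalizing t₀
  · obtain ⟨u, hu, ε, h⟩ := Function.Antiperiodic.exists_mem_Ico_eq_or (E := E) hτ t₀
    rw [h y ha, norm_units_smul]
    exact this u hu
  by_contra! hlt
  obtain ⟨hlt1, hlt2⟩ := lt_min_iff.1 hlt
  obtain ⟨b, hb, hbρ⟩ : ∃ b ∈ Set.Icc 0 τ, ρ ≤ ‖y b‖ := by
    by_contra! hcon
    have h1 : ∫ _t in (0 : ℝ)..τ, (|P| + 1) / τ ≤ ∫ t in (0 : ℝ)..τ, -V t (y t) :=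
      intervalIntegral.integral_mono_on hτ.le intervalIntegrable_const
        (hcV.neg.intervalIntegrable _ _) fun t ht => by
          have := hsing t (y t) (h0 t) ((hcon t ht).trans hρ1)
          linarith
    rw [intervalIntegral.integral_const, sub_zero, smul_eq_mul, mul_div_cancel₀ _ hτ.ne'] at h1
    linarith [le_abs_self P]
  set φ : ℝ → ℝ := fun t => C' + -V t (y t) with hφ
  have hcφ : Continuous φ := continuous_const.add hcV.neg
  have hφ0 : ∀ t, 0 ≤ φ t := fun t => by
    have h1 := hC t
    have h2 : C ≤ C' := le_max_left _ _
    simp only [hφ]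
    linarith
  have hUφ : ∀ t, y t ∈ 𝒩 \ {0} → ‖gradient U (y t)‖ ^ 2 ≤ φ t := fun t ht =>
    (hUV t _ ht).trans (le_add_of_nonneg_left (le_max_right _ _))
  have hcψ : Continuous fun t => φ t + ‖y' t‖ ^ 2 := hcφ.add (hy'.norm.pow 2)
  have htot : ∫ t in (0 : ℝ)..τ, (φ t + ‖y' t‖ ^ 2) ≤ τ * C' + P + Q := by
    have hcy2 : Continuous fun t => ‖y' t‖ ^ 2 := hy'.norm.pow 2
    have hcVn : Continuous fun t => -V t (y t) := hcV.neg
    rw [intervalIntegral.integral_add (hcφ.intervalIntegrable _ _)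
      (hcy2.intervalIntegrable _ _), hφ,
      intervalIntegral.integral_add intervalIntegrable_const (hcVn.intervalIntegrable _ _),
      intervalIntegral.integral_const, sub_zero, smul_eq_mul]
    linarith
  have hsub : ∀ a b : ℝ, 0 ≤ a → a ≤ b → b ≤ τ →
      ∫ t in a..b, (φ t + ‖y' t‖ ^ 2) ≤ τ * C' + P + Q := fun a b h1 h2 h3 =>
    (intervalIntegral.integral_mono_interval h1 h2 h3
      (ae_of_all _ fun t => add_nonneg (hφ0 t) (sq_nonneg _))
      (hcψ.intervalIntegrable _ _)).trans htot
  have hUbd : U (y t₀) ≤ bd := by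
    rcases le_total t₀ b with h | h
    · have h1 := le_of_strong_force h𝒩 hU hρ𝒩 hm' hy hy' h0 hcφ hφ0 hUφ h hlt1.le hbρ
      have h2 := hsub t₀ b ht₀.1 h hb.2
      simp only [bd]
      linarith
    · have h1 := le_of_strong_force h𝒩 hU hρ𝒩 hm' (y := fun t => y (-t)) (y' := fun t => -y' (-t))
        (φ := fun t => φ (-t)) (a := -t₀) (b := -b)
        (fun t => by
          have := (hy (-t)).scomp t (hasDerivAt_neg t)
          rw [neg_one_smul] at this
          exact this)
        (hy'.comp continuous_neg).neg (fun t => h0 _) (hcφ.comp continuous_neg) (fun t => hφ0 _)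
        (fun t => hUφ _) (neg_le_neg h) (by simpa using hlt1.le) (by simpa using hbρ)
      have h2 := hsub b t₀ hb.1 h ht₀.2.le
      simp only [neg_neg, norm_neg] at h1
      rw [intervalIntegral.integral_comp_neg (fun t => φ t + ‖y' t‖ ^ 2), neg_neg, neg_neg] at h1
      simp only [bd]
      linarith
  refine (hev (y := y t₀) (by rwa [dist_zero_right]) ⟨hρ𝒩 ?_, h0 t₀⟩).not_ge hUbd
  exact mem_closedBall_zero_iff.2 hlt1.le

end IsPairPotential
end PairPotential

section Gradient

variable {F : Type*} [NormedAddCommGroup F] [InnerProductSpace ℝ F]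
  {W : ℝ → F → ℝ} {Ω : Set F}

lemma hasFDerivAt_of_contDiffOn_prod (hΩ : IsOpen Ω)
    (hW : ContDiffOn ℝ 1 (fun p : ℝ × F => W p.1 p.2) (Set.univ ×ˢ Ω)) (t : ℝ) {x : F}
    (hx : x ∈ Ω) : HasFDerivAt (W t) ((fderiv ℝ (fun p : ℝ × F => W p.1 p.2) (t, x)).comp
      (ContinuousLinearMap.inr ℝ ℝ F)) x :=
  ((hW.differentiableOn one_ne_zero).differentiableAt
    ((isOpen_univ.prod hΩ).mem_nhds ⟨trivial, hx⟩)).hasFDerivAt.comp x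
    (hasFDerivAt_prodMk_right t x)

lemma continuousOn_gradient_of_contDiffOn_prod [CompleteSpace F] (hΩ : IsOpen Ω)
    (hW : ContDiffOn ℝ 1 (fun p : ℝ × F => W p.1 p.2) (Set.univ ×ˢ Ω)) :
    ContinuousOn (fun p : ℝ × F => gradient (W p.1) p.2) (Set.univ ×ˢ Ω) := by
  have h := hW.continuousOn_fderiv_of_isOpen (isOpen_univ.prod hΩ) le_rfl
  refine ContinuousOn.congr (f := fun p => (InnerProductSpace.toDual ℝ F).symm
    ((fderiv ℝ (fun p : ℝ × F => W p.1 p.2) p).comp (ContinuousLinearMap.inr ℝ ℝ F)))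
    ?_ fun p hp => ?_
  · exact (LinearIsometryEquiv.continuous _).comp_continuousOn (h.clm_comp continuousOn_const)
  · rw [gradient, (hasFDerivAt_of_contDiffOn_prod hΩ hW p.1 hp.2).fderiv]

lemma gradient_comp_neg [CompleteSpace F] (f : F → ℝ) (x : F) :
    gradient (fun x => f (-x)) x = -gradient f (-x) := by
  have h := fderiv_comp_smul (𝕜 := ℝ) (f := f) (x := x) (-1 : ℝ)
  simp only [neg_smul, one_smul] at h
  rw [gradient, gradient, h, map_neg]

end Gradient

section ManyBody

/-- Configurations of `N` bodies. -/
abbrev Config (N k : ℕ) : Type := PiLp 2 fun _ : Fin N => EuclideanSpace ℝ (Fin k)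

/-- The relative position `x_i - x_j`. -/
def relPos {N k : ℕ} (i j : Fin N) : Config N k →L[ℝ] EuclideanSpace ℝ (Fin k) :=
  PiLp.proj (𝕜 := ℝ) 2 (fun _ : Fin N => EuclideanSpace ℝ (Fin k)) i -
    PiLp.proj (𝕜 := ℝ) 2 (fun _ : Fin N => EuclideanSpace ℝ (Fin k)) j

/-- Configurations without collisions. -/
def collisionFree (N k : ℕ) : Set (Config N k) := {x | ∀ i j, i ≠ j → relPos i j x ≠ 0}

variable {N k : ℕ}

lemma relPos_apply (i j : Fin N) (x : Config N k) : relPos i j x = x i - x j := rfl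

lemma norm_relPos_le (i j : Fin N) (x : Config N k) : ‖relPos i j x‖ ≤ 2 * ‖x‖ := by
  have h1 := PiLp.norm_apply_le x i
  have h2 := PiLp.norm_apply_le x j
  have h3 := norm_sub_le (x i) (x j)
  rw [relPos_apply]
  linarith

lemma norm_relPos_sq_le (i j : Fin N) (x : Config N k) : ‖relPos i j x‖ ^ 2 ≤ 4 * ‖x‖ ^ 2 := by
  nlinarith [norm_relPos_le i j x, norm_nonneg (relPos i j x), norm_nonneg x]

lemma isOpen_collisionFree : IsOpen (collisionFree N k) := by
  simp only [collisionFree, Set.ofPred_forall]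
  exact isOpen_iInter_of_finite fun i => isOpen_iInter_of_finite fun j =>
    isOpen_iInter_of_finite fun _ => isOpen_ne_fun (relPos i j).continuous continuous_const

variable {V : Fin N → Fin N → ℝ → EuclideanSpace ℝ (Fin k) → ℝ} {τ : ℝ}

/-- The total potential as a function on the Hilbert space of configurations. -/
def configPotential (V : Fin N → Fin N → ℝ → EuclideanSpace ℝ (Fin k) → ℝ) (t : ℝ)
    (x : Config N k) : ℝ := Vtot V t x.ofLp

lemma configPotential_eq (t : ℝ) (x : Config N k) : configPotential V t x =
    1 / 2 * ∑ i, ∑ j, if i ≠ j then V i j t (relPos i j x) else 0 := rfl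

lemma contDiffOn_configPotential (hV : ∀ i j, i ≠ j → IsPairPotential τ (V i j)) :
    ContDiffOn ℝ 1 (fun p : ℝ × Config N k => configPotential V p.1 p.2)
      (Set.univ ×ˢ collisionFree N k) := by
  simp only [configPotential_eq]
  refine contDiffOn_const.mul (ContDiffOn.sum fun i _ => ContDiffOn.sum fun j _ => ?_)
  by_cases h : i = j
  · simp only [h, ne_eq, not_true_eq_false, if_false]
    exact contDiffOn_const
  · simp only [h, ne_eq, not_false_eq_true, if_true]
    exact (hV i j h).contDiffOn.comp
      (g := fun p : ℝ × EuclideanSpace ℝ (Fin k) => V i j p.1 p.2)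
      (f := fun p : ℝ × Config N k => (p.1, relPos i j p.2))
      (contDiff_fst.prodMk ((relPos i j).contDiff.comp contDiff_snd)).contDiffOn
      fun p hp => ⟨trivial, hp.2 i j h⟩

lemma configPotential_add_neg (hV : ∀ i j, i ≠ j → IsPairPotential τ (V i j)) (t : ℝ)
    (x : Config N k) : configPotential V (t + τ) (-x) = configPotential V t x := by
  simp only [configPotential_eq, map_neg]
  congr 1
  refine Finset.sum_congr rfl fun i _ => Finset.sum_congr rfl fun j _ => ?_
  split_ifs with h
  · exact (hV i j h).symm t _
  · rfl

lemma hasGradientAt_configPotential (hV : ∀ i j, i ≠ j → IsPairPotential τ (V i j)) (t : ℝ)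
    {x : Config N k} (hx : x ∈ collisionFree N k) :
    HasGradientAt (configPotential V t) (gradient (configPotential V t) x) x :=
  (hasFDerivAt_of_contDiffOn_prod isOpen_collisionFree (contDiffOn_configPotential hV) t
    hx).differentiableAt.hasGradientAt

lemma gradient_configPotential_neg (hV : ∀ i j, i ≠ j → IsPairPotential τ (V i j)) (t : ℝ)
    (x : Config N k) : gradient (configPotential V (t + τ)) (-x) =
      -gradient (configPotential V t) x := by
  have h : configPotential V t = fun x => configPotential V (t + τ) (-x) :=
    funext fun x => (configPotential_add_neg hV t x).symm
  rw [h, gradient_comp_neg, neg_neg]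

/-- The gradient with respect to the position of one body. -/
lemma gradient_update (hV : ∀ i j, i ≠ j → IsPairPotential τ (V i j)) (t : ℝ)
    {x : Config N k} (hx : x ∈ collisionFree N k) (i : Fin N) :
    gradient (fun y => Vtot V t (Function.update x.ofLp i y)) (x i) =
      gradient (configPotential V t) x i := by
  have h1 : HasFDerivAt (fun y => WithLp.toLp 2 (Function.update x.ofLp i y) :
      EuclideanSpace ℝ (Fin k) → Config N k)
      ((PiLp.continuousLinearEquiv 2 ℝ fun _ : Fin N =>
        EuclideanSpace ℝ (Fin k)).symm.toContinuousLinearMap.comp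
      (ContinuousLinearMap.pi (Pi.single i (.id ℝ (EuclideanSpace ℝ (Fin k)))))) (x i) := by
    exact (PiLp.continuousLinearEquiv 2 ℝ fun _ : Fin N =>
      EuclideanSpace ℝ (Fin k)).symm.hasFDerivAt.comp (x i)
      (hasFDerivAt_update x.ofLp (x i))
  have h2 : WithLp.toLp 2 (Function.update x.ofLp i (x i)) = x := by
    rw [Function.update_eq_self]
  have h3 := (hasGradientAt_configPotential hV t hx).hasFDerivAt
  rw [← h2] at h3
  have h4 := h3.comp (x i) h1
  rw [h2] at h4
  refine HasGradientAt.gradient (hasGradientAt_iff_hasFDerivAt.2 (h4.congr_fderiv ?_))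
  ext y
  simp only [ContinuousLinearMap.comp_apply, InnerProductSpace.toDual_apply_apply, PiLp.inner_apply]
  rw [Finset.sum_eq_single i]
  · simp
  · intro b _ hb
    simp [Pi.single_eq_of_ne hb]
  · simp

lemma configPotential_le_of_forall_le {t D : ℝ} {x : Config N k} (hD : 0 ≤ D)
    (h : ∀ i j, i ≠ j → V i j t (relPos i j x) ≤ D) : configPotential V t x ≤ N ^ 2 * D := by
  have h1 : ∑ i, ∑ j, (if i ≠ j then V i j t (relPos i j x) else 0) ≤
      ∑ _i : Fin N, ∑ _j : Fin N, D := by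
    refine Finset.sum_le_sum fun i _ => Finset.sum_le_sum fun j _ => ?_
    split_ifs with hij
    · exact h i j hij
    · exact hD
  have h2 : ∑ _i : Fin N, ∑ _j : Fin N, D = N ^ 2 * D := by
    simp only [Finset.sum_const, Finset.card_univ, Fintype.card_fin, nsmul_eq_mul]
    ring
  have h3 : (0 : ℝ) ≤ N ^ 2 * D := by positivity
  rw [configPotential_eq]
  linarith

/-- Each pair potential is controlled by the total one, given an upper bound for all of them. -/
lemma neg_pair_le {t D : ℝ} {x : Config N k} (hD : 0 ≤ D)
    (h : ∀ i j, i ≠ j → V i j t (relPos i j x) ≤ D) {i j : Fin N} (hij : i ≠ j) :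
    -V i j t (relPos i j x) ≤ N ^ 2 * D - 2 * configPotential V t x := by
  set a : Fin N → Fin N → ℝ := fun i j => if i ≠ j then V i j t (relPos i j x) else 0 with ha
  have h0 : ∀ i j, 0 ≤ D - a i j := by
    intro i j
    simp only [ha]
    split_ifs with hij
    · linarith [h i j hij]
    · linarith
  have h1 : D - a i j ≤ ∑ i, ∑ j, (D - a i j) :=
    (Finset.single_le_sum (fun j _ => h0 i j) (Finset.mem_univ j)).trans
      (Finset.single_le_sum (f := fun i => ∑ j, (D - a i j))
        (fun i _ => Finset.sum_nonneg fun j _ => h0 i j) (Finset.mem_univ i))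
  have h2 : ∑ i, ∑ j, (D - a i j) = N ^ 2 * D - 2 * configPotential V t x := by
    rw [configPotential_eq]
    simp only [Finset.sum_sub_distrib, Finset.sum_const, Finset.card_univ, Fintype.card_fin,
      nsmul_eq_mul]
    ring
  have h3 : a i j = V i j t (relPos i j x) := if_pos hij
  linarith

lemma exists_pair_le (hV : ∀ i j, i ≠ j → IsPairPotential τ (V i j)) (hτ : 0 < τ) {ε : ℝ}
    (hε : 0 < ε) : ∃ C ≥ 0, ∀ i j, i ≠ j → ∀ t, ∀ x ∈ collisionFree N k,
      V i j t (relPos i j x) ≤ C + ε * ‖x‖ ^ 2 := by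
  have h : ∀ i j : Fin N, ∃ C ≥ 0, i ≠ j → ∀ t, ∀ x ∈ collisionFree N k,
      V i j t (relPos i j x) ≤ C + ε * ‖x‖ ^ 2 := by
    intro i j
    by_cases hij : i = j
    · exact ⟨0, le_rfl, fun h => absurd hij h⟩
    · obtain ⟨C, hC, h⟩ := (hV i j hij).exists_le_add_mul_sq hτ (show 0 < ε / 4 by positivity)
      refine ⟨C, hC, fun _ t x hx => (h t _ (hx i j hij)).trans ?_⟩
      nlinarith [norm_relPos_sq_le i j x]
  choose C hC h using h
  refine ⟨∑ i, ∑ j, C i j, Finset.sum_nonneg fun i _ => Finset.sum_nonneg fun j _ => hC i j,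
    fun i j hij t x hx => (h i j hij t x hx).trans ?_⟩
  have h1 : C i j ≤ ∑ i, ∑ j, C i j :=
    (Finset.single_le_sum (fun j _ => hC i j) (Finset.mem_univ j)).trans
      (Finset.single_le_sum (f := fun i => ∑ j, C i j)
        (fun i _ => Finset.sum_nonneg fun j _ => hC i j) (Finset.mem_univ i))
  linarith

lemma exists_configPotential_le (hV : ∀ i j, i ≠ j → IsPairPotential τ (V i j)) (hτ : 0 < τ)
    {ε : ℝ} (hε : 0 < ε) : ∃ C ≥ 0, ∀ t, ∀ x ∈ collisionFree N k,
      configPotential V t x ≤ C + ε * ‖x‖ ^ 2 := by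
  have hN : (0 : ℝ) < N ^ 2 + 1 := by positivity
  obtain ⟨C, hC, h⟩ := exists_pair_le (k := k) hV hτ (show 0 < ε / (N ^ 2 + 1) by positivity)
  refine ⟨N ^ 2 * C, by positivity, fun t x hx => ?_⟩
  refine (configPotential_le_of_forall_le (by positivity) fun i j hij => h i j hij t x hx).trans ?_
  have h1 : N ^ 2 * (ε / (N ^ 2 + 1) * ‖x‖ ^ 2) ≤ ε * ‖x‖ ^ 2 := by
    rw [← mul_assoc]
    refine mul_le_mul_of_nonneg_right ?_ (sq_nonneg _)
    rw [mul_div_assoc', div_le_iff₀ hN]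
    nlinarith
  linarith

/-- Compactness of the sublevels of the action. -/
lemma exists_isCompact_sublevel (hV : ∀ i j, i ≠ j → IsPairPotential τ (V i j)) (hτ : 0 < τ)
    (B : ℝ) : ∃ C ⊆ collisionFree N k, IsCompact C ∧ ∃ R, ∀ v,
      IsVelocity τ (collisionFree N k) v → halfAction τ (configPotential V) v ≤ B →
      (∀ t, antiPrimitive τ v t ∈ C) ∧ ∫ t in (0 : ℝ)..τ, ‖v t‖ ^ 2 ≤ R := by
  obtain ⟨C₀, hC₀, hW⟩ := exists_configPotential_le (k := k) hV hτ
    (show 0 < 1 / (4 * τ ^ 2) by positivity)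
  obtain ⟨C₁, hC₁, hpair⟩ := exists_pair_le (k := k) hV hτ one_pos
  set R := 4 * (|B| + τ * C₀) with hR
  have hR0 : 0 ≤ R := by positivity
  set D := C₁ + τ * R with hD
  have hD0 : 0 ≤ D := by positivity
  have hδ : ∀ i j : Fin N, ∃ δ > 0, i ≠ j → ∀ y y' : ℝ → EuclideanSpace ℝ (Fin k),
      (∀ t, HasDerivAt y (y' t) t) → Continuous y' → (∀ t, y t ≠ 0) →
      Function.Antiperiodic y τ → (∀ t, V i j t (y t) ≤ D) →
      ∫ t in (0 : ℝ)..τ, -V i j t (y t) ≤ τ * (N ^ 2 * D) + 2 * B →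
      ∫ t in (0 : ℝ)..τ, ‖y' t‖ ^ 2 ≤ 4 * R → ∀ t, δ ≤ ‖y t‖ := by
    intro i j
    by_cases hij : i = j
    · exact ⟨1, one_pos, fun h => absurd hij h⟩
    · obtain ⟨δ, hδ, h⟩ := (hV i j hij).exists_le_norm hτ D (τ * (N ^ 2 * D) + 2 * B) (4 * R)
      exact ⟨δ, hδ, fun _ => h⟩
  choose δ hδ0 hδ using hδ
  refine ⟨Metric.closedBall 0 (√(τ * R)) ∩ {x | ∀ i j, i ≠ j → δ i j ≤ ‖relPos i j x‖},
    fun x hx i j hij => norm_pos_iff.1 ((hδ0 i j).trans_le (hx.2 i j hij)),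
    (isCompact_closedBall _ _).inter_right ?_, R, fun v hv hvB => ?_⟩
  · simp only [Set.ofPred_forall]
    exact isClosed_iInter fun i => isClosed_iInter fun j => isClosed_iInter fun _ =>
      isClosed_le continuous_const (relPos i j).continuous.norm
  set x := antiPrimitive τ v with hx
  have hcx : Continuous x := continuous_antiPrimitive hv.continuous
  have hcv2 : Continuous fun t => ‖v t‖ ^ 2 := hv.continuous.norm.pow 2
  have hcW : Continuous fun t => configPotential V t (x t) :=
    continuous_comp_path (contDiffOn_configPotential hV).continuousOn hcx hv.mem
  set K := ∫ t in (0 : ℝ)..τ, ‖v t‖ ^ 2 with hK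
  have hK0 : 0 ≤ K := intervalIntegral.integral_nonneg hτ.le fun t _ => sq_nonneg _
  have hxK : ∀ t, ‖x t‖ ^ 2 ≤ τ * K := fun t => by
    have h := norm_antiPrimitive_le hτ hv.continuous hv.antiperiodic t
    calc ‖x t‖ ^ 2 ≤ √(τ * K) ^ 2 := by gcongr
      _ = τ * K := Real.sq_sqrt (by positivity)
  have hact : 1 / 2 * K - ∫ t in (0 : ℝ)..τ, configPotential V t (x t) ≤ B := by
    rw [halfAction, intervalIntegral.integral_sub ((hcv2.intervalIntegrable _ _).const_mul _)
      (hcW.intervalIntegrable _ _), intervalIntegral.integral_const_mul] at hvB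
    exact hvB
  have hWint : ∫ t in (0 : ℝ)..τ, configPotential V t (x t) ≤ τ * C₀ + K / 4 := by
    calc ∫ t in (0 : ℝ)..τ, configPotential V t (x t)
        ≤ ∫ _t in (0 : ℝ)..τ, (C₀ + 1 / (4 * τ ^ 2) * (τ * K)) := by
          refine intervalIntegral.integral_mono_on hτ.le (hcW.intervalIntegrable _ _)
            intervalIntegrable_const fun t _ => (hW t _ (hv.mem t)).trans ?_
          gcongr
          exact hxK t
      _ = τ * C₀ + K / 4 := by
          rw [intervalIntegral.integral_const, smul_eq_mul]
          field_simp
          ring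
  have hKR : K ≤ R := by
    have := le_abs_self B
    linarith
  have hpairD : ∀ t, ∀ i j, i ≠ j → V i j t (relPos i j (x t)) ≤ D := fun t i j hij =>
    (hpair i j hij t _ (hv.mem t)).trans <| by
      have h1 := hxK t
      have h2 : τ * K ≤ τ * R := by gcongr
      linarith
  refine ⟨fun t => ⟨?_, fun i j hij => ?_⟩, hKR⟩
  · rw [mem_closedBall_zero_iff]
    refine Real.le_sqrt_of_sq_le ((hxK t).trans ?_)
    gcongr
  · refine hδ i j hij (fun t => relPos i j (x t)) (fun t => relPos i j (v t))
      (fun t => (relPos i j).hasFDerivAt.comp_hasDerivAt t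
        (hasDerivAt_antiPrimitive hv.continuous t))
      ((relPos i j).continuous.comp hv.continuous) (fun t => hv.mem t i j hij) (fun t => ?_)
      (fun t => hpairD t i j hij) ?_ ?_ t
    · simp only [hx]
      rw [antiperiodic_antiPrimitive hv.continuous hv.antiperiodic t, map_neg]
    · have hcVij : Continuous fun t => V i j t (relPos i j (x t)) :=
        continuous_comp_path (hV i j hij).continuousOn ((relPos i j).continuous.comp hcx)
          fun t => hv.mem t i j hij
      have hcW2 : Continuous fun t => 2 * configPotential V t (x t) := continuous_const.mul hcW
      have h1 : ∫ t in (0 : ℝ)..τ, -V i j t (relPos i j (x t)) ≤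
          ∫ t in (0 : ℝ)..τ, (N ^ 2 * D - 2 * configPotential V t (x t)) :=
        intervalIntegral.integral_mono_on hτ.le (hcVij.neg.intervalIntegrable _ _)
          ((continuous_const.sub hcW2).intervalIntegrable _ _)
          fun t _ => neg_pair_le hD0 (hpairD t) hij
      rw [intervalIntegral.integral_sub intervalIntegrable_const (hcW2.intervalIntegrable _ _),
        intervalIntegral.integral_const, intervalIntegral.integral_const_mul, sub_zero,
        smul_eq_mul] at h1
      linarith
    · calc ∫ t in (0 : ℝ)..τ, ‖relPos i j (v t)‖ ^ 2 ≤ ∫ t in (0 : ℝ)..τ, 4 * ‖v t‖ ^ 2 :=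
            intervalIntegral.integral_mono_on hτ.le
              ((((relPos i j).continuous.comp hv.continuous).norm.pow 2).intervalIntegrable _ _)
              ((hcv2.intervalIntegrable _ _).const_mul _) fun t _ => norm_relPos_sq_le i j (v t)
        _ = 4 * K := intervalIntegral.integral_const_mul _ _
        _ ≤ 4 * R := by linarith

lemma isCoerciveSystem_configPotential (hV : ∀ i j, i ≠ j → IsPairPotential τ (V i j))
    (hτ : 0 < τ) : IsCoerciveSystem τ (collisionFree N k) (configPotential V)
      fun t => gradient (configPotential V t) where
  pos := hτ
  isOpen := isOpen_collisionFree
  continuousOn_potential := (contDiffOn_configPotential hV).continuousOn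
  continuousOn_gradient :=
    continuousOn_gradient_of_contDiffOn_prod isOpen_collisionFree (contDiffOn_configPotential hV)
  hasFDerivAt t _ hx := (hasGradientAt_configPotential hV t hx).hasFDerivAt
  gradient_neg t _ _ _ := gradient_configPotential_neg hV t _
  compact := exists_isCompact_sublevel hV hτ

end ManyBody

section Reflection

variable {E : Type*} [NormedAddCommGroup E] [InnerProductSpace ℝ E]

/-- The reflection in the hyperplane orthogonal to `p`, in a form continuous in `p ≠ 0`. -/
def hyperReflect (p x : E) : E := x - (2 * inner ℝ p x / inner ℝ p p) • p

lemma inner_hyperReflect {p : E} (hp : p ≠ 0) (x y : E) :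
    inner ℝ (hyperReflect p x) (hyperReflect p y) = inner ℝ x y := by
  have h : inner ℝ p p ≠ 0 := inner_self_ne_zero.2 hp
  simp only [hyperReflect, inner_sub_left, inner_sub_right, real_inner_smul_left,
    real_inner_smul_right, real_inner_comm p x]
  field_simp
  ring

lemma Continuous.hyperReflect {X : Type*} [TopologicalSpace X] {f g : X → E} (hf : Continuous f)
    (hg : Continuous g) (h0 : ∀ x, f x ≠ 0) : Continuous fun x => hyperReflect (f x) (g x) :=
  hg.sub ((((continuous_const.mul (hf.inner hg)).div (hf.inner hf)
    fun x => inner_self_ne_zero.2 (h0 x))).smul hf)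

/-- An isometry taking `b` to the half-line spanned by the unit vector `e`. -/
def rotateTo (e b x : E) : E := hyperReflect e (hyperReflect (b + ‖b‖ • e) x)

variable {e b : E}

lemma add_norm_smul_ne_zero (he : ‖e‖ = 1) (h : 0 < inner ℝ b e) : b + ‖b‖ • e ≠ 0 := by
  intro h0
  have h1 : inner ℝ (b + ‖b‖ • e) e = 0 := by rw [h0, inner_zero_left]
  rw [inner_add_left, real_inner_smul_left, real_inner_self_eq_norm_sq, he] at h1
  have := norm_nonneg b
  linarith

lemma inner_rotateTo (he : ‖e‖ = 1) (h : 0 < inner ℝ b e) (x y : E) :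
    inner ℝ (rotateTo e b x) (rotateTo e b y) = inner ℝ x y := by
  have he0 : e ≠ 0 := norm_ne_zero_iff.1 (by rw [he]; exact one_ne_zero)
  rw [rotateTo, rotateTo, inner_hyperReflect he0, inner_hyperReflect (add_norm_smul_ne_zero he h)]

lemma rotateTo_self (he : ‖e‖ = 1) (h : 0 < inner ℝ b e) : rotateTo e b b = ‖b‖ • e := by
  have h0 : inner ℝ (b + ‖b‖ • e) (b + ‖b‖ • e) ≠ 0 :=
    inner_self_ne_zero.2 (add_norm_smul_ne_zero he h)
  have h1 : 2 * inner ℝ (b + ‖b‖ • e) b = inner ℝ (b + ‖b‖ • e) (b + ‖b‖ • e) := by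
    simp only [inner_add_left, inner_add_right, real_inner_smul_left, real_inner_smul_right,
      real_inner_self_eq_norm_sq, norm_smul, norm_norm, he, real_inner_comm b e]
    ring
  have h2 : hyperReflect (b + ‖b‖ • e) b = -(‖b‖ • e) := by
    rw [hyperReflect, h1, div_self h0, one_smul]
    abel
  rw [rotateTo, h2, hyperReflect, inner_neg_right, real_inner_smul_right,
    real_inner_self_eq_norm_sq, he]
  module

lemma rotateTo_smul_axis (he : ‖e‖ = 1) {β : ℝ} (hβ : 0 < β) (x : E) :
    rotateTo e (β • e) x = x := by
  have h : β • e + ‖β • e‖ • e = (2 * β) • e := by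
    rw [norm_smul, he, Real.norm_of_nonneg hβ.le]
    module
  have h1 : inner ℝ e e = (1 : ℝ) := by rw [real_inner_self_eq_norm_sq, he, one_pow]
  have h2 : hyperReflect ((2 * β) • e) x = x - (2 * inner ℝ e x) • e := by
    rw [hyperReflect, real_inner_smul_left, real_inner_smul_left, real_inner_smul_right, h1,
      smul_smul]
    congr 2
    field_simp
  rw [rotateTo, h, h2, hyperReflect, inner_sub_right, real_inner_smul_right, h1]
  module

lemma continuous_rotateTo {X : Type*} [TopologicalSpace X] {f g : X → E} (he : ‖e‖ = 1)
    (hf : Continuous f) (hg : Continuous g) (h : ∀ x, 0 < inner ℝ (f x) e) :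
    Continuous fun x => rotateTo e (f x) (g x) :=
  continuous_const.hyperReflect
    ((hf.add (hf.norm.smul continuous_const)).hyperReflect hg
      fun x => add_norm_smul_ne_zero he (h x))
    fun _ => norm_ne_zero_iff.1 (by rw [he]; exact one_ne_zero)

lemma norm_eq_of_inner {A : E → E} (hA : ∀ x y, inner ℝ (A x) (A y) = inner ℝ x y) (x : E) :
    ‖A x‖ = ‖x‖ := by
  have := hA x x
  rw [real_inner_self_eq_norm_sq, real_inner_self_eq_norm_sq] at this
  exact (sq_eq_sq₀ (norm_nonneg _) (norm_nonneg _)).1 this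

end Reflection

section Coordinates

variable {d : ℕ}

/-- The splitting of a vector into its first coordinate and the remaining ones. -/
def splitFirst (d : ℕ) : EuclideanSpace ℝ (Fin (d + 2)) ≃L[ℝ] ℝ × (Fin (d + 1) → ℝ) :=
  (EuclideanSpace.equiv (Fin (d + 2)) ℝ).trans (Fin.consEquivL ℝ fun _ : Fin (d + 2) => ℝ).symm

lemma splitFirst_fst (x : EuclideanSpace ℝ (Fin (d + 2))) : (splitFirst d x).1 = x 0 := rfl

lemma splitFirst_snd (x : EuclideanSpace ℝ (Fin (d + 2))) (j : Fin (d + 1)) :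
    (splitFirst d x).2 j = x j.succ := rfl

/-- The first coordinate vector. -/
def firstAxis (d : ℕ) : EuclideanSpace ℝ (Fin (d + 2)) := EuclideanSpace.single 0 1

lemma norm_firstAxis : ‖firstAxis d‖ = 1 := by simp [firstAxis]

lemma splitFirst_firstAxis : splitFirst d (firstAxis d) = (1, 0) := by
  refine Prod.ext ?_ (funext fun j => ?_)
  · rw [splitFirst_fst]
    simp [firstAxis]
  · rw [splitFirst_snd]
    simp [firstAxis]

lemma splitFirst_smul_firstAxis (c : ℝ) : (splitFirst d (c • firstAxis d)).2 = 0 := by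
  rw [map_smul, splitFirst_firstAxis]
  simp

end Coordinates

section Trivialization
open unitInterval

variable {n d : ℕ} {τ : ℝ}

instance : CompactSpace (UnitFamily n d) := by
  refine isCompact_iff_compactSpace.1 ?_
  have h : {s : Fin n → Fin (d + 1) → ℝ | ∀ i, ‖s i‖ = 1} =
      Set.univ.pi fun _ => Metric.sphere 0 1 := by
    ext s
    simp
  change IsCompact {s : Fin n → Fin (d + 1) → ℝ | ∀ i, ‖s i‖ = 1}
  rw [h]
  exact isCompact_univ_pi fun _ => isCompact_sphere _ _

/-- Nowhere vanishing families of arcs with both ends on the first axis. -/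
def IsArcFamily (f : C(UnitFamily n d × I, ℝ × (Fin (d + 1) → ℝ))) : Prop :=
  (∀ x, f x ≠ 0) ∧ (∀ s, (f (s, 0)).2 = 0) ∧ ∀ s, (f (s, 1)).2 = 0

/-- The family of arcs `basePath`. -/
def baseArcs (n d : ℕ) : C(UnitFamily n d × I, ℝ × (Fin (d + 1) → ℝ)) where
  toFun p := basePath p.1 p.2
  continuous_toFun := by
    have h : ∀ i : Fin n, Continuous fun p : UnitFamily n d × I => timeBump i p.2 := fun i =>
      (contDiff_timeBump i).continuous.comp (continuous_subtype_val.comp continuous_snd)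
    have h2 : Continuous fun p : UnitFamily n d × I => baseAxis n p.2 := by
      unfold baseAxis
      fun_prop
    have h3 : ∀ i : Fin n, Continuous fun p : UnitFamily n d × I => p.1.1 i := fun i =>
      (continuous_apply i).comp (continuous_subtype_val.comp continuous_fst)
    exact h2.prodMk (continuous_finsetSum _ fun i _ => (h i).smul (h3 i))

/-- The family of arcs `y`, turned so as to start on the positive first axis, is homotopic to
the base family. -/
def IsTrivialized (τ : ℝ) (y : UnitFamily n d → ℝ → EuclideanSpace ℝ (Fin (d + 2))) : Prop :=
  ∃ A : UnitFamily n d → EuclideanSpace ℝ (Fin (d + 2)) → EuclideanSpace ℝ (Fin (d + 2)),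
    (Continuous fun p : UnitFamily n d × EuclideanSpace ℝ (Fin (d + 2)) => A p.1 p.2) ∧
    (∀ s x x', inner ℝ (A s x) (A s x') = inner ℝ x x') ∧
    (∀ s, A s (y s 0) = ‖y s 0‖ • firstAxis d) ∧
    ∃ f, ContinuousMap.HomotopicWith (baseArcs n d) f IsArcFamily ∧
      ∀ s t, f (s, t) = splitFirst d (A s (y s (τ * t)))

lemma isArcFamily_baseArcs (hn : Odd n) : IsArcFamily (baseArcs n d) := by
  refine ⟨fun x => basePath_ne_zero hn _ _, fun s => ?_, fun s => ?_⟩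
  · change (basePath s 0).2 = 0
    rw [basePath_zero]
  · change (basePath s 1).2 = 0
    rw [← zero_add (1 : ℝ), basePath_add_one hn, basePath_zero]
    simp

lemma isTrivialized_base (hn : Odd n)
    {y : UnitFamily n d → ℝ → EuclideanSpace ℝ (Fin (d + 2))}
    (hy : ∀ s, ∀ t : I, y s (τ * t) = (splitFirst d).symm (basePath s t)) : IsTrivialized τ y := by
  refine ⟨fun _ x => x, continuous_snd, fun _ _ _ => rfl, fun s => ?_, baseArcs n d,
    ContinuousMap.HomotopicWith.refl _ (isArcFamily_baseArcs hn), fun s t => ?_⟩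
  · have h := hy s 0
    rw [Set.Icc.coe_zero, mul_zero, basePath_zero, ← splitFirst_firstAxis,
      ContinuousLinearEquiv.symm_apply_apply] at h
    rw [h, norm_firstAxis, one_smul]
  · rw [hy, ContinuousLinearEquiv.apply_symm_apply]
    rfl

/-- Trivializations persist under small perturbations. -/
lemma IsTrivialized.of_norm_sub_lt {y y' : UnitFamily n d → ℝ → EuclideanSpace ℝ (Fin (d + 2))}
    (h : IsTrivialized τ y) (hy : Continuous fun p : UnitFamily n d × ℝ => y p.1 p.2)
    (hy' : Continuous fun p : UnitFamily n d × ℝ => y' p.1 p.2) (ha : ∀ s, y s τ = -y s 0)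
    (ha' : ∀ s, y' s τ = -y' s 0) (hlt : ∀ s t, ‖y' s t - y s t‖ < ‖y s t‖) :
    IsTrivialized τ y' := by
  obtain ⟨A, hA, hAi, hA0, f, hf, hfA⟩ := h
  set e := firstAxis d with he
  have he1 : ‖e‖ = 1 := norm_firstAxis
  set z : I → UnitFamily n d → ℝ → EuclideanSpace ℝ (Fin (d + 2)) := fun l s t =>
    y s t + (l : ℝ) • (y' s t - y s t) with hz
  have hz0 : ∀ s t, z 0 s t = y s t := fun s t => by simp [hz]
  have hz1 : ∀ s t, z 1 s t = y' s t := fun s t => by simp [hz]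
  have hzc : Continuous fun p : I × UnitFamily n d × ℝ => z p.1 p.2.1 p.2.2 := by
    have h1 : Continuous fun p : I × UnitFamily n d × ℝ => y p.2.1 p.2.2 := hy.comp continuous_snd
    have h2 : Continuous fun p : I × UnitFamily n d × ℝ => y' p.2.1 p.2.2 :=
      hy'.comp continuous_snd
    exact h1.add ((continuous_subtype_val.comp continuous_fst).smul (h2.sub h1))
  have hzpos : ∀ l s t, 0 < inner ℝ (z l s t) (y s t) := by
    intro l s t
    have h1 := hlt s t
    have h2 : ‖(l : ℝ) • (y' s t - y s t)‖ < ‖y s t‖ := by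
      rw [norm_smul, Real.norm_of_nonneg l.2.1]
      exact (mul_le_of_le_one_left (norm_nonneg _) l.2.2).trans_lt h1
    have h3 := (abs_le.1 (abs_real_inner_le_norm ((l : ℝ) • (y' s t - y s t)) (y s t))).1
    have h4 : 0 < ‖y s t‖ := (norm_nonneg _).trans_lt h1
    simp only [hz]
    rw [inner_add_left, real_inner_self_eq_norm_sq]
    nlinarith
  have hzne : ∀ l s t, z l s t ≠ 0 := fun l s t h0 => by
    have := hzpos l s t
    rw [h0, inner_zero_left] at this
    exact lt_irrefl _ this
  have hza : ∀ l s, z l s τ = -z l s 0 := fun l s => by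
    simp only [hz, ha, ha']
    module
  have hy0 : ∀ s, 0 < ‖y s 0‖ := fun s => (norm_nonneg _).trans_lt (hlt s 0)
  set b : I → UnitFamily n d → EuclideanSpace ℝ (Fin (d + 2)) := fun l s => A s (z l s 0) with hb
  have hbpos : ∀ l s, 0 < inner ℝ (b l s) e := by
    intro l s
    have h1 := hzpos l s 0
    rw [← hAi s, hA0, real_inner_smul_right] at h1
    exact pos_of_mul_pos_right h1 (hy0 s).le
  have hbc : Continuous fun p : I × UnitFamily n d => b p.1 p.2 :=
    hA.comp (continuous_snd.prodMk
      (hzc.comp (continuous_fst.prodMk (continuous_snd.prodMk continuous_const))))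
  set A' : I → UnitFamily n d → EuclideanSpace ℝ (Fin (d + 2)) → EuclideanSpace ℝ (Fin (d + 2)) :=
    fun l s x => rotateTo e (b l s) (A s x) with hA'
  have hA'i : ∀ l s x x', inner ℝ (A' l s x) (A' l s x') = inner ℝ x x' := fun l s x x' => by
    simp only [hA']
    rw [inner_rotateTo he1 (hbpos l s), hAi]
  have hA'0 : ∀ l s, A' l s (z l s 0) = ‖z l s 0‖ • e := fun l s => by
    simp only [hA']
    rw [rotateTo_self he1 (hbpos l s), norm_eq_of_inner (hAi s)]
  have hA'neg : ∀ l s x, A' l s (-x) = -A' l s x := fun l s x => by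
    refine eq_neg_of_add_eq_zero_left (norm_eq_zero.1 (pow_eq_zero_iff two_ne_zero |>.1 ?_))
    rw [← real_inner_self_eq_norm_sq]
    simp only [inner_add_left, inner_add_right, hA'i, inner_neg_left, inner_neg_right]
    ring
  have hAc : Continuous fun p : I × UnitFamily n d × I =>
      A' p.1 p.2.1 (z p.1 p.2.1 (τ * p.2.2)) := by
    have h1 : Continuous fun p : I × UnitFamily n d × I => z p.1 p.2.1 (τ * p.2.2) :=
      hzc.comp (g := fun p : I × UnitFamily n d × ℝ => z p.1 p.2.1 p.2.2)
        (f := fun p : I × UnitFamily n d × I => (p.1, p.2.1, τ * (p.2.2 : ℝ))) (by fun_prop)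
    refine continuous_rotateTo he1 ?_ ?_ fun p => hbpos p.1 p.2.1
    · exact hbc.comp (continuous_fst.prodMk (continuous_fst.comp continuous_snd))
    · exact hA.comp ((continuous_fst.comp continuous_snd).prodMk h1)
  set H : C(I × UnitFamily n d × I, ℝ × (Fin (d + 1) → ℝ)) :=
    ⟨fun p => splitFirst d (A' p.1 p.2.1 (z p.1 p.2.1 (τ * p.2.2))),
      (splitFirst d).continuous.comp hAc⟩ with hH
  refine ⟨A' 1, ?_, hA'i 1, fun s => ?_, H.curry 1,
    hf.trans ⟨⟨⟨H, fun x => ?_, fun x => rfl⟩, ?_⟩⟩, fun s t => ?_⟩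
  · exact continuous_rotateTo he1 (hbc.comp (continuous_const.prodMk continuous_fst)) hA
      fun p => hbpos 1 p.1
  · have := hA'0 1 s
    rwa [hz1] at this
  · change splitFirst d (A' 0 x.1 (z 0 x.1 (τ * x.2))) = f x
    rw [show f x = _ from hfA x.1 x.2]
    simp only [hA', hb, hz0, hA0]
    rw [rotateTo_smul_axis he1 (hy0 _)]
  · intro l
    refine ⟨fun x => ?_, fun s => ?_, fun s => ?_⟩
    · change splitFirst d (A' l x.1 (z l x.1 (τ * x.2))) ≠ 0
      refine (map_ne_zero_iff _ (splitFirst d).injective).2 (norm_ne_zero_iff.1 ?_)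
      rw [norm_eq_of_inner (hA'i l x.1)]
      exact norm_ne_zero_iff.2 (hzne _ _ _)
    · change (splitFirst d (A' l s (z l s (τ * (0 : I))))).2 = 0
      rw [Set.Icc.coe_zero, mul_zero, hA'0, splitFirst_smul_firstAxis]
    · change (splitFirst d (A' l s (z l s (τ * (1 : I))))).2 = 0
      rw [Set.Icc.coe_one, mul_one, hza, hA'neg, hA'0, ← neg_smul, splitFirst_smul_firstAxis]
  · change splitFirst d (A' 1 s (z 1 s (τ * t))) = _
    rw [hz1]

/-- Some member of a trivialized family turns back `n - 1` times. -/
lemma IsTrivialized.exists_alternation (hn : Odd n)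
    {y : UnitFamily n d → ℝ → EuclideanSpace ℝ (Fin (d + 2))} (h : IsTrivialized τ y) :
    ∃ s, ∃ t : Fin n → I, Monotone t ∧ ∀ i j : Fin n, (j : ℕ) = i + 1 →
      inner ℝ (y s (τ * t i)) (y s (τ * t j)) < 0 := by
  obtain ⟨A, -, hAi, -, f, ⟨H⟩, hfA⟩ := h
  obtain ⟨s, t, ht, hs⟩ := exists_alternation_basePath hn (Z := H.toContinuousMap)
    (fun x => (H.prop x.1).1 x.2) (fun l s => (H.prop l).2.1 s) (fun l s => (H.prop l).2.2 s)
    (fun s t => H.apply_zero (s, t))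
  refine ⟨s, t, ht, fun i j hij => ?_⟩
  have hval : ∀ i, H.toContinuousMap (1, s, t i) = splitFirst d (A s (y s (τ * t i))) := fun i =>
    (H.apply_one (s, t i)).trans (hfA s (t i))
  simp only [hval] at hs
  obtain ⟨hi1, hi2, hi3⟩ := hs i
  obtain ⟨hj1, hj2, hj3⟩ := hs j
  simp only [splitFirst_fst, splitFirst_snd] at hi1 hi2 hi3 hj1 hj2 hj3
  rw [← hAi s, PiLp.inner_apply, Fin.sum_univ_succ, Fin.sum_univ_succ]
  rw [Finset.sum_eq_zero fun l _ => by rw [hi2 l.succ (Fin.succ_ne_zero l), inner_zero_left], hi1,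
    inner_zero_left, zero_add, add_zero]
  rw [hij, pow_succ] at hj3
  have h1 := mul_pos hi3 hj3
  have h2 : ((-1 : ℝ) ^ (i : ℕ)) * (-1) ^ (i : ℕ) = 1 := by
    rw [← mul_pow]
    simp
  simp only [RCLike.inner_apply, conj_trivial]
  nlinarith

end Trivialization

section FamilyOfVelocities

variable {F E M : Type*} [NormedAddCommGroup F] [InnerProductSpace ℝ F]
  [NormedAddCommGroup E] [InnerProductSpace ℝ E] [TopologicalSpace M] {τ : ℝ} {Ω : Set F}
  {W : ℝ → F → ℝ} {G : ℝ → F → F}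

lemma continuous_comp_family {X Y : Type*} [TopologicalSpace X] [TopologicalSpace Y] {Ω : Set X}
    {H : ℝ → X → Y} {x : M → ℝ → X}
    (hH : ContinuousOn (fun p : ℝ × X => H p.1 p.2) (Set.univ ×ˢ Ω))
    (hx : Continuous fun p : M × ℝ => x p.1 p.2) (hm : ∀ m t, x m t ∈ Ω) :
    Continuous fun p : M × ℝ => H p.2 (x p.1 p.2) :=
  hH.comp_continuous (continuous_snd.prodMk hx) fun p => ⟨trivial, hm p.1 p.2⟩

namespace IsCoerciveSystem

lemma continuous_eulerStep_family [CompleteSpace F] (S : IsCoerciveSystem τ Ω W G) {h : M → ℝ → F}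
    (hv : ∀ m, IsVelocity τ Ω (h m)) (hc : Continuous fun p : M × ℝ => h p.1 p.2) (s : ℝ) :
    Continuous fun p : M × ℝ => eulerStep τ G s (h p.1) p.2 := by
  have h1 := continuous_antiPrimitive_parametric (τ := τ) hc
  have h2 := (continuous_comp_family S.continuousOn_gradient h1 fun m => (hv m).mem).neg
  have h3 := continuous_antiPrimitive_parametric (τ := τ)
    (g := fun m t => -G t (antiPrimitive τ (h m) t)) h2
  exact hc.sub (continuous_const.smul (hc.sub h3))

lemma exists_forall_halfAction_le [CompactSpace M] [FirstCountableTopology M]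
    (S : IsCoerciveSystem τ Ω W G) {h : M → ℝ → F} (hv : ∀ m, IsVelocity τ Ω (h m))
    (hc : Continuous fun p : M × ℝ => h p.1 p.2) : ∃ B, ∀ m, halfAction τ W (h m) ≤ B := by
  have h1 := continuous_antiPrimitive_parametric (τ := τ) hc
  have h2 := continuous_comp_family S.continuousOn_potential h1 fun m => (hv m).mem
  have hsq : Continuous fun p : M × ℝ => (1 / 2 : ℝ) * ‖h p.1 p.2‖ ^ 2 := by fun_prop
  have hint : Continuous fun p : M × ℝ =>
      1 / 2 * ‖h p.1 p.2‖ ^ 2 - W p.2 (antiPrimitive τ (h p.1) p.2) := hsq.sub h2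
  have h3 : Continuous fun m => halfAction τ W (h m) :=
    intervalIntegral.continuous_parametric_intervalIntegral_of_continuous'
      (f := fun m t => 1 / 2 * ‖h m t‖ ^ 2 - W t (antiPrimitive τ (h m) t)) hint 0 τ
  obtain ⟨B, hB⟩ := (isCompact_range h3).bddAbove
  exact ⟨B, fun m => hB ⟨m, rfl⟩⟩

lemma exists_pos_le_norm (S : IsCoerciveSystem τ Ω W G) {L : F →L[ℝ] E}
    (hL : ∀ x ∈ Ω, L x ≠ 0) (B : ℝ) : ∃ δ > 0, ∃ R, ∀ v, IsVelocity τ Ω v →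
      halfAction τ W v ≤ B → (∀ t, δ ≤ ‖L (antiPrimitive τ v t)‖) ∧
        ∫ t in (0 : ℝ)..τ, ‖v t‖ ^ 2 ≤ R := by
  obtain ⟨C, hCΩ, hC, R, h⟩ := S.compact B
  obtain ⟨δ, hδ, hδC⟩ := hC.exists_forall_le' (f := fun x => ‖L x‖) L.continuous.norm.continuousOn
    (a := 0) fun x hx => norm_pos_iff.2 (hL x (hCΩ hx))
  exact ⟨δ, hδ, R, fun v hv hB => ⟨fun t => hδC _ ((h v hv hB).1 t), (h v hv hB).2⟩⟩

end IsCoerciveSystem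

/-- A path that turns back many times is long. -/
lemma mul_le_integral_norm_of_alternation {n : ℕ} {δ : ℝ} {y y' : ℝ → E} [CompleteSpace E]
    (hy : ∀ t, HasDerivAt y (y' t) t) (hy' : Continuous y') (hδ : 0 ≤ δ) (hδy : ∀ t, δ ≤ ‖y t‖)
    {a : Fin (n + 1) → ℝ} (ha : Monotone a) (haτ : ∀ i, a i ∈ Set.Icc 0 τ)
    (hneg : ∀ i j : Fin (n + 1), (j : ℕ) = i + 1 → inner ℝ (y (a i)) (y (a j)) < 0) :
    n * δ ≤ ∫ t in (0 : ℝ)..τ, ‖y' t‖ := by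
  set b : ℕ → ℝ := fun i => a (Fin.ofNat (n + 1) (min i n)) with hb
  have hval : ∀ i ≤ n, ((Fin.ofNat (n + 1) (min i n) : Fin (n + 1)) : ℕ) = i := fun i hi => by
    rw [Fin.val_ofNat, min_eq_left hi, Nat.mod_eq_of_lt (Nat.lt_succ_of_le hi)]
  have hstep : ∀ i ∈ Finset.range n, δ ≤ ∫ t in b i..b (i + 1), ‖y' t‖ := by
    intro i hi
    have hi' := Finset.mem_range.1 hi
    have h1 := hval i hi'.le
    have h2 := hval (i + 1) hi'
    have hle : b i ≤ b (i + 1) := ha (by rw [Fin.le_def, h1, h2]; exact Nat.le_succ i)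
    have h3 : inner ℝ (y (b i)) (y (b (i + 1))) < 0 := hneg _ _ (by rw [h1, h2])
    have h4 := norm_sub_sq_real (y (b (i + 1))) (y (b i))
    rw [real_inner_comm] at h4
    have h5 : δ ≤ ‖y (b (i + 1)) - y (b i)‖ := by
      refine (sq_le_sq₀ hδ (norm_nonneg _)).1 ?_
      have h6 : δ ^ 2 ≤ ‖y (b (i + 1))‖ ^ 2 := by gcongr; exact hδy _
      nlinarith [sq_nonneg ‖y (b i)‖]
    rw [← intervalIntegral.integral_eq_sub_of_hasDerivAt (fun t _ => hy t)
      (hy'.intervalIntegrable _ _)] at h5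
    exact h5.trans (intervalIntegral.norm_integral_le_integral_norm hle)
  have hsum := Finset.sum_le_sum hstep
  rw [intervalIntegral.sum_integral_adjacent_intervals fun k _ => hy'.norm.intervalIntegrable _ _,
    Finset.sum_const, Finset.card_range, nsmul_eq_mul] at hsum
  have h0n : b 0 ≤ b n := ha (by
    rw [Fin.le_def, hval 0 (Nat.zero_le n), hval n le_rfl]
    exact Nat.zero_le n)
  exact hsum.trans (intervalIntegral.integral_mono_interval (haτ _).1 h0n (haτ _).2
    (ae_of_all _ fun t => norm_nonneg _) (hy'.norm.intervalIntegrable _ _))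

end FamilyOfVelocities

section Unbounded

variable {n d : ℕ} {τ : ℝ}

lemma exists_baseVelocity : ∃ v : UnitFamily n d → ℝ → ℝ × (Fin (d + 1) → ℝ),
    (Continuous fun p : UnitFamily n d × ℝ => v p.1 p.2) ∧
      ∀ s t, HasDerivAt (basePath s) (v s t) t := by
  have hb : ContDiff ℝ 1 (baseAxis n) :=
    Real.contDiff_cos.comp (contDiff_const.mul contDiff_id)
  refine ⟨fun s t => (deriv (baseAxis n) t, ∑ i, deriv (timeBump i) t • s.1 i), ?_, fun s t => ?_⟩
  · have h : ∀ i : Fin n, Continuous fun p : UnitFamily n d × ℝ => p.1.1 i := fun i =>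
      (continuous_apply i).comp (continuous_subtype_val.comp continuous_fst)
    exact ((hb.continuous_deriv le_rfl).comp continuous_snd).prodMk
      (continuous_finsetSum _ fun i _ =>
        (((contDiff_timeBump i).continuous_deriv le_rfl).comp continuous_snd).smul (h i))
  · exact ((hb.differentiable one_ne_zero t).hasDerivAt).prodMk
      (HasDerivAt.fun_sum fun i _ =>
        ((contDiff_timeBump i).differentiable one_ne_zero t).hasDerivAt.smul_const _)

variable {F : Type*} [NormedAddCommGroup F] [InnerProductSpace ℝ F] [FiniteDimensional ℝ F]
  {Ω : Set F} {W : ℝ → F → ℝ} {G : ℝ → F → F}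

lemma exists_trivialized_family (hn : Odd n) (hτ : 0 < τ)
    {L : F →L[ℝ] EuclideanSpace ℝ (Fin (d + 2))} {J : EuclideanSpace ℝ (Fin (d + 2)) →L[ℝ] F}
    (hLJ : ∀ y, L (J y) = y) (hJ : ∀ y, y ≠ 0 → J y ∈ Ω) :
    ∃ h : UnitFamily n d → ℝ → F, (∀ s, IsVelocity τ Ω (h s)) ∧
      (Continuous fun p : UnitFamily n d × ℝ => h p.1 p.2) ∧
      IsTrivialized τ fun s t => L (antiPrimitive τ (h s) t) := by
  obtain ⟨v, hvc, hv⟩ := exists_baseVelocity (n := n) (d := d)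
  set P : ℝ × (Fin (d + 1) → ℝ) →L[ℝ] F := J.comp (splitFirst d).symm.toContinuousLinearMap with hP
  set h : UnitFamily n d → ℝ → F := fun s t => P (τ⁻¹ • v s (τ⁻¹ * t)) with hh
  set x : UnitFamily n d → ℝ → F := fun s t => P (basePath s (τ⁻¹ * t)) with hx
  have hxh : ∀ s t, HasDerivAt (x s) (h s t) t := fun s t =>
    P.hasFDerivAt.comp_hasDerivAt t <| (hv s (τ⁻¹ * t)).scomp t <| by
      simpa using (hasDerivAt_id t).const_mul τ⁻¹
  have hvτ : Continuous fun p : UnitFamily n d × ℝ => v p.1 (τ⁻¹ * p.2) :=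
    hvc.comp (g := fun p : UnitFamily n d × ℝ => v p.1 p.2)
      (f := fun p : UnitFamily n d × ℝ => (p.1, τ⁻¹ * p.2)) (by fun_prop)
  have hc : Continuous fun p : UnitFamily n d × ℝ => h p.1 p.2 :=
    P.continuous.comp (hvτ.const_smul τ⁻¹)
  have hch : ∀ s, Continuous (h s) := fun s => hc.comp (continuous_const.prodMk continuous_id)
  have hxa : ∀ s, Function.Antiperiodic (x s) τ := fun s t => by
    simp only [hx]
    rw [mul_add, inv_mul_cancel₀ hτ.ne', basePath_add_one hn, map_neg]
  have hha : ∀ s, Function.Antiperiodic (h s) τ := fun s t => by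
    have h1 := (hxh s (t + τ)).comp_add_const t τ
    rw [show (fun t => x s (t + τ)) = fun t => -x s t from funext (hxa s)] at h1
    exact h1.unique (hxh s t).neg
  have hprim : ∀ s, antiPrimitive τ (h s) = x s := fun s =>
    (eq_antiPrimitive (hch s) (hxh s) (hxa s)).symm
  refine ⟨h, fun s => ⟨hch s, hha s, fun t => ?_⟩, hc, isTrivialized_base hn fun s t => ?_⟩
  · rw [hprim]
    exact hJ _ fun h0 => basePath_ne_zero hn s (τ⁻¹ * t) (by simpa using h0)
  · rw [hprim]
    simp only [hx, hP]
    rw [inv_mul_cancel_left₀ hτ.ne']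
    exact hLJ _

/-- A coercive system whose configurations project to a punctured space of dimension at least two
has antiperiodic solutions of arbitrarily large action. -/
theorem IsCoerciveSystem.exists_le_halfAction (S : IsCoerciveSystem τ Ω W G)
    {L : F →L[ℝ] EuclideanSpace ℝ (Fin (d + 2))} {J : EuclideanSpace ℝ (Fin (d + 2)) →L[ℝ] F}
    (hL : ∀ x ∈ Ω, L x ≠ 0) (hLJ : ∀ y, L (J y) = y) (hJ : ∀ y, y ≠ 0 → J y ∈ Ω) (A : ℝ) :
    ∃ v, IsVelocity τ Ω v ∧ response τ G v = v ∧ A ≤ halfAction τ W v := by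
  by_contra! hA
  obtain ⟨δ, hδ, R, hR⟩ := S.exists_pos_le_norm hL (A + 1)
  obtain ⟨m, hm⟩ := exists_nat_gt (‖L‖ * √(τ * R) / δ)
  set n := 2 * m with hn
  have hodd : Odd (n + 1) := ⟨m, rfl⟩
  obtain ⟨h₀, h₀v, h₀c, h₀t⟩ := exists_trivialized_family (n := n + 1) hodd S.pos hLJ hJ
  obtain ⟨B₀, hB₀⟩ := S.exists_forall_halfAction_le h₀v h₀c
  set B := max B₀ (A + 1)
  obtain ⟨δ', hδ', R', hR'⟩ := S.exists_pos_le_norm hL B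
  obtain ⟨h, ⟨hv, hc, ht⟩, hA1⟩ := S.exists_family_le hA (B := B) (le_max_right _ _)
    (ε := δ' / (‖L‖ + 1)) (by positivity)
    (Γ := fun h => (∀ s, IsVelocity τ Ω (h s)) ∧
      (Continuous fun p : UnitFamily (n + 1) d × ℝ => h p.1 p.2) ∧
      IsTrivialized τ fun s t => L (antiPrimitive τ (h s) t))
    (fun h hΓ => hΓ.1) (fun h hΓ hB s hs hv' => by
      obtain ⟨hv, hc, ht⟩ := hΓ
      have hc' := S.continuous_eulerStep_family hv hc s
      have hτ0 : ∀ {h : UnitFamily (n + 1) d → ℝ → F}, (∀ m, IsVelocity τ Ω (h m)) → ∀ m,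
          L (antiPrimitive τ (h m) τ) = -L (antiPrimitive τ (h m) 0) := fun hv m => by
        rw [← map_neg, ← (antiperiodic_antiPrimitive (hv m).continuous (hv m).antiperiodic).eq]
      refine ⟨hv', hc', ht.of_norm_sub_lt
        (L.continuous.comp (continuous_antiPrimitive_parametric hc))
        (L.continuous.comp (continuous_antiPrimitive_parametric
          (g := fun m => eulerStep τ G s (h m)) hc')) (hτ0 hv) (hτ0 hv')
        fun m t => ?_⟩
      refine lt_of_lt_of_le ?_ ((hR' _ (hv m) (hB m)).1 t)
      rw [S.antiPrimitive_eulerStep (hv m), ← map_sub, sub_sub_cancel_left, map_neg, norm_neg]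
      have h1 := (L.le_opNorm _).trans (mul_le_mul_of_nonneg_left (hs m t) (norm_nonneg L))
      refine h1.trans_lt ?_
      rw [mul_div_assoc', div_lt_iff₀ (by positivity)]
      nlinarith [norm_nonneg L])
    ⟨h₀v, h₀c, h₀t⟩ fun m => (hB₀ m).trans (le_max_left _ _)
  obtain ⟨s, t, htm, halt⟩ := ht.exists_alternation hodd
  obtain ⟨hδs, hRs⟩ := hR _ (hv s) (hA1 s)
  have hcv := (hv s).continuous
  have hlen := mul_le_integral_norm_of_alternation (τ := τ)
    (y := fun t => L (antiPrimitive τ (h s) t))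
    (y' := fun t => L (h s t)) (a := fun i => τ * t i)
    (fun t => L.hasFDerivAt.comp_hasDerivAt t (hasDerivAt_antiPrimitive hcv t))
    (L.continuous.comp hcv) hδ.le hδs
    (fun i j hij => mul_le_mul_of_nonneg_left (htm hij) S.pos.le)
    (fun i => ⟨mul_nonneg S.pos.le (t i).2.1, mul_le_of_le_one_right S.pos.le (t i).2.2⟩) halt
  have h1 : ∫ u in (0 : ℝ)..τ, ‖L (h s u)‖ ≤ ‖L‖ * ∫ u in (0 : ℝ)..τ, ‖h s u‖ := by
    rw [← intervalIntegral.integral_const_mul]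
    exact intervalIntegral.integral_mono_on S.pos.le
      ((L.continuous.comp hcv).norm.intervalIntegrable _ _)
      ((hcv.norm.intervalIntegrable _ _).const_mul _) fun u _ => L.le_opNorm _
  have h2 : ∫ u in (0 : ℝ)..τ, ‖h s u‖ ≤ √(τ * R) := by
    refine Real.le_sqrt_of_sq_le ((sq_integral_norm_le S.pos.le hcv).trans ?_)
    rw [sub_zero]
    exact mul_le_mul_of_nonneg_left hRs S.pos.le
  have h3 := mul_le_mul_of_nonneg_left h2 (norm_nonneg L)
  rw [div_lt_iff₀ hδ] at hm
  have h4 : (n : ℝ) = 2 * m := by rw [hn]; push_cast; rfl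
  rw [h4] at hlen
  have h5 : (0 : ℝ) ≤ m * δ := by positivity
  linarith

end Unbounded

section Assembly

lemma contDiff_two_of_hasDerivAt {E : Type*} [NormedAddCommGroup E] [NormedSpace ℝ E]
    {x v a : ℝ → E} (hx : ∀ t, HasDerivAt x (v t) t) (hv : ∀ t, HasDerivAt v (a t) t)
    (ha : Continuous a) : ContDiff ℝ 2 x := by
  have h1 : deriv x = v := funext fun t => (hx t).deriv
  have h2 : deriv v = a := funext fun t => (hv t).deriv
  have h3 : ContDiff ℝ 1 v :=
    contDiff_one_iff_deriv.2 ⟨fun t => (hv t).differentiableAt, h2 ▸ ha⟩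
  rw [show (2 : WithTop ℕ∞) = 1 + 1 by norm_num, contDiff_succ_iff_deriv, h1]
  exact ⟨fun t => (hx t).differentiableAt, by simp, h3⟩

lemma Function.Periodic.intervalIntegral_zero_two_mul {f : ℝ → ℝ} {τ : ℝ}
    (hf : Function.Periodic f τ) (hc : Continuous f) :
    ∫ t in (0 : ℝ)..2 * τ, f t = 2 * ∫ t in (0 : ℝ)..τ, f t := by
  have h := hf.intervalIntegral_add_eq τ 0
  rw [zero_add, ← two_mul] at h
  rw [← intervalIntegral.integral_add_adjacent_intervals (hc.intervalIntegrable 0 τ)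
    (hc.intervalIntegrable τ (2 * τ)), h, two_mul]

section Projection

variable {F E : Type*} [NormedAddCommGroup F] [InnerProductSpace ℝ F] [FiniteDimensional ℝ F]
  [NormedAddCommGroup E] [NormedSpace ℝ E] {τ : ℝ} {Ω : Set F} {W : ℝ → F → ℝ} {G : ℝ → F → F}
  {v : ℝ → F}

lemma deriv_comp_antiPrimitive (hv : IsVelocity τ Ω v) (p : F →L[ℝ] E) :
    deriv (fun s => p (antiPrimitive τ v s)) = fun t => p (v t) :=
  funext fun t => (p.hasFDerivAt.comp_hasDerivAt t
    (hasDerivAt_antiPrimitive hv.continuous t)).deriv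

/-- Fixed points of the response are velocities of solutions of the equations of motion. -/
lemma IsCoerciveSystem.contDiff_and_deriv_deriv (S : IsCoerciveSystem τ Ω W G)
    (hv : IsVelocity τ Ω v) (h : response τ G v = v) (p : F →L[ℝ] E) :
    ContDiff ℝ 2 (fun s => p (antiPrimitive τ v s)) ∧
      ∀ t, deriv (deriv fun s => p (antiPrimitive τ v s)) t =
        p (-G t (antiPrimitive τ v t)) := by
  have h1 : ∀ t, HasDerivAt (response τ G v) (-G t (antiPrimitive τ v t)) t := fun t =>
    hasDerivAt_antiPrimitive (S.continuous_force hv) t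
  rw [h] at h1
  have h2 := fun t => p.hasFDerivAt.comp_hasDerivAt t (h1 t)
  refine ⟨contDiff_two_of_hasDerivAt (fun t => p.hasFDerivAt.comp_hasDerivAt t
    (hasDerivAt_antiPrimitive hv.continuous t)) h2
    (p.continuous.comp (S.continuous_force hv)), fun t => ?_⟩
  rw [deriv_comp_antiPrimitive hv p]
  exact (h2 t).deriv

end Projection

variable {N k : ℕ} {V : Fin N → Fin N → ℝ → EuclideanSpace ℝ (Fin k) → ℝ} {τ : ℝ}

/-- The position of one body. -/
def bodyPos {N k : ℕ} (i : Fin N) : Config N k →L[ℝ] EuclideanSpace ℝ (Fin k) :=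
  PiLp.proj (𝕜 := ℝ) 2 (fun _ : Fin N => EuclideanSpace ℝ (Fin k)) i

/-- The collinear configuration of equally spaced bodies with the given spacing. -/
def collinear (N k : ℕ) : EuclideanSpace ℝ (Fin k) →L[ℝ] Config N k :=
  (PiLp.continuousLinearEquiv 2 ℝ fun _ : Fin N =>
    EuclideanSpace ℝ (Fin k)).symm.toContinuousLinearMap.comp
    (ContinuousLinearMap.pi fun j : Fin N => (j : ℝ) • ContinuousLinearMap.id ℝ _)

lemma relPos_collinear (i j : Fin N) (y : EuclideanSpace ℝ (Fin k)) :
    relPos i j (collinear N k y) = ((i : ℝ) - j) • y := by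
  rw [sub_smul]
  rfl

lemma exists_solution_le_halfAction (hN : 2 ≤ N) (hk : 2 ≤ k)
    (hV : ∀ i j, i ≠ j → IsPairPotential τ (V i j)) (hτ : 0 < τ) (A : ℝ) :
    ∃ v, IsVelocity τ (collisionFree N k) v ∧
      response τ (fun t => gradient (configPotential V t)) v = v ∧
      A ≤ halfAction τ (configPotential V) v := by
  obtain ⟨d, rfl⟩ := Nat.exists_eq_add_of_le' hk
  refine (isCoerciveSystem_configPotential hV hτ).exists_le_halfAction
    (L := relPos ⟨1, hN⟩ ⟨0, by lia⟩) (J := collinear N (d + 2))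
    (fun x hx => hx _ _ (by simp)) (fun y => by simp [relPos_collinear])
    (fun y hy i j hij => ?_) A
  rw [relPos_collinear]
  refine smul_ne_zero (sub_ne_zero.2 ?_) hy
  exact_mod_cast Fin.val_ne_of_ne hij

lemma action_antiPrimitive (hV : ∀ i j, i ≠ j → IsPairPotential τ (V i j)) (hτ : 0 < τ)
    (m : Fin N → ℝ) {v : ℝ → Config N k} (hv : IsVelocity τ (collisionFree N k) v) :
    action (2 * τ) m V (fun t => (antiPrimitive τ v t).ofLp) =
      2 * (1 / 2 * ∑ i, m i * (∫ t in (0 : ℝ)..τ, ‖v t i‖ ^ 2) -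
        ∫ t in (0 : ℝ)..τ, configPotential V t (antiPrimitive τ v t)) := by
  have hd : ∀ i t, deriv (fun s => antiPrimitive τ v s i) t = v t i := fun i =>
    congrFun (deriv_comp_antiPrimitive hv (bodyPos i))
  have hkin : ∀ i, ∫ t in (0 : ℝ)..2 * τ, ‖v t i‖ ^ 2 = 2 * ∫ t in (0 : ℝ)..τ, ‖v t i‖ ^ 2 := by
    intro i
    have hc : Continuous fun t => v t i :=
      ((bodyPos i).continuous).comp hv.continuous
    refine Function.Periodic.intervalIntegral_zero_two_mul (fun t => ?_) (hc.norm.pow 2)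
    rw [hv.antiperiodic t, PiLp.neg_apply, norm_neg]
  have hpot : ∫ t in (0 : ℝ)..2 * τ, configPotential V t (antiPrimitive τ v t) =
      2 * ∫ t in (0 : ℝ)..τ, configPotential V t (antiPrimitive τ v t) := by
    refine Function.Periodic.intervalIntegral_zero_two_mul (fun t => ?_)
      ((isCoerciveSystem_configPotential hV hτ).continuous_potential hv)
    rw [antiperiodic_antiPrimitive hv.continuous hv.antiperiodic t, configPotential_add_neg hV]
  simp only [action, hd, hkin]
  rw [mul_sub, ← hpot]
  congr 1
  simp only [Finset.mul_sum]
  exact Finset.sum_congr rfl fun i _ => by ring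

/-- Up to constants, the action controls the action with unit masses over half a period. -/
lemma exists_halfAction_le_action (hV : ∀ i j, i ≠ j → IsPairPotential τ (V i j)) (hτ : 0 < τ)
    {m : Fin N → ℝ} (hm : ∀ i, 0 < m i) : ∃ μ > 0, ∃ D, ∀ v : ℝ → Config N k,
      IsVelocity τ (collisionFree N k) v → μ * halfAction τ (configPotential V) v - D ≤
        action (2 * τ) m V fun t => (antiPrimitive τ v t).ofLp := by
  obtain ⟨μ, hμ, hμ1, hμm⟩ : ∃ μ > 0, μ ≤ 1 ∧ ∀ i, μ ≤ m i := by
    have h : ∀ᶠ μ in nhdsWithin (0 : ℝ) (Set.Ioi 0), μ ≤ 1 ∧ ∀ i, μ ≤ m i := by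
      refine nhdsWithin_le_nhds ((eventually_le_nhds one_pos).and (eventually_all.2 fun i => ?_))
      exact eventually_le_nhds (hm i)
    obtain ⟨μ, h1, h2⟩ := (h.and self_mem_nhdsWithin).exists
    exact ⟨μ, h2, h1⟩
  obtain ⟨C, hC, hW⟩ := exists_configPotential_le (k := k) hV hτ
    (show 0 < μ / (4 * τ ^ 2) by positivity)
  refine ⟨μ, hμ, 2 * (τ * C), fun v hv => ?_⟩
  have hS := isCoerciveSystem_configPotential hV hτ
  set K := ∫ t in (0 : ℝ)..τ, ‖v t‖ ^ 2 with hK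
  have hK0 : 0 ≤ K := intervalIntegral.integral_nonneg hτ.le fun t _ => by positivity
  have hx : ∀ t, ‖antiPrimitive τ v t‖ ^ 2 ≤ τ * K := fun t => by
    have h := norm_antiPrimitive_le hτ hv.continuous hv.antiperiodic t
    calc ‖antiPrimitive τ v t‖ ^ 2 ≤ √(τ * K) ^ 2 := by gcongr
      _ = τ * K := Real.sq_sqrt (by positivity)
  have hI : ∫ t in (0 : ℝ)..τ, configPotential V t (antiPrimitive τ v t) ≤
      τ * C + μ / 4 * K := by
    calc _ ≤ ∫ _t in (0 : ℝ)..τ, (C + μ / (4 * τ ^ 2) * (τ * K)) := by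
          refine intervalIntegral.integral_mono_on hτ.le
            ((hS.continuous_potential hv).intervalIntegrable _ _) (by simp) fun t _ => ?_
          have h1 := hx t
          have h2 := hW t _ (hv.mem t)
          have h3 : μ / (4 * τ ^ 2) * ‖antiPrimitive τ v t‖ ^ 2 ≤ μ / (4 * τ ^ 2) * (τ * K) := by
            gcongr
          linarith
      _ = τ * C + μ / 4 * K := by
          rw [intervalIntegral.integral_const, smul_eq_mul, sub_zero]
          field_simp
  have hkin : μ * K ≤ ∑ i, m i * (∫ t in (0 : ℝ)..τ, ‖v t i‖ ^ 2) := by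
    have hc : ∀ i, Continuous fun t => ‖v t i‖ ^ 2 := fun i =>
      (((bodyPos i).continuous).comp hv.continuous).norm.pow 2
    have h1 : K = ∑ i, ∫ t in (0 : ℝ)..τ, ‖v t i‖ ^ 2 := by
      rw [← intervalIntegral.integral_finsetSum fun i _ => (hc i).intervalIntegrable _ _]
      simp only [hK, PiLp.norm_sq_eq_of_L2]
    rw [h1, Finset.mul_sum]
    refine Finset.sum_le_sum fun i _ => mul_le_mul_of_nonneg_right (hμm i) ?_
    exact intervalIntegral.integral_nonneg hτ.le fun t _ => by positivity
  rw [action_antiPrimitive hV hτ m hv, hS.halfAction_eq hv]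
  set I := ∫ t in (0 : ℝ)..τ, configPotential V t (antiPrimitive τ v t)
  have h1 : (1 - μ / 2) * I ≤ (1 - μ / 2) * (τ * C + μ / 4 * K) := by
    gcongr
    linarith
  have h2 : 0 ≤ μ / 2 * (τ * C + μ / 4 * K) := by positivity
  linarith

lemma contDiff_and_solves (hV : ∀ i j, i ≠ j → IsPairPotential τ (V i j)) (hτ : 0 < τ)
    {v : ℝ → Config N k} (hv : IsVelocity τ (collisionFree N k) v)
    (h : response τ (fun t => gradient (configPotential V t)) v = v) :
    (∀ i, ContDiff ℝ 2 fun t => antiPrimitive τ v t i) ∧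
      ∀ t i, deriv (deriv fun s => antiPrimitive τ v s i) t +
        gradient (fun y => Vtot V t (Function.update (antiPrimitive τ v t).ofLp i y))
          (antiPrimitive τ v t i) = 0 := by
  have hS := isCoerciveSystem_configPotential hV hτ
  refine ⟨fun i => (hS.contDiff_and_deriv_deriv hv h (bodyPos i)).1, fun t i => ?_⟩
  rw [gradient_update hV t (hv.mem t) i]
  have h1 := (hS.contDiff_and_deriv_deriv hv h (bodyPos i)).2 t
  rw [map_neg] at h1
  exact add_eq_zero_iff_eq_neg.2 h1

end Assembly

theorem nbody_subquadratic_unbounded_actions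
    {N k : ℕ} (hN : 2 ≤ N) (hk : 2 ≤ k)
    (T : ℝ) (hT : 0 < T)
    (m : Fin N → ℝ) (hm : ∀ i, 0 < m i)
    (Vij : Fin N → Fin N → ℝ → EuclideanSpace ℝ (Fin k) → ℝ)
    -- (V1)-(V2): each `V_{ij}` is `C¹` on `ℝ × (ℝ^k ∖ {0})`
    (hC1 : ∀ i j, i ≠ j →
      ContDiffOn ℝ 1 (fun p : ℝ × EuclideanSpace ℝ (Fin k) => Vij i j p.1 p.2)
        (Set.univ ×ˢ {(0 : EuclideanSpace ℝ (Fin k))}ᶜ))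
    -- `T`-periodicity in time
    (hper : ∀ i j t ξ, Vij i j (t + T) ξ = Vij i j t ξ)
    -- (V3): `V_{ij}(t,ξ) → -∞` uniformly in `t` as `|ξ| → 0`
    (hV3 : ∀ i j, i ≠ j → ∀ M : ℝ, ∃ δ > (0:ℝ), ∀ t : ℝ,
      ∀ ξ : EuclideanSpace ℝ (Fin k), ξ ≠ 0 → ‖ξ‖ < δ → Vij i j t ξ < -M)
    -- (V5): Gordon's strong force condition
    (hV5 : ∀ i j, i ≠ j → ∃ 𝒩 : Set (EuclideanSpace ℝ (Fin k)),
      IsOpen 𝒩 ∧ (0 : EuclideanSpace ℝ (Fin k)) ∈ 𝒩 ∧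
      ∃ U : EuclideanSpace ℝ (Fin k) → ℝ, ContDiffOn ℝ 1 U (𝒩 \ {0}) ∧
        Tendsto U (nhdsWithin 0 (𝒩 \ {0})) atTop ∧
        ∀ t : ℝ, ∀ ξ ∈ 𝒩 \ {0}, ‖gradient U ξ‖ ^ 2 ≤ -Vij i j t ξ)
    -- (V6): the symmetry `V_{ij}(t + T/2, -ξ) = V_{ij}(t, ξ)`
    (hV6 : ∀ i j t ξ, Vij i j (t + T / 2) (-ξ) = Vij i j t ξ)
    -- (V4)': sub-quadratic growth at infinity
    (hV4' : ∃ g > (0:ℝ), ∃ θ < (2:ℝ), ∃ r > (0:ℝ), ∀ i j, i ≠ j →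
      ∀ (t : ℝ) (ξ : EuclideanSpace ℝ (Fin k)), r < ‖ξ‖ →
        Vij i j t ξ ≤ g * m i * m j * ‖ξ‖ ^ θ) :
    ∃ X : ℕ → ℝ → Fin N → EuclideanSpace ℝ (Fin k),
      (∀ n : ℕ,
        (∀ i, ContDiff ℝ 2 fun t => X n t i) ∧
        (∀ t i, X n (t + T) i = X n t i) ∧
        (∀ t i, X n (t + T / 2) i = -X n t i) ∧
        (∀ t, ∀ i j, i ≠ j → X n t i ≠ X n t j) ∧
        (∀ t i, deriv (deriv fun s => X n s i) t
          + gradient (fun y => Vtot Vij t (Function.update (X n t) i y)) (X n t i) = 0)) ∧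
      Tendsto (fun n => action T m Vij (X n)) atTop atTop := by
  have hτ : 0 < T / 2 := by positivity
  have hV : ∀ i j, i ≠ j → IsPairPotential (T / 2) (Vij i j) := fun i j hij =>
    { contDiffOn := hC1 i j hij
      symm := hV6 i j
      singular := hV3 i j hij
      strong := hV5 i j hij
      growth := fun ε hε => by
        obtain ⟨g, -, θ, hθ, r, -, h⟩ := hV4'
        obtain ⟨R, hR⟩ := exists_rpow_le_mul_sq (g * m i * m j) hθ hε
        exact ⟨max r R, fun t ξ hξ => (h i j hij t ξ ((le_max_left _ _).trans_lt hξ)).trans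
          (hR _ ((le_max_right _ _).trans_lt hξ))⟩ }
  obtain ⟨μ, hμ, D, hD⟩ := exists_halfAction_le_action (k := k) hV hτ hm
  choose v hv hsol hA using fun n : ℕ =>
    exists_solution_le_halfAction hN hk hV hτ (((n : ℝ) + D) / μ)
  have hS := isCoerciveSystem_configPotential hV hτ
  have ha : ∀ n t, antiPrimitive (T / 2) (v n) (t + T / 2) = -antiPrimitive (T / 2) (v n) t :=
    fun n => antiperiodic_antiPrimitive (hv n).continuous (hv n).antiperiodic
  refine ⟨fun n t => (antiPrimitive (T / 2) (v n) t).ofLp, fun n => ?_, ?_⟩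
  · obtain ⟨h2, hode⟩ := contDiff_and_solves hV hτ (hv n) (hsol n)
    refine ⟨h2, fun t i => ?_, fun t i => ?_, fun t i j hij h => ?_, hode⟩
    · simp only
      rw [show t + T = t + T / 2 + T / 2 by ring, ha, ha, neg_neg]
    · simp only [ha]
      rfl
    · exact (hv n).mem t i j hij (sub_eq_zero.2 h)
  · refine tendsto_atTop_mono (fun n => ?_) tendsto_natCast_atTop_atTop
    have h1 := hD (v n) (hv n)
    have h2 := mul_le_mul_of_nonneg_left (hA n) hμ.le
    rw [mul_div_cancel₀ _ hμ.ne'] at h2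
    rw [mul_div_cancel₀ T two_ne_zero] at h1
    linarith

end
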